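/- Assume Hypotheses (H) and let s ∈ [0,T) and f ∈ C_b(ℝ^N). Then the Cauchy problem D_t u = 𝒜u on (s,T]×ℝ^N, u(s,·)=f, admits a unique bounded classical solution u; moreover ‖u(t,·)‖_∞ ≤ e^{c₀(t−s)}‖f‖_∞ for every t ∈ [s,T], where c₀ is the upper bound of c from Hypotheses (H)(iv). -/

import Mathlib

open Set Filter MeasureTheory Metric
open scoped Topology ENNReal RealInnerProductSpace Classical

noncomputable section

/-- `ℝ^N` with the Euclidean norm. -/
abbrev ES (N : ℕ) := EuclideanSpace ℝ (Fin N)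

/-- First-order partial derivative `D_i f` in the `i`-th coordinate direction. -/
def pd1 {N : ℕ} (f : ES N → ℝ) (i : Fin N) : ES N → ℝ :=
  fun x => fderiv ℝ f x (EuclideanSpace.single i 1)

/-- Second-order partial derivative `D_{ij} f`. -/
def pd2 {N : ℕ} (f : ES N → ℝ) (i j : Fin N) : ES N → ℝ := pd1 (pd1 f j) i

/-- Third-order partial derivative `D_{ijk} f`. -/
def pd3 {N : ℕ} (f : ES N → ℝ) (i j k : Fin N) : ES N → ℝ := pd1 (pd2 f j k) i

/-- The nonautonomous elliptic operator
`(𝒜 φ)(t,x) = ∑ᵢⱼ qᵢⱼ(t,x) Dᵢⱼφ(x) + ∑ⱼ bⱼ(t,x) Dⱼφ(x) + c(t,x) φ(x)`. -/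
def Aop {N : ℕ} (q : ℝ → ES N → Fin N → Fin N → ℝ) (b : ℝ → ES N → Fin N → ℝ)
    (c : ℝ → ES N → ℝ) (φ : ES N → ℝ) (t : ℝ) (x : ES N) : ℝ :=
  (∑ i, ∑ j, q t x i j * pd2 φ i j x) + (∑ j, b t x j * pd1 φ j x) + c t x * φ x

/-- Membership in the parabolic Hölder space `C^{δ/2,δ}([0,T] × B(0,R))`. -/
def ParabolicHolderOn {N : ℕ} (T δ R : ℝ) (h : ℝ → ES N → ℝ) : Prop :=
  ∃ C : ℝ, ∀ t ∈ Icc (0:ℝ) T, ∀ s ∈ Icc (0:ℝ) T,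
    ∀ x ∈ closedBall (0 : ES N) R, ∀ y ∈ closedBall (0 : ES N) R,
      |h t x - h s y| ≤ C * (|t - s| + ‖x - y‖ ^ 2) ^ (δ / 2)

/-- Hypotheses (H) of Lorenzi's paper (smooth unbounded coefficients). -/
structure Hyp (N : ℕ) (T : ℝ) (q : ℝ → ES N → Fin N → Fin N → ℝ)
    (b : ℝ → ES N → Fin N → ℝ) (c : ℝ → ES N → ℝ) where
  T_pos : 0 < T
  N_pos : 1 ≤ N
  /- (i) smoothness in space and parabolic Hölder regularity up to third-order
     spatial derivatives on `[0,T] × B(0,R)` for every `R`. -/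
  δ : ℝ
  δ_mem : δ ∈ Ioo (0:ℝ) 1
  smooth_q : ∀ t ∈ Icc (0:ℝ) T, ∀ i j, ContDiff ℝ 3 fun x => q t x i j
  smooth_b : ∀ t ∈ Icc (0:ℝ) T, ∀ j, ContDiff ℝ 3 fun x => b t x j
  smooth_c : ∀ t ∈ Icc (0:ℝ) T, ContDiff ℝ 3 fun x => c t x
  holder_q : ∀ R > 0, ∀ i j, ParabolicHolderOn T δ R fun t x => q t x i j
  holder_q1 : ∀ R > 0, ∀ i j k, ParabolicHolderOn T δ R fun t x => pd1 (fun y => q t y i j) k x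
  holder_q2 : ∀ R > 0, ∀ i j k l, ParabolicHolderOn T δ R fun t x => pd2 (fun y => q t y i j) k l x
  holder_q3 : ∀ R > 0, ∀ i j k l m, ParabolicHolderOn T δ R fun t x => pd3 (fun y => q t y i j) k l m x
  holder_b : ∀ R > 0, ∀ j, ParabolicHolderOn T δ R fun t x => b t x j
  holder_b1 : ∀ R > 0, ∀ j k, ParabolicHolderOn T δ R fun t x => pd1 (fun y => b t y j) k x
  holder_b2 : ∀ R > 0, ∀ j k l, ParabolicHolderOn T δ R fun t x => pd2 (fun y => b t y j) k l x
  holder_b3 : ∀ R > 0, ∀ j k l m, ParabolicHolderOn T δ R fun t x => pd3 (fun y => b t y j) k l m x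
  holder_c : ∀ R > 0, ParabolicHolderOn T δ R c
  holder_c1 : ∀ R > 0, ∀ k, ParabolicHolderOn T δ R fun t x => pd1 (c t) k x
  holder_c2 : ∀ R > 0, ∀ k l, ParabolicHolderOn T δ R fun t x => pd2 (c t) k l x
  holder_c3 : ∀ R > 0, ∀ k l m, ParabolicHolderOn T δ R fun t x => pd3 (c t) k l m x
  /- (ii) symmetry and (uniform) ellipticity. -/
  q_symm : ∀ t ∈ Icc (0:ℝ) T, ∀ x i j, q t x i j = q t x j i
  ν : ℝ → ES N → ℝ
  ν₀ : ℝ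
  ν₀_pos : 0 < ν₀
  ν_lb : ∀ t ∈ Icc (0:ℝ) T, ∀ x, ν₀ ≤ ν t x
  ellip : ∀ t ∈ Icc (0:ℝ) T, ∀ x, ∀ ξ : ES N, ν t x * ‖ξ‖ ^ 2 ≤ ∑ i, ∑ j, q t x i j * ξ i * ξ j
  /- (iii) growth conditions. -/
  C₁ : ℝ
  C₂ : ℝ
  C₃ : ℝ
  C₁_pos : 0 < C₁
  C₂_pos : 0 < C₂
  C₃_pos : 0 < C₃
  growth_Q : ∀ t ∈ Icc (0:ℝ) T, ∀ x,
    ‖(EuclideanSpace.equiv (Fin N) ℝ).symm fun i => ∑ j, q t x i j * x j‖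
      ≤ C₁ * (1 + ‖x‖ ^ 2) * ν t x
  growth_tr : ∀ t ∈ Icc (0:ℝ) T, ∀ x, (∑ i, q t x i i) ≤ C₂ * (1 + ‖x‖ ^ 2) * ν t x
  growth_b : ∀ t ∈ Icc (0:ℝ) T, ∀ x, (∑ j, b t x j * x j) ≤ C₃ * (1 + ‖x‖ ^ 2) * ν t x
  /- (iv) `c` is bounded from above. -/
  c₀ : ℝ
  c_ub : ∀ t ∈ Icc (0:ℝ) T, ∀ x, c t x ≤ c₀
  /- (v) bounds on the derivatives of the diffusion coefficients. -/
  K₁ : ℝ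
  K₂ : ℝ
  K₃ : ℝ
  K₁_pos : 0 < K₁
  K₂_pos : 0 < K₂
  K₃_pos : 0 < K₃
  dq1_bound : ∀ t ∈ Icc (0:ℝ) T, ∀ x i j k, |pd1 (fun y => q t y i j) k x| ≤ K₁ * ν t x
  dq3_bound : ∀ t ∈ Icc (0:ℝ) T, ∀ x i j k l m, |pd3 (fun y => q t y i j) k l m x| ≤ K₃ * ν t x
  dq2_quad : ∀ t ∈ Icc (0:ℝ) T, ∀ x, ∀ Ξ : Fin N → Fin N → ℝ, (∀ h k, Ξ h k = Ξ k h) →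
    (∑ h, ∑ k, ∑ l, ∑ m, pd2 (fun y => q t y h k) l m x * Ξ h k * Ξ l m)
      ≤ K₂ * ν t x * ∑ h, ∑ k, Ξ h k ^ 2
  /- (vi) dissipativity and bounds on the derivatives of the drift and of `c`. -/
  d : ℝ → ES N → ℝ
  r : ℝ → ES N → ℝ
  ϱ : ℝ → ES N → ℝ
  ϱ₀ : ℝ
  ϱ₀_pos : 0 < ϱ₀
  ϱ_lb : ∀ t ∈ Icc (0:ℝ) T, ∀ x, ϱ₀ ≤ ϱ t x
  L₁ : ℝ
  L₂ : ℝ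
  L₃ : ℝ
  L₁_pos : 0 < L₁
  L₂_pos : 0 < L₂
  L₃_pos : 0 < L₃
  dissip : ∀ t ∈ Icc (0:ℝ) T, ∀ x, ∀ ξ : ES N,
    (∑ i, ∑ j, pd1 (fun y => b t y i) j x * ξ j * ξ i) ≤ d t x * ‖ξ‖ ^ 2
  db2_bound : ∀ t ∈ Icc (0:ℝ) T, ∀ x j k l, |pd2 (fun y => b t y j) k l x| ≤ r t x
  db3_bound : ∀ t ∈ Icc (0:ℝ) T, ∀ x j k l m, |pd3 (fun y => b t y j) k l m x| ≤ r t x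
  dc1_bound : ∀ t ∈ Icc (0:ℝ) T, ∀ x k, |pd1 (c t) k x| ≤ ϱ t x
  dc2_bound : ∀ t ∈ Icc (0:ℝ) T, ∀ x k l, |pd2 (c t) k l x| ≤ ϱ t x
  dc3_bound : ∀ t ∈ Icc (0:ℝ) T, ∀ x k l m, |pd3 (c t) k l m x| ≤ ϱ t x
  funz : ∀ t ∈ Icc (0:ℝ) T, ∀ x, d t x + L₁ * r t x + L₂ * ϱ t x ^ 2 ≤ L₃ * ν t x
  /- (vii) existence of a Lyapunov function. -/
  liap : ∃ φ : ES N → ℝ, ∃ lam : ℝ, 0 < lam ∧ (∀ x, 0 < φ x) ∧ ContDiff ℝ 2 φ ∧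
    Tendsto φ (cocompact (ES N)) atTop ∧
    ∃ M : ℝ, ∀ t ∈ Icc (0:ℝ) T, ∀ x, Aop q b c φ t x - lam * φ x ≤ M

/-- `u` is a bounded classical solution on `[s,τ] × ℝ^N` of the homogeneous Cauchy problem
`D_t u = 𝒜 u`, `u(s,·) = f`: it is bounded and continuous on `[s,τ] × ℝ^N`, continuously
differentiable once in time and twice in space on `(s,τ] × ℝ^N`, satisfies the equation there
and attains the initial datum `f` at time `s`. -/
def IsBCSol {N : ℕ} (q : ℝ → ES N → Fin N → Fin N → ℝ) (b : ℝ → ES N → Fin N → ℝ)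
    (c : ℝ → ES N → ℝ) (s τ : ℝ) (f : ES N → ℝ) (u : ℝ → ES N → ℝ) : Prop :=
  (∃ M, ∀ t ∈ Icc s τ, ∀ x, |u t x| ≤ M) ∧
  ContinuousOn (fun p : ℝ × ES N => u p.1 p.2) (Icc s τ ×ˢ univ) ∧
  (∀ t ∈ Ioc s τ, ContDiff ℝ 2 (u t)) ∧
  (∀ x, ∀ t ∈ Ioc s τ, DifferentiableAt ℝ (fun t' => u t' x) t) ∧
  ContinuousOn (fun p : ℝ × ES N => deriv (fun t' => u t' p.2) p.1) (Ioc s τ ×ˢ univ) ∧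
  (∀ i, ContinuousOn (fun p : ℝ × ES N => pd1 (u p.1) i p.2) (Ioc s τ ×ˢ univ)) ∧
  (∀ i j, ContinuousOn (fun p : ℝ × ES N => pd2 (u p.1) i j p.2) (Ioc s τ ×ˢ univ)) ∧
  (∀ t ∈ Ioc s τ, ∀ x, deriv (fun t' => u t' x) t = Aop q b c (u t) t x) ∧
  (∀ x, u s x = f x)

/-- `u` is a bounded classical solution on `[0,T] × ℝ^N` of the nonhomogeneous Cauchy problem
`D_t u = 𝒜 u + g`, `u(0,·) = f`, continuously differentiable once in time and twice in space
on all of `[0,T] × ℝ^N`. -/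
def IsBCSolInhom {N : ℕ} (q : ℝ → ES N → Fin N → Fin N → ℝ) (b : ℝ → ES N → Fin N → ℝ)
    (c : ℝ → ES N → ℝ) (T : ℝ) (f : ES N → ℝ) (g : ℝ → ES N → ℝ) (u : ℝ → ES N → ℝ) : Prop :=
  (∃ M, ∀ t ∈ Icc (0:ℝ) T, ∀ x, |u t x| ≤ M) ∧
  (∀ t ∈ Icc (0:ℝ) T, ContDiff ℝ 2 (u t)) ∧
  (∀ x, ∀ t ∈ Icc (0:ℝ) T, DifferentiableWithinAt ℝ (fun t' => u t' x) (Icc (0:ℝ) T) t) ∧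
  ContinuousOn (fun p : ℝ × ES N => derivWithin (fun t' => u t' p.2) (Icc (0:ℝ) T) p.1)
    (Icc (0:ℝ) T ×ˢ univ) ∧
  (∀ i, ContinuousOn (fun p : ℝ × ES N => pd1 (u p.1) i p.2) (Icc (0:ℝ) T ×ˢ univ)) ∧
  (∀ i j, ContinuousOn (fun p : ℝ × ES N => pd2 (u p.1) i j p.2) (Icc (0:ℝ) T ×ˢ univ)) ∧
  (∀ t ∈ Icc (0:ℝ) T, ∀ x,
    derivWithin (fun t' => u t' x) (Icc (0:ℝ) T) t = Aop q b c (u t) t x + g t x) ∧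
  (∀ x, u 0 x = f x)

/-- Extended-real sup norm of the `k`-th derivative. -/
def supNormE {N : ℕ} (k : ℕ) (f : ES N → ℝ) : ℝ≥0∞ :=
  ⨆ x : ES N, ENNReal.ofReal ‖iteratedFDeriv ℝ k f x‖

/-- Extended-real `γ`-Hölder seminorm of the `k`-th derivative. -/
def holderSemiE {N : ℕ} (k : ℕ) (γ : ℝ) (f : ES N → ℝ) : ℝ≥0∞ :=
  ⨆ (x : ES N) (y : ES N) (_ : x ≠ y),
    ENNReal.ofReal (‖iteratedFDeriv ℝ k f x - iteratedFDeriv ℝ k f y‖ / ‖x - y‖ ^ γ)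

/-- The `C^α_b(ℝ^N)` norm (valued in `[0,∞]`): sup norms of the derivatives up to order `⌊α⌋`
plus, when `α ∉ ℕ`, the `(α-⌊α⌋)`-Hölder seminorm of the `⌊α⌋`-th order derivatives. -/
def CbNorm {N : ℕ} (α : ℝ) (f : ES N → ℝ) : ℝ≥0∞ :=
  (∑ k ∈ Finset.range (⌊α⌋₊ + 1), supNormE k f) +
    (if (⌊α⌋₊ : ℝ) = α then 0 else holderSemiE ⌊α⌋₊ (α - ⌊α⌋₊) f)

/-- Membership in `C^α_b(ℝ^N)`. -/
def MemCb {N : ℕ} (α : ℝ) (f : ES N → ℝ) : Prop :=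
  ContDiff ℝ (⌊α⌋₊ : ℕ) f ∧ CbNorm α f ≠ ⊤

/-! ### Partial derivatives -/

/-- Smoothness of real functions on `ℝ^N`. -/
abbrev Smooth {N : ℕ} (f : ES N → ℝ) : Prop := ContDiff ℝ ((⊤ : ℕ∞) : WithTop ℕ∞) f

/-- Iterated partial derivatives along a word; the head of the word is the outermost derivative. -/
def pdl {N : ℕ} : List (Fin N) → (ES N → ℝ) → ES N → ℝ
  | [], f => f
  | i :: I, f => pd1 (pdl I f) i

section Derivatives

variable {N : ℕ}

@[simp] lemma pdl_nil (f : ES N → ℝ) : pdl [] f = f := rfl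

@[simp] lemma pdl_cons (i : Fin N) (I : List (Fin N)) (f : ES N → ℝ) :
    pdl (i :: I) f = pd1 (pdl I f) i := rfl

lemma pdl_append (I J : List (Fin N)) (f : ES N → ℝ) : pdl (I ++ J) f = pdl I (pdl J f) := by
  induction I with
  | nil => rfl
  | cons i I ih => simp [ih]

lemma Smooth.differentiable {f : ES N → ℝ} (hf : Smooth f) : Differentiable ℝ f :=
  ContDiff.differentiable hf (by simp)

lemma ContDiff.pd1 {n m : WithTop ℕ∞} {f : ES N → ℝ} (hf : ContDiff ℝ n f) (h : m + 1 ≤ n)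
    (i : Fin N) : ContDiff ℝ m (pd1 f i) :=
  (hf.fderiv_right h).clm_apply contDiff_const

lemma Smooth.pd1 {f : ES N → ℝ} (hf : Smooth f) (i : Fin N) : Smooth (pd1 f i) :=
  ContDiff.pd1 hf (by exact_mod_cast le_rfl) i

lemma Smooth.pdl {f : ES N → ℝ} (hf : Smooth f) (I : List (Fin N)) : Smooth (pdl I f) := by
  induction I with
  | nil => exact hf
  | cons i I ih => exact ih.pd1 i

lemma eq_sum_single (y : ES N) : y = ∑ i, y i • EuclideanSpace.single i (1 : ℝ) := by
  ext j
  simp [Finset.sum_apply, Pi.single_apply]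

lemma fderiv_apply_eq_sum (f : ES N → ℝ) (x y : ES N) :
    fderiv ℝ f x y = ∑ i, y i * pd1 f i x := by
  conv_lhs => rw [eq_sum_single y]
  simp [pd1]

lemma pd1_add {f g : ES N → ℝ} {x : ES N} (hf : DifferentiableAt ℝ f x)
    (hg : DifferentiableAt ℝ g x) (i : Fin N) :
    pd1 (fun y => f y + g y) i x = pd1 f i x + pd1 g i x := by
  simp [pd1, fderiv_fun_add hf hg]

lemma pd1_sub {f g : ES N → ℝ} {x : ES N} (hf : DifferentiableAt ℝ f x)
    (hg : DifferentiableAt ℝ g x) (i : Fin N) :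
    pd1 (fun y => f y - g y) i x = pd1 f i x - pd1 g i x := by
  simp [pd1, fderiv_fun_sub hf hg]

lemma pd1_mul {f g : ES N → ℝ} {x : ES N} (hf : DifferentiableAt ℝ f x)
    (hg : DifferentiableAt ℝ g x) (i : Fin N) :
    pd1 (fun y => f y * g y) i x = pd1 f i x * g x + f x * pd1 g i x := by
  simp [pd1, fderiv_fun_mul hf hg]; ring

lemma pd1_const_mul {f : ES N → ℝ} {x : ES N} (c : ℝ) (hf : DifferentiableAt ℝ f x) (i : Fin N) :
    pd1 (fun y => c * f y) i x = c * pd1 f i x := by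
  simp [pd1, fderiv_const_mul hf c]

lemma pd1_const (c : ℝ) (i : Fin N) : pd1 (fun _ : ES N => c) i = fun _ => 0 := by
  ext x; simp [pd1]

lemma pd1_sum {ι : Type*} (s : Finset ι) {f : ι → ES N → ℝ} {x : ES N}
    (hf : ∀ a ∈ s, DifferentiableAt ℝ (f a) x) (i : Fin N) :
    pd1 (fun y => ∑ a ∈ s, f a y) i x = ∑ a ∈ s, pd1 (f a) i x := by
  simp [pd1, fderiv_fun_sum hf]

lemma pd1_comm {f : ES N → ℝ} (hf : ContDiff ℝ 2 f) (i j : Fin N) :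
    pd1 (pd1 f i) j = pd1 (pd1 f j) i := by
  ext x
  have hd : DifferentiableAt ℝ (fderiv ℝ f) x :=
    ((hf.fderiv_right (m := 1) (by norm_num)).differentiable (by simp)) x
  have h := (hf.contDiffAt (x := x)).isSymmSndFDerivAt (by simp)
  have key : ∀ k l, pd1 (pd1 f k) l x =
      fderiv ℝ (fderiv ℝ f) x (EuclideanSpace.single l 1) (EuclideanSpace.single k 1) := by
    intro k l
    unfold pd1
    rw [fderiv_clm_apply hd (differentiableAt_const _)]
    simp
  rw [key, key]
  exact h _ _

lemma HasDerivAt.of_line {f : ES N → ℝ} (hf : Differentiable ℝ f) (x y : ES N) (τ : ℝ) :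
    HasDerivAt (fun τ : ℝ => f (x + τ • y)) (∑ i, y i * pd1 f i (x + τ • y)) τ := by
  have h1 : HasDerivAt (fun τ : ℝ => x + τ • y) y τ := by
    simpa using ((hasDerivAt_id τ).smul_const y).const_add x
  rw [← fderiv_apply_eq_sum]
  exact (hf (x + τ • y)).hasFDerivAt.comp_hasDerivAt τ h1

lemma pd1_comp {f : ES N → ℝ} {Y : ES N → ES N} {x : ES N} (hf : Differentiable ℝ f)
    (hY : DifferentiableAt ℝ Y x) (i : Fin N) :
    pd1 (fun y => f (Y y)) i x = ∑ j, pd1 f j (Y x) * pd1 (fun y => Y y j) i x := by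
  have h1 : fderiv ℝ (fun y => f (Y y)) x = (fderiv ℝ f (Y x)).comp (fderiv ℝ Y x) :=
    fderiv_comp x (hf (Y x)) hY
  have h2 : ∀ j, fderiv ℝ (fun y => Y y j) x (EuclideanSpace.single i 1)
      = (fderiv ℝ Y x (EuclideanSpace.single i 1)) j := by
    intro j
    have := ((EuclideanSpace.proj (𝕜 := ℝ) j : ES N →L[ℝ] ℝ).hasFDerivAt.comp x hY.hasFDerivAt).fderiv
    change fderiv ℝ (fun y => Y y j) x = _ at this
    rw [this]; rfl
  simp only [pd1, h1, h2, ContinuousLinearMap.comp_apply]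
  rw [fderiv_apply_eq_sum]
  exact Finset.sum_congr rfl fun j _ => mul_comm _ _

/-! ### Taylor estimates -/

lemma abs_sub_le_of_deriv_le {g g' : ℝ → ℝ} {C : ℝ} (h : ∀ τ, HasDerivAt g (g' τ) τ)
    (hC : ∀ τ ∈ Icc (0 : ℝ) 1, |g' τ| ≤ C) : |g 1 - g 0| ≤ C := by
  have := Convex.norm_image_sub_le_of_norm_hasDerivWithin_le (f := g) (f' := g') (C := C)
    (s := Icc (0 : ℝ) 1) (x := 0) (y := 1) (fun τ _ => (h τ).hasDerivWithinAt) (by simpa using hC)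
    (convex_Icc 0 1) (by simp) (by simp)
  simpa using this

lemma sum_abs_le_norm (y : ES N) : ∑ i, |y i| ≤ N * ‖y‖ := by
  calc ∑ i, |y i| ≤ ∑ _i : Fin N, ‖y‖ :=
        Finset.sum_le_sum fun i _ => by simpa using PiLp.norm_apply_le y i
    _ = N * ‖y‖ := by simp

lemma abs_sum_mul_le {y : ES N} {a : Fin N → ℝ} {K : ℝ} (ha : ∀ i, |a i| ≤ K) :
    |∑ i, y i * a i| ≤ N * ‖y‖ * K := by
  calc |∑ i, y i * a i| ≤ ∑ i, |y i * a i| := Finset.abs_sum_le_sum_abs _ _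
    _ ≤ ∑ i, |y i| * K := Finset.sum_le_sum fun i _ => by
        rw [abs_mul]; exact mul_le_mul_of_nonneg_left (ha i) (abs_nonneg _)
    _ ≤ N * ‖y‖ * K := by
        rw [← Finset.sum_mul]
        rcases Nat.eq_zero_or_pos N with rfl | h
        · simp
        · exact mul_le_mul_of_nonneg_right (sum_abs_le_norm y) ((abs_nonneg _).trans (ha ⟨0, h⟩))

lemma Convex.line_mem {s : Set (ES N)} (hs : Convex ℝ s) {x y : ES N} (hx : x ∈ s)
    (hxy : x + y ∈ s) {τ : ℝ} (hτ : τ ∈ Icc (0 : ℝ) 1) : x + τ • y ∈ s :=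
  hs.add_smul_mem hx hxy hτ

lemma taylor_one {f : ES N → ℝ} (hf : Smooth f) {s : Set (ES N)} (hs : Convex ℝ s) {K : ℝ}
    (hK : ∀ i, ∀ z ∈ s, |pd1 f i z| ≤ K) {x y : ES N} (hx : x ∈ s) (hxy : x + y ∈ s) :
    |f (x + y) - f x| ≤ N * ‖y‖ * K := by
  have := abs_sub_le_of_deriv_le (fun τ => HasDerivAt.of_line hf.differentiable x y τ)
    (C := N * ‖y‖ * K) (fun τ hτ => abs_sum_mul_le fun i => hK i _ (hs.line_mem hx hxy hτ))
  simpa using this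

lemma taylor_two {f : ES N → ℝ} (hf : Smooth f) {s : Set (ES N)} (hs : Convex ℝ s) {K : ℝ}
    (hK : ∀ i j, ∀ z ∈ s, |pd1 (pd1 f i) j z| ≤ K) {x y : ES N} (hx : x ∈ s) (hxy : x + y ∈ s) :
    |f (x + y) - f x - ∑ i, y i * pd1 f i x| ≤ (N * ‖y‖) ^ 2 * |K| := by
  have hd : ∀ τ, HasDerivAt (fun τ : ℝ => f (x + τ • y) - τ * ∑ i, y i * pd1 f i x)
      (∑ i, y i * (pd1 f i (x + τ • y) - pd1 f i x)) τ := by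
    intro τ
    refine ((HasDerivAt.of_line hf.differentiable x y τ).sub
      ((hasDerivAt_id τ).mul_const _)).congr_deriv ?_
    simp [mul_sub]
  have := abs_sub_le_of_deriv_le hd (C := N * ‖y‖ * (N * ‖y‖ * |K|)) (fun τ hτ => by
    refine abs_sum_mul_le fun i => ?_
    refine (taylor_one (hf.pd1 i) hs (fun j z hz => hK i j z hz) hx (hs.line_mem hx hxy hτ)).trans ?_
    have h1 : ‖τ • y‖ ≤ ‖y‖ := by
      rw [norm_smul, Real.norm_eq_abs, abs_of_nonneg hτ.1]
      exact mul_le_of_le_one_left (norm_nonneg _) hτ.2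
    calc (N : ℝ) * ‖τ • y‖ * K ≤ N * ‖τ • y‖ * |K| := by gcongr; exact le_abs_self K
      _ ≤ N * ‖y‖ * |K| := by gcongr)
  convert this using 1
  · congr 1; simp; ring
  · ring

lemma taylor_three {f : ES N → ℝ} (hf : Smooth f) {s : Set (ES N)} (hs : Convex ℝ s) {K : ℝ}
    (hK : ∀ i j k, ∀ z ∈ s, |pd1 (pd1 (pd1 f i) j) k z| ≤ K) {x y : ES N} (hx : x ∈ s)
    (hxy : x + y ∈ s) :
    |f (x + y) - f x - ∑ i, y i * pd1 f i x - 1 / 2 * ∑ i, ∑ j, y i * y j * pd1 (pd1 f i) j x|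
      ≤ (N * ‖y‖) ^ 3 * |K| := by
  have hd : ∀ τ, HasDerivAt (fun τ : ℝ => f (x + τ • y) - τ * ∑ i, y i * pd1 f i x
        - τ ^ 2 / 2 * ∑ i, ∑ j, y i * y j * pd1 (pd1 f i) j x)
      (∑ i, y i * (pd1 f i (x + τ • y) - pd1 f i x
        - ∑ j, (τ • y) j * pd1 (pd1 f i) j x)) τ := by
    intro τ
    refine (((HasDerivAt.of_line hf.differentiable x y τ).sub
      ((hasDerivAt_id τ).mul_const _)).sub
        (((hasDerivAt_pow 2 τ).div_const 2).mul_const _)).congr_deriv ?_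
    simp only [mul_sub, Finset.sum_sub_distrib, Finset.mul_sum, PiLp.smul_apply, smul_eq_mul]
    congr 1
    · simp
    · refine Finset.sum_congr rfl fun i _ => Finset.sum_congr rfl fun j _ => ?_
      simp; ring
  have := abs_sub_le_of_deriv_le hd (C := N * ‖y‖ * ((N * ‖y‖) ^ 2 * |K|)) (fun τ hτ => by
    refine abs_sum_mul_le fun i => ?_
    refine (taylor_two (hf.pd1 i) hs (fun j k z hz => hK i j k z hz) hx
      (hs.line_mem hx hxy hτ)).trans ?_
    have h1 : ‖τ • y‖ ≤ ‖y‖ := by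
      rw [norm_smul, Real.norm_eq_abs, abs_of_nonneg hτ.1]
      exact mul_le_of_le_one_left (norm_nonneg _) hτ.2
    gcongr)
  convert this using 1
  · congr 1; simp; ring
  · ring

end Derivatives

/-! ### Families of smooth functions with uniformly bounded derivatives -/

section UniformlyBounded

variable {N : ℕ} {P : Type*}

/-- A family of smooth functions all of whose derivatives are bounded uniformly over the family. -/
def UB (g : P → ES N → ℝ) : Prop :=
  (∀ p, Smooth (g p)) ∧ ∀ I, ∃ C, ∀ p x, |pdl I (g p) x| ≤ C

/-- Uniform boundedness of the derivatives up to a given order. -/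
def BddOrder : ℕ → (P → ES N → ℝ) → Prop
  | 0, g => ∃ C, ∀ p x, |g p x| ≤ C
  | k + 1, g => (∃ C, ∀ p x, |g p x| ≤ C) ∧ ∀ i, BddOrder k (fun p => pd1 (g p) i)

lemma BddOrder.zero {k : ℕ} {g : P → ES N → ℝ} (h : BddOrder k g) :
    ∃ C, ∀ p x, |g p x| ≤ C := by
  cases k with
  | zero => exact h
  | succ k => exact h.1

lemma BddOrder.of_succ {k : ℕ} {g : P → ES N → ℝ} (h : BddOrder (k + 1) g) : BddOrder k g := by
  induction k generalizing g with
  | zero => exact h.1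
  | succ k ih => exact ⟨h.1, fun i => ih (h.2 i)⟩

lemma BddOrder.pdl {k : ℕ} {g : P → ES N → ℝ} (h : BddOrder k g) (I : List (Fin N))
    (hI : I.length ≤ k) : ∃ C, ∀ p x, |pdl I (g p) x| ≤ C := by
  induction I using List.reverseRecOn generalizing k g with
  | nil => exact h.zero
  | append_singleton I i ih =>
    cases k with
    | zero => simp at hI
    | succ k =>
      obtain ⟨C, hC⟩ := ih (h.2 i) (by simpa using hI)
      exact ⟨C, fun p x => by rw [pdl_append]; exact hC p x⟩

lemma BddOrder.of_pdl {k : ℕ} {g : P → ES N → ℝ}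
    (h : ∀ I : List (Fin N), ∃ C, ∀ p x, |_root_.pdl I (g p) x| ≤ C) : BddOrder k g := by
  induction k generalizing g with
  | zero => exact h []
  | succ k ih =>
    refine ⟨h [], fun i => ih fun I => ?_⟩
    obtain ⟨C, hC⟩ := h (I ++ [i])
    exact ⟨C, fun p x => by have := hC p x; rwa [pdl_append] at this⟩

lemma ub_iff {g : P → ES N → ℝ} : UB g ↔ (∀ p, Smooth (g p)) ∧ ∀ k, BddOrder k g :=
  ⟨fun h => ⟨h.1, fun _ => BddOrder.of_pdl h.2⟩,
    fun h => ⟨h.1, fun I => (h.2 I.length).pdl I le_rfl⟩⟩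

lemma UB.smooth {g : P → ES N → ℝ} (hg : UB g) (p : P) : Smooth (g p) := hg.1 p

lemma UB.differentiableAt {g : P → ES N → ℝ} (hg : UB g) (p : P) (x : ES N) :
    DifferentiableAt ℝ (g p) x := (hg.1 p).differentiable x

lemma UB.bdd {g : P → ES N → ℝ} (hg : UB g) : ∃ C, ∀ p x, |g p x| ≤ C := hg.2 []

lemma UB.pd1 {g : P → ES N → ℝ} (hg : UB g) (i : Fin N) : UB fun p => pd1 (g p) i := by
  refine ⟨fun p => (hg.1 p).pd1 i, fun I => ?_⟩
  obtain ⟨C, hC⟩ := hg.2 (I ++ [i])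
  exact ⟨C, fun p x => by have := hC p x; rwa [pdl_append] at this⟩

lemma UB.reindex {P' : Type*} {g : P → ES N → ℝ} (hg : UB g) (φ : P' → P) :
    UB fun p => g (φ p) :=
  ⟨fun _ => hg.1 _, fun I => (hg.2 I).imp fun _ hC _ => hC _⟩

lemma BddOrder.const {k : ℕ} {a : P → ℝ} {C : ℝ} (ha : ∀ p, |a p| ≤ C) :
    BddOrder k fun (p : P) (_ : ES N) => a p := by
  induction k generalizing a C with
  | zero => exact ⟨C, fun p _ => ha p⟩
  | succ k ih =>
    refine ⟨⟨C, fun p _ => ha p⟩, fun i => ?_⟩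
    simp only [pd1_const]
    exact ih (C := 0) (by simp)

lemma UB.const {a : P → ℝ} {C : ℝ} (ha : ∀ p, |a p| ≤ C) : UB fun (p : P) (_ : ES N) => a p :=
  ub_iff.2 ⟨fun _ => contDiff_const, fun _ => BddOrder.const ha⟩

lemma BddOrder.add {k : ℕ} {f g : P → ES N → ℝ} (sf : ∀ p, Smooth (f p)) (sg : ∀ p, Smooth (g p))
    (hf : BddOrder k f) (hg : BddOrder k g) : BddOrder k fun p x => f p x + g p x := by
  induction k generalizing f g with
  | zero =>
    obtain ⟨C, hC⟩ := hf
    obtain ⟨D, hD⟩ := hg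
    exact ⟨C + D, fun p x => (abs_add_le _ _).trans (add_le_add (hC p x) (hD p x))⟩
  | succ k ih =>
    refine ⟨?_, fun i => ?_⟩
    · obtain ⟨C, hC⟩ := hf.1
      obtain ⟨D, hD⟩ := hg.1
      exact ⟨C + D, fun p x => (abs_add_le _ _).trans (add_le_add (hC p x) (hD p x))⟩
    · have : (fun p => _root_.pd1 (fun x => f p x + g p x) i) =
          fun p x => _root_.pd1 (f p) i x + _root_.pd1 (g p) i x := by
        ext p x
        exact pd1_add ((sf p).differentiable x) ((sg p).differentiable x) i
      rw [this]
      exact ih (fun p => (sf p).pd1 i) (fun p => (sg p).pd1 i) (hf.2 i) (hg.2 i)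

lemma UB.add {f g : P → ES N → ℝ} (hf : UB f) (hg : UB g) : UB fun p x => f p x + g p x := by
  rw [ub_iff] at *
  exact ⟨fun p => (hf.1 p).add (hg.1 p), fun k => (hf.2 k).add hf.1 hg.1 (hg.2 k)⟩

lemma BddOrder.mul {k : ℕ} {f g : P → ES N → ℝ} (sf : ∀ p, Smooth (f p)) (sg : ∀ p, Smooth (g p))
    (hf : BddOrder k f) (hg : BddOrder k g) : BddOrder k fun p x => f p x * g p x := by
  have h0 : ∀ {f g : P → ES N → ℝ}, (∃ C, ∀ p x, |f p x| ≤ C) → (∃ C, ∀ p x, |g p x| ≤ C) →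
      ∃ C, ∀ p x, |f p x * g p x| ≤ C := by
    rintro f g ⟨C, hC⟩ ⟨D, hD⟩
    refine ⟨C * D, fun p x => ?_⟩
    rw [abs_mul]
    exact mul_le_mul (hC p x) (hD p x) (abs_nonneg _) ((abs_nonneg _).trans (hC p x))
  induction k generalizing f g with
  | zero => exact h0 hf hg
  | succ k ih =>
    refine ⟨h0 hf.1 hg.1, fun i => ?_⟩
    have : (fun p => _root_.pd1 (fun x => f p x * g p x) i) =
        fun p x => _root_.pd1 (f p) i x * g p x + f p x * _root_.pd1 (g p) i x := by
      ext p x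
      exact pd1_mul ((sf p).differentiable x) ((sg p).differentiable x) i
    rw [this]
    exact BddOrder.add (fun p => ((sf p).pd1 i).mul (sg p)) (fun p => (sf p).mul ((sg p).pd1 i))
      (ih (fun p => (sf p).pd1 i) sg (hf.2 i) hg.of_succ)
      (ih sf (fun p => (sg p).pd1 i) hf.of_succ (hg.2 i))

lemma UB.mul {f g : P → ES N → ℝ} (hf : UB f) (hg : UB g) : UB fun p x => f p x * g p x := by
  rw [ub_iff] at *
  exact ⟨fun p => (hf.1 p).mul (hg.1 p), fun k => (hf.2 k).mul hf.1 hg.1 (hg.2 k)⟩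

lemma UB.const_mul {g : P → ES N → ℝ} (hg : UB g) (c : ℝ) : UB fun p x => c * g p x :=
  (UB.const (a := fun _ => c) (fun _ => le_rfl)).mul hg

lemma UB.sub {f g : P → ES N → ℝ} (hf : UB f) (hg : UB g) : UB fun p x => f p x - g p x := by
  have := hf.add (hg.const_mul (-1))
  simpa [sub_eq_add_neg] using this

lemma UB.inv_sqrt {g : P → ES N → ℝ} {ν : ℝ} (hν : 0 < ν) (hg : UB g) (hb : ∀ p x, ν ≤ g p x) :
    UB fun p x => (√(g p x))⁻¹ := by
  have hpos : ∀ p x, 0 < g p x := fun p x => hν.trans_le (hb p x)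
  have sm : ∀ p, Smooth fun x => (√(g p x))⁻¹ := fun p =>
    ((hg.1 p).sqrt fun x => (hpos p x).ne').inv fun x => (Real.sqrt_pos.2 (hpos p x)).ne'
  have b0 : ∃ C, ∀ p x, |(√(g p x))⁻¹| ≤ C := by
    refine ⟨(√ν)⁻¹, fun p x => ?_⟩
    rw [abs_of_nonneg (by positivity)]
    exact inv_anti₀ (Real.sqrt_pos.2 hν) (Real.sqrt_le_sqrt (hb p x))
  rw [ub_iff]
  refine ⟨sm, fun k => ?_⟩
  induction k with
  | zero => exact b0
  | succ k ih =>
    refine ⟨b0, fun i => ?_⟩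
    have : (fun p => _root_.pd1 (fun x => (√(g p x))⁻¹) i) =
        fun p x => (-(1 / 2) * ((√(g p x))⁻¹ * ((√(g p x))⁻¹ * (√(g p x))⁻¹)))
          * _root_.pd1 (g p) i x := by
      ext p x
      have h1 : HasFDerivAt (g p) (fderiv ℝ (g p) x) x := (hg.differentiableAt p x).hasFDerivAt
      have h2 := (Real.hasDerivAt_sqrt (hpos p x).ne').fun_inv (Real.sqrt_pos.2 (hpos p x)).ne'
      have h3 := (h2.comp_hasFDerivAt x h1).fderiv
      unfold _root_.pd1
      simp only [Function.comp_def] at h3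
      rw [h3]
      have h4 := Real.sqrt_pos.2 (hpos p x)
      simp only [smul_apply, smul_eq_mul]
      field_simp
    rw [this]
    refine BddOrder.mul ?_ (fun p => (hg.1 p).pd1 i) ?_ ((ub_iff.1 (hg.pd1 i)).2 k)
    · exact fun p => contDiff_const.mul ((sm p).mul ((sm p).mul (sm p)))
    · exact BddOrder.mul (fun p => contDiff_const) (fun p => (sm p).mul ((sm p).mul (sm p)))
        (BddOrder.const (a := fun _ => -(1 / 2)) fun _ => le_rfl)
        (BddOrder.mul sm (fun p => (sm p).mul (sm p)) ih (BddOrder.mul sm sm ih ih))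

/-! ### Smooth square-root factorization of elliptic matrices -/

lemma sum_sum_sub_single (a : Fin N → Fin N → ℝ) (ha : ∀ i j, a i j = a j i) (ξ : Fin N → ℝ)
    (m : Fin N) (s : ℝ) :
    ∑ i, ∑ j, a i j * (ξ i - s * Pi.single (M := fun _ => ℝ) m 1 i)
        * (ξ j - s * Pi.single (M := fun _ => ℝ) m 1 j)
      = ∑ i, ∑ j, a i j * ξ i * ξ j - 2 * s * ∑ i, a i m * ξ i + s ^ 2 * a m m := by
  have h1 : ∀ i j, a i j * (ξ i - s * Pi.single (M := fun _ => ℝ) m 1 i)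
        * (ξ j - s * Pi.single (M := fun _ => ℝ) m 1 j)
      = a i j * ξ i * ξ j - s * (a i j * ξ i * Pi.single (M := fun _ => ℝ) m 1 j)
        - s * (a i j * ξ j * Pi.single (M := fun _ => ℝ) m 1 i)
        + s ^ 2 * (a i j * Pi.single (M := fun _ => ℝ) m 1 i
          * Pi.single (M := fun _ => ℝ) m 1 j) := fun i j => by ring
  simp only [h1, Finset.sum_add_distrib, Finset.sum_sub_distrib, ← Finset.mul_sum]
  have h2 : ∑ i, ∑ j, a i j * ξ j * Pi.single (M := fun _ => ℝ) m 1 i = ∑ i, a i m * ξ i := by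
    rw [Finset.sum_comm]
    simp [Pi.single_apply, ha m]
  rw [h2]
  simp [Pi.single_apply]
  ring

theorem exists_smooth_factorization {q : P → Fin N → Fin N → ES N → ℝ} {ν : ℝ} (hν : 0 < ν)
    (hq : ∀ i j, UB fun p => q p i j) (hs : ∀ p i j x, q p i j x = q p j i x)
    (he : ∀ p x (ξ : Fin N → ℝ), ν * ∑ i, ξ i ^ 2 ≤ ∑ i, ∑ j, q p i j x * ξ i * ξ j) :
    ∃ σ : P → Fin N → Fin N → ES N → ℝ, (∀ k i, UB fun p => σ p k i) ∧
      ∀ p x i j, ∑ k, σ p k i x * σ p k j x = q p i j x := by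
  have key : ∀ m ≤ N, ∃ (Q : P → Fin N → Fin N → ES N → ℝ) (σ : ℕ → P → Fin N → ES N → ℝ),
      (∀ i j, UB fun p => Q p i j) ∧ (∀ k i, UB fun p => σ k p i) ∧
      (∀ p i j x, Q p i j x = Q p j i x) ∧
      (∀ p i j x, ∑ k ∈ Finset.range m, σ k p i x * σ k p j x + Q p i j x = q p i j x) ∧
      (∀ p i j x, i.1 < m → Q p i j x = 0) ∧
      ∀ p x (ξ : Fin N → ℝ), ∃ η : Fin N → ℝ, (∀ i : Fin N, m ≤ i.1 → η i = ξ i) ∧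
        ∑ i, ∑ j, Q p i j x * ξ i * ξ j = ∑ i, ∑ j, q p i j x * η i * η j := by
    intro m
    induction m with
    | zero =>
      intro _
      refine ⟨q, fun _ _ _ _ => 0, hq, fun _ _ => ?_, hs, by simp, by simp,
        fun p x ξ => ⟨ξ, by simp, rfl⟩⟩
      exact UB.const (a := fun _ => 0) (C := 0) (by simp)
    | succ m ih =>
      intro hm
      obtain ⟨Q, σ, hQ, hσ, hsym, hsum, hker, hquad⟩ := ih (by omega)
      let M : Fin N := ⟨m, by omega⟩
      have hd : ∀ p x, ν ≤ Q p M M x := by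
        intro p x
        obtain ⟨η, h1, h2⟩ := hquad p x (Pi.single M 1)
        have h3 := he p x η
        rw [← h2] at h3
        simp only [Pi.single_apply] at h3
        simp at h3
        have h4 : (1 : ℝ) ≤ ∑ i, η i ^ 2 := by
          have : η M ^ 2 ≤ ∑ i, η i ^ 2 :=
            Finset.single_le_sum (f := fun i => η i ^ 2) (fun i _ => sq_nonneg _) (Finset.mem_univ M)
          rw [h1 M le_rfl] at this
          simpa using this
        nlinarith
      have hd0 : ∀ p x, 0 < Q p M M x := fun p x => hν.trans_le (hd p x)
      let τ : P → Fin N → ES N → ℝ := fun p i x => Q p i M x * (√(Q p M M x))⁻¹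
      have hτ : ∀ i, UB fun p => τ p i := fun i => (hQ i M).mul ((hQ M M).inv_sqrt hν hd)
      have hττ : ∀ p i j x, τ p i x * τ p j x = Q p i M x * Q p j M x / Q p M M x := by
        intro p i j x
        have h5 : (√(Q p M M x))⁻¹ * (√(Q p M M x))⁻¹ = (Q p M M x)⁻¹ := by
          rw [← mul_inv, Real.mul_self_sqrt (hd0 p x).le]
        simp only [τ]
        rw [div_eq_mul_inv, ← h5]; ring
      refine ⟨fun p i j x => Q p i j x - τ p i x * τ p j x,
        fun k => if k = m then τ else σ k, fun i j => (hQ i j).sub ((hτ i).mul (hτ j)), ?_, ?_, ?_,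
        ?_, ?_⟩
      · intro k i
        by_cases hk : k = m
        · simpa [hk] using hτ i
        · simpa [hk] using hσ k i
      · intro p i j x
        change Q p i j x - τ p i x * τ p j x = Q p j i x - τ p j x * τ p i x
        rw [hsym p i j x, mul_comm (τ p i x)]
      · intro p i j x
        rw [Finset.sum_range_succ, ← hsum p i j x]
        have : ∀ k ∈ Finset.range m, (if k = m then τ else σ k) p i x * (if k = m then τ else σ k) p j x
            = σ k p i x * σ k p j x := by
          intro k hk
          have : k ≠ m := (Finset.mem_range.1 hk).ne
          simp [this]
        rw [Finset.sum_congr rfl this]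
        simp
      · intro p i j x hi
        change Q p i j x - τ p i x * τ p j x = 0
        rw [hττ]
        rcases Nat.lt_succ_iff_lt_or_eq.1 hi with h | h
        · simp [hker p i _ x h]
        · have : i = M := Fin.ext h
          subst this
          have := (hd0 p x).ne'
          field_simp
          rw [hsym p j M x]; ring
      · intro p x ξ
        set s := (∑ i, Q p i M x * ξ i) / Q p M M x with hs'
        obtain ⟨η, h1, h2⟩ := hquad p x fun i => ξ i - s * Pi.single (M := fun _ => ℝ) M 1 i
        refine ⟨η, fun i hi => ?_, ?_⟩
        · rw [h1 i (by omega)]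
          have : i ≠ M := by rintro rfl; simp [M] at hi
          simp [this]
        · rw [← h2, sum_sum_sub_single _ (fun i j => hsym p i j x)]
          have h6 : ∀ i j, (Q p i j x - τ p i x * τ p j x) * ξ i * ξ j = Q p i j x * ξ i * ξ j
              - (Q p i M x * ξ i) * (Q p j M x * ξ j) / Q p M M x := by
            intro i j
            rw [hττ]; ring
          simp only [h6, Finset.sum_sub_distrib, ← Finset.sum_div, ← Finset.mul_sum,
            ← Finset.sum_mul]
          rw [hs']
          have := (hd0 p x).ne'
          field_simp
          ring
  obtain ⟨Q, σ, -, hσ, -, hsum, hker, -⟩ := key N le_rfl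
  refine ⟨fun p k i => σ k p i, fun k i => hσ k i, fun p x i j => ?_⟩
  rw [← hsum p i j x, hker p i j x i.2, add_zero, Finset.sum_range]

end UniformlyBounded

/-! ### Locally bounded and equicontinuous sequences -/

section Sequences

variable {N : ℕ} {J : Set ℝ}

/-- Local boundedness in space, uniform along the tail of a sequence of functions. -/
def LocBdd (J : Set ℝ) (g : ℕ → ℝ → ES N → ℝ) : Prop :=
  ∀ R : ℝ, ∃ C : ℝ, ∀ᶠ n in atTop, ∀ t ∈ J, ∀ x ∈ closedBall (0 : ES N) R, |g n t x| ≤ C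

/-- Time equicontinuity, locally uniform in space, along the tail of a sequence of functions. -/
def TimeEqui (J : Set ℝ) (g : ℕ → ℝ → ES N → ℝ) : Prop :=
  ∀ R : ℝ, ∀ ε > 0, ∃ δ > 0, ∀ᶠ n in atTop, ∀ t ∈ J, ∀ t' ∈ J, |t - t'| < δ →
    ∀ x ∈ closedBall (0 : ES N) R, |g n t x - g n t' x| ≤ ε

lemma LocBdd.exists_pos {g : ℕ → ℝ → ES N → ℝ} (hg : LocBdd J g) (R : ℝ) :
    ∃ C > 0, ∀ᶠ n in atTop, ∀ t ∈ J, ∀ x ∈ closedBall (0 : ES N) R, |g n t x| ≤ C := by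
  obtain ⟨C, hC⟩ := hg R
  exact ⟨|C| + 1, by positivity, hC.mono fun n h t ht x hx =>
    (h t ht x hx).trans ((le_abs_self C).trans (by linarith))⟩

lemma LocBdd.exists_unif {ι : Type*} [Finite ι] {g : ι → ℕ → ℝ → ES N → ℝ}
    (hg : ∀ a, LocBdd J (g a)) (R : ℝ) : ∃ K > 0, ∀ᶠ n in atTop, ∀ a, ∀ t ∈ J,
      ∀ x ∈ closedBall (0 : ES N) R, |g a n t x| ≤ K := by
  have := Fintype.ofFinite ι
  choose C hC hb using fun a => (hg a).exists_pos R
  refine ⟨∑ a, C a + 1, ?_, ?_⟩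
  · have : 0 ≤ ∑ a, C a := Finset.sum_nonneg fun k _ => (hC k).le
    linarith
  · filter_upwards [eventually_all.2 hb] with n h a t ht x hx
    refine (h a t ht x hx).trans ?_
    have h1 : C a ≤ ∑ a, C a :=
      Finset.single_le_sum (f := fun a => C a) (fun j _ => (hC j).le) (Finset.mem_univ a)
    linarith

lemma LocBdd.add {f g : ℕ → ℝ → ES N → ℝ} (hf : LocBdd J f) (hg : LocBdd J g) :
    LocBdd J fun n t x => f n t x + g n t x := by
  intro R
  obtain ⟨C, hC⟩ := hf R
  obtain ⟨D, hD⟩ := hg R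
  refine ⟨C + D, ?_⟩
  filter_upwards [hC, hD] with n h1 h2 t ht x hx
  exact (abs_add_le _ _).trans (add_le_add (h1 t ht x hx) (h2 t ht x hx))

lemma LocBdd.mul {f g : ℕ → ℝ → ES N → ℝ} (hf : LocBdd J f) (hg : LocBdd J g) :
    LocBdd J fun n t x => f n t x * g n t x := by
  intro R
  obtain ⟨C, hC⟩ := hf R
  obtain ⟨D, hD⟩ := hg R
  refine ⟨C * D, ?_⟩
  filter_upwards [hC, hD] with n h1 h2 t ht x hx
  rw [abs_mul]
  exact mul_le_mul (h1 t ht x hx) (h2 t ht x hx) (abs_nonneg _)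
    ((abs_nonneg _).trans (h1 t ht x hx))

lemma LocBdd.sum {ι : Type*} (s : Finset ι) {f : ι → ℕ → ℝ → ES N → ℝ}
    (hf : ∀ a ∈ s, LocBdd J (f a)) : LocBdd J fun n t x => ∑ a ∈ s, f a n t x := by
  induction s using Finset.induction_on with
  | empty => exact fun R => ⟨0, by simp⟩
  | insert a s ha ih =>
    simp only [Finset.sum_insert ha]
    exact (hf a (by simp)).add (ih fun b hb => hf b (by simp [hb]))

lemma TimeEqui.add {f g : ℕ → ℝ → ES N → ℝ} (hf : TimeEqui J f) (hg : TimeEqui J g) :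
    TimeEqui J fun n t x => f n t x + g n t x := by
  intro R ε hε
  obtain ⟨δ₁, h₁, hf⟩ := hf R (ε / 2) (by linarith)
  obtain ⟨δ₂, h₂, hg⟩ := hg R (ε / 2) (by linarith)
  refine ⟨min δ₁ δ₂, lt_min h₁ h₂, ?_⟩
  filter_upwards [hf, hg] with n hf hg t ht t' ht' h x hx
  have h3 := hf t ht t' ht' (h.trans_le (min_le_left _ _)) x hx
  have h4 := hg t ht t' ht' (h.trans_le (min_le_right _ _)) x hx
  rw [abs_le] at *
  constructor <;> linarith

lemma TimeEqui.mul {f g : ℕ → ℝ → ES N → ℝ} (hf : TimeEqui J f) (hg : TimeEqui J g)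
    (bf : LocBdd J f) (bg : LocBdd J g) : TimeEqui J fun n t x => f n t x * g n t x := by
  intro R ε hε
  obtain ⟨C, hC, bf⟩ := bf.exists_pos R
  obtain ⟨D, hD, bg⟩ := bg.exists_pos R
  obtain ⟨δ₁, h₁, hf⟩ := hf R (ε / 2 / D) (by positivity)
  obtain ⟨δ₂, h₂, hg⟩ := hg R (ε / 2 / C) (by positivity)
  refine ⟨min δ₁ δ₂, lt_min h₁ h₂, ?_⟩
  filter_upwards [hf, hg, bf, bg] with n hf hg bf bg t ht t' ht' h x hx
  have h3 := hf t ht t' ht' (h.trans_le (min_le_left _ _)) x hx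
  have h4 := hg t ht t' ht' (h.trans_le (min_le_right _ _)) x hx
  have h5 : f n t x * g n t x - f n t' x * g n t' x
      = (f n t x - f n t' x) * g n t x + f n t' x * (g n t x - g n t' x) := by ring
  rw [h5]
  refine (abs_add_le _ _).trans ?_
  rw [abs_mul, abs_mul]
  have h6 : |f n t x - f n t' x| * |g n t x| ≤ ε / 2 / D * D :=
    mul_le_mul h3 (bg t ht x hx) (abs_nonneg _) (by positivity)
  have h7 : |f n t' x| * |g n t x - g n t' x| ≤ C * (ε / 2 / C) :=
    mul_le_mul (bf t' ht' x hx) h4 (abs_nonneg _) hC.le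
  have h8 : ε / 2 / D * D = ε / 2 := by field_simp
  have h9 : C * (ε / 2 / C) = ε / 2 := by field_simp
  linarith

lemma TimeEqui.sum {ι : Type*} (s : Finset ι) {f : ι → ℕ → ℝ → ES N → ℝ}
    (hf : ∀ a ∈ s, TimeEqui J (f a)) : TimeEqui J fun n t x => ∑ a ∈ s, f a n t x := by
  induction s using Finset.induction_on with
  | empty => exact fun R ε hε => ⟨1, one_pos, by simp [hε.le]⟩
  | insert a s ha ih =>
    simp only [Finset.sum_insert ha]
    exact (hf a (by simp)).add (ih fun b hb => hf b (by simp [hb]))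

/-- Time equicontinuity passes to first-order space derivatives by interpolation. -/
lemma TimeEqui.pd1 {g : ℕ → ℝ → ES N → ℝ} (hs : ∀ n, ∀ t ∈ J, Smooth (g n t))
    (hg : TimeEqui J g) (hb : ∀ i j, LocBdd J fun n t => pd1 (pd1 (g n t) i) j) (i : Fin N) :
    TimeEqui J fun n t => pd1 (g n t) i := by
  intro R ε hε
  obtain ⟨K, hK, hb⟩ := LocBdd.exists_unif (ι := Fin N × Fin N) (fun a => hb a.1 a.2) (R + 1)
  set η : ℝ := min 1 (ε / (4 * ((N : ℝ) ^ 2 * K + 1))) with hη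
  have hη0 : 0 < η := lt_min one_pos (by positivity)
  have hη1 : η ≤ 1 := min_le_left _ _
  have hη2 : η * ((N : ℝ) ^ 2 * K) ≤ ε / 4 := by
    have h1 : η ≤ ε / (4 * ((N : ℝ) ^ 2 * K + 1)) := min_le_right _ _
    rw [le_div_iff₀ (by positivity)] at h1
    nlinarith
  obtain ⟨δ, hδ, hg⟩ := hg (R + 1) (ε * η / 4) (by positivity)
  refine ⟨δ, hδ, ?_⟩
  filter_upwards [hb, hg] with n hb hg t ht t' ht' htt x hx
  set y : ES N := η • EuclideanSpace.single i (1 : ℝ) with hy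
  have hyn : ‖y‖ = η := by simp [hy, norm_smul, abs_of_pos hη0]
  have hxR : x ∈ closedBall (0 : ES N) (R + 1) := closedBall_subset_closedBall (by linarith) hx
  have hxy : x + y ∈ closedBall (0 : ES N) (R + 1) := by
    rw [mem_closedBall_zero_iff] at *
    exact (norm_add_le _ _).trans (by linarith)
  have hsum : ∀ a : Fin N → ℝ, ∑ j, y j * a j = η * a i := by
    intro a
    simp [hy, PiLp.single_apply]
  have h1 := taylor_two (hs n t ht) (convex_closedBall 0 (R + 1))
    (fun k j z hz => hb (k, j) t ht z hz) hxR hxy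
  have h2 := taylor_two (hs n t' ht') (convex_closedBall 0 (R + 1))
    (fun k j z hz => hb (k, j) t' ht' z hz) hxR hxy
  rw [hsum, hyn, abs_of_pos hK] at h1 h2
  have h3 := hg t ht t' ht' htt x hxR
  have h4 := hg t ht t' ht' htt (x + y) hxy
  have h5 : ((N : ℝ) * η) ^ 2 * K ≤ η * (ε / 4) := by nlinarith
  have h6 : η * |_root_.pd1 (g n t) i x - _root_.pd1 (g n t') i x| ≤ η * ε := by
    rw [← abs_of_pos hη0, ← abs_mul, abs_of_pos hη0]
    rw [abs_le] at *
    constructor <;> nlinarith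
  exact le_of_mul_le_mul_left h6 hη0

lemma TimeEqui.pdl {g : ℕ → ℝ → ES N → ℝ} {m : ℕ} (hs : ∀ n, ∀ t ∈ J, Smooth (g n t))
    (hg : TimeEqui J g) (hb : ∀ I : List (Fin N), I.length ≤ m + 1 →
      LocBdd J fun n t => pdl I (g n t)) (I : List (Fin N)) (hI : I.length ≤ m) :
    TimeEqui J fun n t => pdl I (g n t) := by
  induction I with
  | nil => exact hg
  | cons i I ih =>
    simp only [List.length_cons] at hI
    exact TimeEqui.pd1 (g := fun n t => _root_.pdl I (g n t)) (fun n t ht => (hs n t ht).pdl I)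
      (ih (by omega)) (fun k j => hb (j :: k :: I) (by simp; omega)) i

/-! ### Limits along an ultrafilter -/

/-- A fixed non-principal ultrafilter. -/
abbrev hyp : Ultrafilter ℕ := hyperfilter ℕ

lemma hyp_le : (hyp : Filter ℕ) ≤ atTop := by
  rw [← Nat.cofinite_eq_atTop]; exact hyperfilter_le_cofinite

/-- Pointwise limit of a sequence of functions along a fixed ultrafilter. -/
def ulim (g : ℕ → ℝ → ES N → ℝ) (t : ℝ) (x : ES N) : ℝ := limUnder (hyp : Filter ℕ) fun n => g n t x

lemma exists_tendsto_hyp {a : ℕ → ℝ} {C : ℝ} (ha : ∀ᶠ n in atTop, |a n| ≤ C) :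
    ∃ l, Tendsto a hyp (𝓝 l) := by
  have h1 : ∀ᶠ n in (hyp : Filter ℕ), a n ∈ Icc (-C) C :=
    (ha.filter_mono hyp_le).mono fun n hn => abs_le.1 hn
  obtain ⟨l, -, hl⟩ := (isCompact_Icc (a := -C) (b := C)).ultrafilter_le_nhds (hyp.map a)
    (by rw [le_principal_iff]; exact h1)
  exact ⟨l, hl⟩

lemma LocBdd.tendsto_ulim {g : ℕ → ℝ → ES N → ℝ} (hg : LocBdd J g) {t : ℝ} (ht : t ∈ J)
    (x : ES N) : Tendsto (fun n => g n t x) hyp (𝓝 (ulim g t x)) := by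
  obtain ⟨C, hC⟩ := hg ‖x‖
  exact tendsto_nhds_limUnder (exists_tendsto_hyp (C := C) (hC.mono fun n h => h t ht x (by simp)))

lemma ulim_eq {g : ℕ → ℝ → ES N → ℝ} {t l : ℝ} {x : ES N}
    (h : Tendsto (fun n => g n t x) hyp (𝓝 l)) : ulim g t x = l := h.limUnder_eq

lemma contDiff_of_pdl {m : ℕ} {v : List (Fin N) → ES N → ℝ}
    (hd : ∀ I, I.length < m → ∀ x,
      HasFDerivAt (v I) (∑ i, v (i :: I) x • (EuclideanSpace.proj i : ES N →L[ℝ] ℝ)) x)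
    (hc : ∀ I, I.length ≤ m → Continuous (v I)) :
    ContDiff ℝ m (v []) ∧ ∀ I, I.length ≤ m → pdl I (v []) = v I := by
  refine ⟨?_, fun I => ?_⟩
  · have : ∀ k : ℕ, ∀ I, I.length + k ≤ m → ContDiff ℝ k (v I) := by
      intro k
      induction k with
      | zero => exact fun I hI => contDiff_zero.2 (hc I (by omega))
      | succ k ih =>
        intro I hI
        have h1 := fun x => hd I (by omega) x
        rw [Nat.cast_add, Nat.cast_one, contDiff_succ_iff_hasFDerivAt]
        exact ⟨_, ContDiff.sum fun i _ => (ih (i :: I) (by simp; omega)).smul contDiff_const, h1⟩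
    exact this m [] (by simp)
  · induction I with
    | nil => simp
    | cons i I ih =>
      intro hI
      simp only [List.length_cons] at hI
      rw [pdl_cons, ih (by omega)]
      ext x
      rw [pd1, (hd I (by omega) x).fderiv]
      simp [PiLp.single_apply]

lemma hasFDerivAt_of_quadratic {f : ES N → ℝ} {L : ES N →L[ℝ] ℝ} {x : ES N} {C : ℝ}
    (h : ∀ y, ‖y‖ ≤ 1 → |f (x + y) - f x - L y| ≤ C * ‖y‖ ^ 2) : HasFDerivAt f L x := by
  rw [hasFDerivAt_iff_isLittleO_nhds_zero]
  refine Asymptotics.IsBigO.trans_isLittleO ?_ (Asymptotics.isLittleO_norm_pow_id one_lt_two)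
  refine Asymptotics.IsBigO.of_bound C ?_
  filter_upwards [closedBall_mem_nhds (0 : ES N) one_pos] with y hy
  have := h y (by simpa using hy)
  simpa using this

lemma continuousOn_of_lipschitz_of_equi {v : ℝ → ES N → ℝ}
    (hx : ∀ R, ∃ L, ∀ t ∈ J, ∀ x ∈ closedBall (0 : ES N) R, ∀ y ∈ closedBall (0 : ES N) R,
      |v t x - v t y| ≤ L * ‖x - y‖)
    (ht : ∀ R, ∀ ε > 0, ∃ δ > 0, ∀ t ∈ J, ∀ t' ∈ J, |t - t'| < δ →
      ∀ x ∈ closedBall (0 : ES N) R, |v t x - v t' x| ≤ ε) :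
    ContinuousOn (fun p : ℝ × ES N => v p.1 p.2) (J ×ˢ univ) := by
  rw [Metric.continuousOn_iff]
  rintro ⟨t₀, x₀⟩ ⟨ht₀, -⟩ ε hε
  obtain ⟨L, hL⟩ := hx (‖x₀‖ + 1)
  obtain ⟨δ, hδ, hd⟩ := ht (‖x₀‖ + 1) (ε / 2) (by linarith)
  refine ⟨min δ (min 1 (ε / (2 * (|L| + 1)))), by positivity, ?_⟩
  rintro ⟨t, x⟩ ⟨ht, -⟩ hdist
  simp only [Prod.dist_eq, max_lt_iff, lt_min_iff] at hdist ⊢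
  obtain ⟨h1, h5, h6⟩ : dist t t₀ < δ ∧ dist x x₀ < 1 ∧ dist x x₀ < ε / (2 * (|L| + 1)) := by
    tauto
  rw [Real.dist_eq] at *
  rw [dist_eq_norm] at h5 h6
  have hx0 : x₀ ∈ closedBall (0 : ES N) (‖x₀‖ + 1) := by simp
  have hx : x ∈ closedBall (0 : ES N) (‖x₀‖ + 1) := by
    rw [mem_closedBall_zero_iff]
    have := norm_sub_norm_le x x₀
    linarith
  have e1 := hL t ht x hx x₀ hx0
  have e2 := hd t ht t₀ ht₀ h1 x₀ hx0
  have e3 : L * ‖x - x₀‖ < ε / 2 := by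
    rw [lt_div_iff₀ (by positivity)] at h6
    have := mul_le_mul_of_nonneg_right (le_abs_self L) (norm_nonneg (x - x₀))
    nlinarith [norm_nonneg (x - x₀)]
  calc |v t x - v t₀ x₀| = |(v t x - v t x₀) + (v t x₀ - v t₀ x₀)| := by ring_nf
    _ ≤ _ := abs_add_le _ _
    _ < ε := by linarith

section Limit

variable {m : ℕ} {w : ℕ → ℝ → ES N → ℝ}

theorem ulim_regularity (hs : ∀ n, ∀ t ∈ J, Smooth (w n t))
    (hb : ∀ I : List (Fin N), I.length ≤ m + 1 → LocBdd J fun n t => pdl I (w n t))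
    (ht : TimeEqui J w) :
    (∀ t ∈ J, ContDiff ℝ m (ulim w t)) ∧ ∀ I : List (Fin N), I.length ≤ m →
      (∀ t ∈ J, ∀ x, Tendsto (fun n => pdl I (w n t) x) hyp (𝓝 (pdl I (ulim w t) x))) ∧
      ContinuousOn (fun p : ℝ × ES N => pdl I (ulim w p.1) p.2) (J ×ˢ univ) := by
  set v : List (Fin N) → ℝ → ES N → ℝ := fun I => ulim fun n t => pdl I (w n t) with hv
  have hlim : ∀ I : List (Fin N), I.length ≤ m + 1 → ∀ t ∈ J, ∀ x,
      Tendsto (fun n => pdl I (w n t) x) hyp (𝓝 (v I t x)) :=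
    fun I hI t ht x => (hb I hI).tendsto_ulim ht x
  have hlip : ∀ I : List (Fin N), I.length ≤ m → ∀ R, ∃ L, ∀ t ∈ J, ∀ x ∈ closedBall (0 : ES N) R,
      ∀ y ∈ closedBall (0 : ES N) R, |v I t x - v I t y| ≤ L * ‖x - y‖ := by
    intro I hI R
    obtain ⟨K, hK, h⟩ := LocBdd.exists_unif (fun i => hb (i :: I) (by simpa using hI)) R
    refine ⟨N * K, fun t ht x hx y hy => ?_⟩
    refine le_of_tendsto ((hlim I (by omega) t ht x).sub (hlim I (by omega) t ht y)).abs ?_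
    filter_upwards [h.filter_mono hyp_le] with n hn
    have := taylor_one ((hs n t ht).pdl I) (convex_closedBall 0 R)
      (fun i z hz => hn i t ht z hz) hy (y := x - y) (by simpa using hx)
    rw [add_sub_cancel] at this
    linarith
  have hder : ∀ t ∈ J, ∀ I : List (Fin N), I.length < m → ∀ x, HasFDerivAt (v I t)
      (∑ i, v (i :: I) t x • (EuclideanSpace.proj i : ES N →L[ℝ] ℝ)) x := by
    intro t ht I hI x
    obtain ⟨K, hK, h⟩ := LocBdd.exists_unif (ι := Fin N × Fin N)
      (fun a => hb (a.2 :: a.1 :: I) (by simp; omega)) (‖x‖ + 1)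
    refine hasFDerivAt_of_quadratic (C := (N : ℝ) ^ 2 * K) fun y hy => ?_
    have hl : Tendsto (fun n => pdl I (w n t) (x + y) - pdl I (w n t) x
        - ∑ i, y i * pdl (i :: I) (w n t) x) hyp
        (𝓝 (v I t (x + y) - v I t x - ∑ i, y i * v (i :: I) t x)) :=
      ((hlim I (by omega) t ht (x + y)).sub (hlim I (by omega) t ht x)).sub
        (tendsto_finsetSum _ fun i _ => (hlim (i :: I) (by simp; omega) t ht x).const_mul _)
    have e : (∑ i, v (i :: I) t x • (EuclideanSpace.proj i : ES N →L[ℝ] ℝ)) y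
        = ∑ i, y i * v (i :: I) t x := by
      simp [mul_comm]
    rw [e]
    refine le_of_tendsto hl.abs ?_
    filter_upwards [h.filter_mono hyp_le] with n hn
    have := taylor_two ((hs n t ht).pdl I) (convex_closedBall 0 (‖x‖ + 1)) (x := x) (y := y)
      (fun i j z hz => hn (i, j) t ht z hz) (by simp)
      (by rw [mem_closedBall_zero_iff]; exact (norm_add_le _ _).trans (by linarith))
    rw [abs_of_pos hK] at this
    refine this.trans (le_of_eq ?_)
    ring
  have hequi : ∀ I : List (Fin N), I.length ≤ m → ∀ R, ∀ ε > 0, ∃ δ > 0, ∀ t ∈ J, ∀ t' ∈ J,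
      |t - t'| < δ → ∀ x ∈ closedBall (0 : ES N) R, |v I t x - v I t' x| ≤ ε := by
    intro I hI R ε hε
    obtain ⟨δ, hδ, h⟩ := TimeEqui.pdl hs ht hb I hI R ε hε
    refine ⟨δ, hδ, fun t ht t' ht' htt x hx => ?_⟩
    refine le_of_tendsto ((hlim I (by omega) t ht x).sub (hlim I (by omega) t' ht' x)).abs ?_
    filter_upwards [h.filter_mono hyp_le] with n hn
    exact hn t ht t' ht' htt x hx
  have hcont : ∀ I : List (Fin N), I.length ≤ m →
      ContinuousOn (fun p : ℝ × ES N => v I p.1 p.2) (J ×ˢ univ) := fun I hI =>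
    continuousOn_of_lipschitz_of_equi (hlip I hI) (hequi I hI)
  have hmain : ∀ t ∈ J, ContDiff ℝ m (ulim w t) ∧
      ∀ I : List (Fin N), I.length ≤ m → pdl I (ulim w t) = v I t := fun t ht =>
    contDiff_of_pdl (v := fun I => v I t) (hder t ht) fun I hI => by
      have := (hcont I hI).comp_continuous (f := fun x : ES N => (t, x)) (by fun_prop)
        (fun x => ⟨ht, mem_univ _⟩)
      exact this
  refine ⟨fun t ht => (hmain t ht).1, fun I hI => ⟨fun t ht x => ?_, ?_⟩⟩
  · rw [(hmain t ht).2 I hI]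
    exact hlim I (by omega) t ht x
  · refine (hcont I hI).congr ?_
    rintro ⟨t, x⟩ ⟨ht, -⟩
    exact congrFun ((hmain t ht).2 I hI) x

theorem ulim_hasDerivWithinAt {F : ℕ → ℝ → ES N → ℝ} {t g : ℝ} {x : ES N} (htJ : t ∈ J)
    (hb : LocBdd J w) (hF : Tendsto (fun n => F n t x) hyp (𝓝 g))
    (h : ∀ ε > 0, ∃ δ > 0, ∃ η : ℕ → ℝ, Tendsto η atTop (𝓝 0) ∧ ∀ᶠ n in atTop, ∀ t' ∈ J,
      |t' - t| < δ → |w n t' x - w n t x - (t' - t) * F n t x| ≤ ε * |t' - t| + η n) :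
    HasDerivWithinAt (fun t' => ulim w t' x) g J t := by
  rw [hasDerivWithinAt_iff_isLittleO, Asymptotics.isLittleO_iff]
  intro ε hε
  obtain ⟨δ, hδ, η, hη, h⟩ := h ε hε
  have h1 : ∀ᶠ t' in 𝓝[J] t, |t' - t| < δ := by
    refine mem_nhdsWithin_of_mem_nhds ?_
    filter_upwards [ball_mem_nhds t hδ] with t' ht'
    rwa [mem_ball, Real.dist_eq] at ht'
  filter_upwards [h1, self_mem_nhdsWithin] with t' ht' ht'J
  rw [smul_eq_mul, Real.norm_eq_abs, Real.norm_eq_abs]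
  have hl := (((hb.tendsto_ulim ht'J x).sub (hb.tendsto_ulim htJ x)).sub
    (hF.const_mul (t' - t))).abs
  have hr : Tendsto (fun n => ε * |t' - t| + η n) hyp (𝓝 (ε * |t' - t| + 0)) :=
    tendsto_const_nhds.add (hη.mono_left hyp_le)
  rw [add_zero] at hr
  refine le_of_tendsto_of_tendsto hl hr ?_
  filter_upwards [h.filter_mono hyp_le] with n hn
  exact hn t' ht'J ht'

end Limit

end Sequences

/-! ### A one-step approximation of the evolution -/

section Scheme

variable {N : ℕ}

/-- The sign attached to a boolean. -/
def sg (e : Bool) : ℝ := if e then 1 else -1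

lemma sg_mul_self (e : Bool) : sg e * sg e = 1 := by cases e <;> simp [sg]

lemma abs_sg (e : Bool) : |sg e| = 1 := by cases e <;> simp [sg]

/-- Parameters of one step: the current time and the square root of the step size. -/
abbrev Par := ℝ × Icc (0 : ℝ) 1

variable (σ : ℝ → Fin N → Fin N → ES N → ℝ) (b : ℝ → Fin N → ES N → ℝ) (c : ℝ → ES N → ℝ)

/-- The displaced point of one step. -/
def stepPt (p : Par) (k : Fin N) (e : Bool) (x : ES N) : ES N :=
  WithLp.toLp 2 fun i => x i + p.2 * sg e * σ p.1 k i x + (p.2 : ℝ) ^ 2 * b p.1 i x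

/-- One step of the approximation scheme. -/
def step (p : Par) (f : ES N → ℝ) (x : ES N) : ℝ :=
  (2 * N : ℝ)⁻¹ * ∑ k, ∑ e, (1 + (p.2 : ℝ) ^ 2 * c p.1 x) * f (stepPt σ b p k e x)

/-- Perturbation of the identity matrix with entries of the orders appearing in one step. -/
def stepMat {ι : Type} (r : ℝ) (e : Bool) (i j : ι) (θ γ : ℝ) : ℝ :=
  (if i = j then 1 else 0) + r * sg e * θ + r ^ 2 * γ

variable {σ b c}

lemma smooth_stepPt (hσ : ∀ k i, UB fun t => σ t k i) (hb : ∀ i, UB fun t => b t i) (p : Par)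
    (k : Fin N) (e : Bool) : ContDiff ℝ ((⊤ : ℕ∞) : WithTop ℕ∞) (stepPt σ b p k e) := by
  rw [contDiff_euclidean]
  intro i
  have h1 := (hσ k i).smooth p.1
  have h2 := (hb i).smooth p.1
  have h3 : Smooth fun x : ES N => x i := (EuclideanSpace.proj (𝕜 := ℝ) i).contDiff
  exact (h3.add (contDiff_const.mul h1)).add (contDiff_const.mul h2)

lemma smooth_step (hσ : ∀ k i, UB fun t => σ t k i) (hb : ∀ i, UB fun t => b t i) (hc : UB c)
    (p : Par) {f : ES N → ℝ} (hf : Smooth f) : Smooth (step σ b c p f) := by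
  refine contDiff_const.mul (ContDiff.sum fun k _ => ContDiff.sum fun e _ => ?_)
  exact (contDiff_const.add (contDiff_const.mul (hc.smooth p.1))).mul
    (hf.comp (smooth_stepPt hσ hb p k e))

lemma pd1_add_mul_add_mul {f g h : ES N → ℝ} {x : ES N} (hf : DifferentiableAt ℝ f x)
    (hg : DifferentiableAt ℝ g x) (hh : DifferentiableAt ℝ h x) (s s' : ℝ) (i : Fin N) :
    pd1 (fun y => f y + s * g y + s' * h y) i x
      = pd1 f i x + s * pd1 g i x + s' * pd1 h i x := by
  rw [pd1_add (hf.fun_add (hg.const_mul s)) (hh.const_mul s'), pd1_add hf (hg.const_mul s),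
    pd1_const_mul _ hg, pd1_const_mul _ hh]

lemma pd1_stepPt (hσ : ∀ k i, UB fun t => σ t k i) (hb : ∀ i, UB fun t => b t i) (p : Par)
    (k : Fin N) (e : Bool) (i j : Fin N) (x : ES N) :
    pd1 (fun y => stepPt σ b p k e y j) i x =
      stepMat p.2 e i j (pd1 (σ p.1 k j) i x) (pd1 (b p.1 j) i x) := by
  have h1 := (hσ k j).differentiableAt p.1 x
  have h2 := (hb j).differentiableAt p.1 x
  have h3 : DifferentiableAt ℝ (fun x : ES N => x j) x := by fun_prop
  have h4 : pd1 (fun x : ES N => x j) i x = if i = j then 1 else 0 := by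
    have : (fun x : ES N => x j) = EuclideanSpace.proj (𝕜 := ℝ) j := rfl
    rw [pd1, this, ContinuousLinearMap.fderiv]
    simp [PiLp.single_apply, eq_comm]
  simp only [stepPt, stepMat]
  rw [pd1_add_mul_add_mul h3 h1 h2, h4]
  congr

/-- A finite set of words of derivatives on which one step acts by a matrix. -/
structure StepClosure (σ : ℝ → Fin N → Fin N → ES N → ℝ) (b : ℝ → Fin N → ES N → ℝ)
    (c : ℝ → ES N → ℝ) {ι : Type} [Fintype ι] (w : ι → List (Fin N))
    (Θ : Fin N → ι → ι → Par → ES N → ℝ) (C : Fin N → Bool → ι → ι → Par → ES N → ℝ) : Prop where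
  ubΘ : ∀ k a a', UB (Θ k a a')
  ubC : ∀ k e a a', UB (C k e a a')
  eq : ∀ (p : Par) (f : ES N → ℝ), Smooth f → ∀ a x, pdl (w a) (step σ b c p f) x =
    (2 * N : ℝ)⁻¹ * ∑ k, ∑ e, ∑ a', stepMat p.2 e a a' (Θ k a a' p x) (C k e a a' p x)
      * pdl (w a') f (stepPt σ b p k e x)

lemma UB.par {g : ℝ → ES N → ℝ} (hg : UB g) : UB fun p : Par => g p.1 := hg.reindex _

lemma UB.par_pow (n : ℕ) (s : ℝ) : UB fun (p : Par) (_ : ES N) => (p.2 : ℝ) ^ n * s := by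
  refine UB.const (a := fun p : Par => (p.2 : ℝ) ^ n * s) (C := |s|) fun p => ?_
  rw [abs_mul, abs_of_nonneg (pow_nonneg p.2.2.1 n)]
  exact mul_le_of_le_one_left (abs_nonneg _) (pow_le_one₀ p.2.2.1 p.2.2.2)

lemma StepClosure.succ (hσ : ∀ k i, UB fun t => σ t k i) (hb : ∀ i, UB fun t => b t i)
    {ι : Type} [Fintype ι] {w : ι → List (Fin N)}
    {Θ : Fin N → ι → ι → Par → ES N → ℝ} {C : Fin N → Bool → ι → ι → Par → ES N → ℝ}
    (h : StepClosure σ b c w Θ C) :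
    ∃ Θ' C', StepClosure σ b c
      (fun a : ι × Option (Fin N) => a.2.elim (w a.1) fun i => i :: w a.1) Θ' C' := by
  let Θ' : Fin N → ι × Option (Fin N) → ι × Option (Fin N) → Par → ES N → ℝ :=
    fun k a a' => match a, a' with
    | (a, none), (a', none) => Θ k a a'
    | (_, none), (_, some _) => fun _ _ => 0
    | (a, some i), (a', none) => fun p => pd1 (Θ k a a' p) i
    | (a, some i), (a', some j) => fun p x =>
        (if a = a' then 1 else 0) * pd1 (σ p.1 k j) i x + (if i = j then 1 else 0) * Θ k a a' p x
  let C' : Fin N → Bool → ι × Option (Fin N) → ι × Option (Fin N) → Par → ES N → ℝ :=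
    fun k e a a' => match a, a' with
    | (a, none), (a', none) => C k e a a'
    | (_, none), (_, some _) => fun _ _ => 0
    | (a, some i), (a', none) => fun p => pd1 (C k e a a' p) i
    | (a, some i), (a', some j) => fun p x =>
        (Θ k a a' p x * pd1 (σ p.1 k j) i x + ((if a = a' then 1 else 0) * pd1 (b p.1 j) i x
          + (if i = j then 1 else 0) * C k e a a' p x))
        + ((p.2 : ℝ) ^ 1 * sg e * (Θ k a a' p x * pd1 (b p.1 j) i x
            + C k e a a' p x * pd1 (σ p.1 k j) i x)
          + (p.2 : ℝ) ^ 2 * 1 * (C k e a a' p x * pd1 (b p.1 j) i x))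
  have ub0 : UB fun (_ : Par) (_ : ES N) => (0 : ℝ) := UB.const (a := fun _ => 0) (C := 0) (by simp)
  refine ⟨Θ', C', ?_, ?_, ?_⟩
  · rintro k ⟨a, _ | i⟩ ⟨a', _ | j⟩
    · exact h.ubΘ k a a'
    · exact ub0
    · exact (h.ubΘ k a a').pd1 i
    · exact (((hσ k j).pd1 i).par.const_mul _).add ((h.ubΘ k a a').const_mul _)
  · rintro k e ⟨a, _ | i⟩ ⟨a', _ | j⟩
    · exact h.ubC k e a a'
    · exact ub0
    · exact (h.ubC k e a a').pd1 i
    · have s1 := ((hσ k j).pd1 i).par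
      have s2 := ((hb j).pd1 i).par
      have s3 := h.ubΘ k a a'
      have s4 := h.ubC k e a a'
      exact ((s3.mul s1).add ((s2.const_mul _).add (s4.const_mul _))).add
        (((UB.par_pow 1 _).mul ((s3.mul s2).add (s4.mul s1))).add ((UB.par_pow 2 1).mul (s4.mul s2)))
  · rintro p f hf ⟨a, _ | i⟩ x
    · simp only [Option.elim_none]
      rw [h.eq p f hf a x]
      congr 1
      refine Finset.sum_congr rfl fun k _ => Finset.sum_congr rfl fun e _ => ?_
      rw [Fintype.sum_prod_type]
      refine Finset.sum_congr rfl fun a' _ => ?_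
      rw [Fintype.sum_option]
      simp [stepMat, Θ', C']
    · simp only [Option.elim_some, pdl_cons]
      have e1 : pdl (w a) (step σ b c p f) = fun x => (2 * N : ℝ)⁻¹ * ∑ k, ∑ e, ∑ a',
          stepMat p.2 e a a' (Θ k a a' p x) (C k e a a' p x)
            * pdl (w a') f (stepPt σ b p k e x) := funext (h.eq p f hf a)
      have dM : ∀ k e a', DifferentiableAt ℝ
          (fun x => stepMat p.2 e a a' (Θ k a a' p x) (C k e a a' p x)) x := fun k e a' =>
        ((differentiableAt_const _).add (((h.ubΘ k a a').differentiableAt p x).const_mul _)).add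
          (((h.ubC k e a a').differentiableAt p x).const_mul _)
      have dY : ∀ k e, Differentiable ℝ (stepPt σ b p k e) := fun k e =>
        (smooth_stepPt hσ hb p k e).differentiable (by simp)
      have dF : ∀ k e a', DifferentiableAt ℝ (fun x => pdl (w a') f (stepPt σ b p k e x)) x :=
        fun k e a' => ((hf.pdl (w a')).differentiable _).comp x (dY k e x)
      have d1 : ∀ k e a', DifferentiableAt ℝ
          (fun x => stepMat p.2 e a a' (Θ k a a' p x) (C k e a a' p x)
            * pdl (w a') f (stepPt σ b p k e x)) x := fun k e a' => (dM k e a').mul (dF k e a')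
      have d2 : ∀ k e, DifferentiableAt ℝ (fun x => ∑ a',
          stepMat p.2 e a a' (Θ k a a' p x) (C k e a a' p x)
            * pdl (w a') f (stepPt σ b p k e x)) x := fun k e =>
        DifferentiableAt.fun_sum fun a' _ => d1 k e a'
      have d3 : ∀ k, DifferentiableAt ℝ (fun x => ∑ e, ∑ a',
          stepMat p.2 e a a' (Θ k a a' p x) (C k e a a' p x)
            * pdl (w a') f (stepPt σ b p k e x)) x := fun k =>
        DifferentiableAt.fun_sum fun e _ => d2 k e
      rw [e1, pd1_const_mul _ (DifferentiableAt.fun_sum fun k _ => d3 k),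
        pd1_sum _ fun k _ => d3 k]
      congr 1
      refine Finset.sum_congr rfl fun k _ => ?_
      rw [pd1_sum _ fun e _ => d2 k e]
      refine Finset.sum_congr rfl fun e _ => ?_
      rw [pd1_sum _ fun a' _ => d1 k e a', Fintype.sum_prod_type]
      refine Finset.sum_congr rfl fun a' _ => ?_
      rw [pd1_mul (dM k e a') (dF k e a'), Fintype.sum_option]
      have e2 : pd1 (fun x => stepMat p.2 e a a' (Θ k a a' p x) (C k e a a' p x)) i x
          = p.2 * sg e * pd1 (Θ k a a' p) i x + (p.2 : ℝ) ^ 2 * pd1 (C k e a a' p) i x := by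
        have g1 := (h.ubΘ k a a').differentiableAt p x
        have g2 := (h.ubC k e a a').differentiableAt p x
        simp only [stepMat]
        rw [pd1_add_mul_add_mul (differentiableAt_const _) g1 g2, pd1_const, zero_add]
      have e3 : pd1 (fun x => pdl (w a') f (stepPt σ b p k e x)) i x =
          ∑ j, pdl (j :: w a') f (stepPt σ b p k e x)
            * stepMat p.2 e i j (pd1 (σ p.1 k j) i x) (pd1 (b p.1 j) i x) := by
        have := pd1_comp (hf.pdl (w a')).differentiable (dY k e x) i
        rw [this]
        exact Finset.sum_congr rfl fun j _ => by rw [pd1_stepPt hσ hb]; rfl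
      rw [e2, e3, Finset.mul_sum]
      congr 1
      · simp [stepMat, Θ', C']
      · refine Finset.sum_congr rfl fun j _ => ?_
        simp only [stepMat, Θ', C', Prod.mk.injEq, Option.some.injEq, Option.elim_some]
        have := sg_mul_self e
        split_ifs <;> grind

lemma exists_stepClosure (hσ : ∀ k i, UB fun t => σ t k i) (hb : ∀ i, UB fun t => b t i)
    (hc : UB c) (m : ℕ) : ∃ (ι : Type) (_ : Fintype ι) (w : ι → List (Fin N))
      (Θ : Fin N → ι → ι → Par → ES N → ℝ) (C : Fin N → Bool → ι → ι → Par → ES N → ℝ),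
      StepClosure σ b c w Θ C ∧ ∀ I : List (Fin N), I.length ≤ m → ∃ a, w a = I := by
  induction m with
  | zero =>
    refine ⟨Unit, inferInstance, fun _ => [], fun _ _ _ _ _ => 0, fun _ _ _ _ p => c p.1,
      ⟨fun _ _ _ => UB.const (a := fun _ => 0) (C := 0) (by simp), fun _ _ _ _ => hc.par, ?_⟩, ?_⟩
    · intro p f _ a x
      simp [step, stepMat]
    · intro I hI
      exact ⟨(), (List.length_eq_zero_iff.1 (by omega)).symm⟩
  | succ m ih =>
    obtain ⟨ι, _, w, Θ, C, h, hw⟩ := ih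
    obtain ⟨Θ', C', h'⟩ := h.succ hσ hb
    refine ⟨ι × Option (Fin N), inferInstance, _, Θ', C', h', fun I hI => ?_⟩
    cases I with
    | nil =>
      obtain ⟨a, ha⟩ := hw [] (by simp)
      exact ⟨(a, none), ha⟩
    | cons i I =>
      obtain ⟨a, ha⟩ := hw I (by simpa using hI)
      exact ⟨(a, some i), by simp [ha]⟩

/-! ### Stability -/

lemma sq_sum_mul_le {ι : Type} [Fintype ι] {v θ : ι → ℝ} {B : ℝ} (hθ : ∀ a, |θ a| ≤ B) :
    (∑ a, v a * θ a) ^ 2 ≤ Fintype.card ι * B ^ 2 * ∑ a, v a ^ 2 := by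
  have h1 := Finset.sum_mul_sq_le_sq_mul_sq Finset.univ v θ
  have h2 : ∑ a, θ a ^ 2 ≤ Fintype.card ι * B ^ 2 := by
    calc ∑ a, θ a ^ 2 ≤ ∑ _a : ι, B ^ 2 := Finset.sum_le_sum fun a _ => by
          rw [← sq_abs]; exact pow_le_pow_left₀ (abs_nonneg _) (hθ a) 2
      _ = _ := by simp
  have h3 : 0 ≤ ∑ a, v a ^ 2 := Finset.sum_nonneg fun a _ => sq_nonneg _
  nlinarith

lemma sum_sq_stepMat_le {ι : Type} [Fintype ι] {B r : ℝ} (hr : r ∈ Icc (0 : ℝ) 1) (e : Bool)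
    (v : ι → ℝ) {Θ C : ι → ι → ℝ} (hΘ : ∀ a a', |Θ a a'| ≤ B) (hC : ∀ a a', |C a a'| ≤ B) :
    ∑ a', (∑ a, v a * stepMat r e a a' (Θ a a') (C a a')) ^ 2 ≤
      ∑ a, v a ^ 2 + 2 * r * sg e * ∑ a', v a' * ∑ a, v a * Θ a a'
        + (1 + 5 * (Fintype.card ι * (Fintype.card ι * B ^ 2))) * r ^ 2 * ∑ a, v a ^ 2 := by
  set S := ∑ a, v a ^ 2 with hS
  set D := Fintype.card ι * B ^ 2 * S with hD
  have h1 : ∀ a', (∑ a, v a * stepMat r e a a' (Θ a a') (C a a')) ^ 2 ≤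
      v a' ^ 2 + 2 * r * sg e * (v a' * ∑ a, v a * Θ a a') + r ^ 2 * (v a' ^ 2 + 5 * D) := by
    intro a'
    have e1 : ∑ a, v a * stepMat r e a a' (Θ a a') (C a a')
        = v a' + r * sg e * ∑ a, v a * Θ a a' + r ^ 2 * ∑ a, v a * C a a' := by
      simp only [stepMat, mul_add, Finset.sum_add_distrib, Finset.mul_sum]
      congr 1
      · congr 1
        · simp
        · exact Finset.sum_congr rfl fun a _ => by ring
      · exact Finset.sum_congr rfl fun a _ => by ring
    have e2 : (∑ a, v a * Θ a a') ^ 2 ≤ D := sq_sum_mul_le fun a => hΘ a a'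
    have e3 : (∑ a, v a * C a a') ^ 2 ≤ D := sq_sum_mul_le fun a => hC a a'
    rw [e1]
    generalize (∑ a, v a * Θ a a') = θ at *
    generalize (∑ a, v a * C a a') = γ at *
    have e4 := sg_mul_self e
    have e5 : (v a' + r * sg e * θ + r ^ 2 * γ) ^ 2 = v a' ^ 2 + 2 * r * sg e * (v a' * θ)
        + r ^ 2 * (2 * v a' * γ + (sg e * sg e) * θ ^ 2 + 2 * (r * sg e) * θ * γ + r ^ 2 * γ ^ 2) := by
      ring
    rw [e5, e4]
    have e6 : 2 * v a' * γ ≤ v a' ^ 2 + γ ^ 2 := two_mul_le_add_sq _ _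
    have e7 : r ^ 2 * γ ^ 2 ≤ γ ^ 2 :=
      mul_le_of_le_one_left (sq_nonneg _) (pow_le_one₀ hr.1 hr.2)
    have e8 : 2 * (r * sg e) * θ * γ ≤ θ ^ 2 + r ^ 2 * γ ^ 2 := by
      have := sq_nonneg (θ - r * sg e * γ)
      have e9 : (r * sg e * γ) ^ 2 = r ^ 2 * γ ^ 2 * (sg e * sg e) := by ring
      rw [e4] at e9
      nlinarith
    have : r ^ 2 * (2 * v a' * γ + 1 * θ ^ 2 + 2 * (r * sg e) * θ * γ + r ^ 2 * γ ^ 2)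
        ≤ r ^ 2 * (v a' ^ 2 + 5 * D) := mul_le_mul_of_nonneg_left (by linarith) (sq_nonneg r)
    linarith
  refine (Finset.sum_le_sum fun a' _ => h1 a').trans (le_of_eq ?_)
  simp only [Finset.sum_add_distrib, ← Finset.mul_sum]
  simp only [Finset.sum_const, Finset.card_univ, nsmul_eq_mul]
  rw [← hS, hD]
  ring

theorem StepClosure.stable (hN : 1 ≤ N) {ι : Type} [Fintype ι] {w : ι → List (Fin N)}
    {Θ : Fin N → ι → ι → Par → ES N → ℝ} {C : Fin N → Bool → ι → ι → Par → ES N → ℝ}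
    (h : StepClosure σ b c w Θ C) : ∃ K ≥ 0, ∀ (p : Par) (f : ES N → ℝ), Smooth f → ∀ G,
      (∀ x, ∑ a, pdl (w a) f x ^ 2 ≤ G) →
        ∀ x, (1 - K * (p.2 : ℝ) ^ 2) * ∑ a, pdl (w a) (step σ b c p f) x ^ 2 ≤ G := by
  choose B₁ hB₁ using fun k a a' => (h.ubΘ k a a').bdd
  choose B₂ hB₂ using fun k e a a' => (h.ubC k e a a').bdd
  obtain ⟨B, hBΘ, hBC⟩ : ∃ B, (∀ k a a', B₁ k a a' ≤ B) ∧ ∀ k e a a', B₂ k e a a' ≤ B := by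
    obtain ⟨M₁, hM₁⟩ := (finite_range fun z : Fin N × ι × ι => B₁ z.1 z.2.1 z.2.2).bddAbove
    obtain ⟨M₂, hM₂⟩ :=
      (finite_range fun z : Fin N × Bool × ι × ι => B₂ z.1 z.2.1 z.2.2.1 z.2.2.2).bddAbove
    exact ⟨max M₁ M₂, fun k a a' => (hM₁ ⟨(k, a, a'), rfl⟩).trans (le_max_left _ _),
      fun k e a a' => (hM₂ ⟨(k, e, a, a'), rfl⟩).trans (le_max_right _ _)⟩
  set K : ℝ := 1 + 5 * (Fintype.card ι * (Fintype.card ι * B ^ 2)) with hK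
  refine ⟨K, by positivity, fun p f hf G hG x => ?_⟩
  set v : ι → ℝ := fun a => pdl (w a) (step σ b c p f) x with hv
  set r : ℝ := p.2.1 with hr
  set S := ∑ a, v a ^ 2 with hS
  let L : Fin N → ℝ := fun k => ∑ a', v a' * ∑ a, v a * Θ k a a' p x
  let M : Fin N → Bool → ι → ι → ℝ := fun k e a a' =>
    stepMat r e a a' (Θ k a a' p x) (C k e a a' p x)
  have e1 : S = (2 * N : ℝ)⁻¹ * ∑ k, ∑ e, ∑ a', (∑ a, v a * M k e a a')
      * pdl (w a') f (stepPt σ b p k e x) := by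
    have : S = ∑ a, v a * ((2 * N : ℝ)⁻¹ * ∑ k, ∑ e, ∑ a', M k e a a'
        * pdl (w a') f (stepPt σ b p k e x)) := by
      refine Finset.sum_congr rfl fun a _ => ?_
      rw [sq]; congr 1
      exact h.eq p f hf a x
    rw [this]
    simp only [Finset.mul_sum, Finset.sum_mul]
    rw [Finset.sum_comm]
    refine Finset.sum_congr rfl fun k _ => ?_
    rw [Finset.sum_comm]
    refine Finset.sum_congr rfl fun e _ => ?_
    rw [Finset.sum_comm]
    refine Finset.sum_congr rfl fun a' _ => Finset.sum_congr rfl fun a _ => ?_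
    ring
  have e2 : ∀ k e, ∑ a', (∑ a, v a * M k e a a') * pdl (w a') f (stepPt σ b p k e x)
      ≤ 1 / 2 * (S + 2 * r * sg e * L k + K * r ^ 2 * S + G) := by
    intro k e
    have g1 := sum_sq_stepMat_le (r := r) p.2.2 e v (Θ := fun a a' => Θ k a a' p x)
      (C := fun a a' => C k e a a' p x) (B := B) (fun a a' => (hB₁ k a a' p x).trans (hBΘ k a a'))
      (fun a a' => (hB₂ k e a a' p x).trans (hBC k e a a'))
    have g2 := hG (stepPt σ b p k e x)
    have g3 : ∑ a', (∑ a, v a * M k e a a') * pdl (w a') f (stepPt σ b p k e x) ≤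
        ∑ a', 1 / 2 * ((∑ a, v a * M k e a a') ^ 2 + pdl (w a') f (stepPt σ b p k e x) ^ 2) :=
      Finset.sum_le_sum fun a' _ => by
        have := two_mul_le_add_sq (∑ a, v a * M k e a a') (pdl (w a') f (stepPt σ b p k e x))
        linarith
    rw [← Finset.mul_sum, Finset.sum_add_distrib] at g3
    refine g3.trans ?_
    have g4 : ∑ a', (∑ a, v a * M k e a a') ^ 2 ≤ S + 2 * r * sg e * L k + K * r ^ 2 * S := g1
    linarith
  have hN' : (0 : ℝ) < 2 * N := by positivity
  have e3 : S ≤ 1 / 2 * (S + K * r ^ 2 * S + G) := by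
    calc S ≤ (2 * N : ℝ)⁻¹ * ∑ k, ∑ e, 1 / 2 * (S + 2 * r * sg e * L k + K * r ^ 2 * S + G) := by
          refine e1.le.trans ?_
          refine mul_le_mul_of_nonneg_left ?_ (inv_nonneg.2 hN'.le)
          exact Finset.sum_le_sum fun k _ => Finset.sum_le_sum fun e _ => e2 k e
      _ = (2 * N : ℝ)⁻¹ * ∑ k : Fin N, (S + K * r ^ 2 * S + G) := by
          congr 1
          refine Finset.sum_congr rfl fun k _ => ?_
          simp [sg]; ring
      _ = 1 / 2 * (S + K * r ^ 2 * S + G) := by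
          simp only [Finset.sum_const, Finset.card_univ, Fintype.card_fin, nsmul_eq_mul]
          field_simp
  linarith

end Scheme

/-! ### The elliptic operator along sequences -/

section Operator

variable {N : ℕ}

/-- The elliptic operator with coefficients given as families of functions of the space variable. -/
def ell (q : ℝ → Fin N → Fin N → ES N → ℝ) (b : ℝ → Fin N → ES N → ℝ) (c : ℝ → ES N → ℝ) (t : ℝ)
    (g : ES N → ℝ) (x : ES N) : ℝ :=
  (∑ i, ∑ j, q t i j x * pdl [i, j] g x) + (∑ j, b t j x * pdl [j] g x) + c t x * g x

variable {J : Set ℝ} {w : ℕ → ℝ → ES N → ℝ} {q : ℕ → ℝ → Fin N → Fin N → ES N → ℝ}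
  {b : ℕ → ℝ → Fin N → ES N → ℝ} {c : ℕ → ℝ → ES N → ℝ}

lemma LocBdd.ell (hq : ∀ i j, LocBdd J fun n t => q n t i j) (hb : ∀ j, LocBdd J fun n t => b n t j)
    (hc : LocBdd J c) (hw : ∀ I : List (Fin N), I.length ≤ 2 → LocBdd J fun n t => pdl I (w n t)) :
    LocBdd J fun n t x => _root_.ell (q n) (b n) (c n) t (w n t) x :=
  ((LocBdd.sum _ fun i _ => LocBdd.sum _ fun j _ => (hq i j).mul (hw [i, j] (by simp))).add
    (LocBdd.sum _ fun j _ => (hb j).mul (hw [j] (by simp)))).add (hc.mul (hw [] (by simp)))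

lemma TimeEqui.ell (hq : ∀ i j, LocBdd J fun n t => q n t i j)
    (hb : ∀ j, LocBdd J fun n t => b n t j) (hc : LocBdd J c)
    (hw : ∀ I : List (Fin N), I.length ≤ 2 → LocBdd J fun n t => _root_.pdl I (w n t))
    (hq' : ∀ i j, TimeEqui J fun n t => q n t i j) (hb' : ∀ j, TimeEqui J fun n t => b n t j)
    (hc' : TimeEqui J c)
    (hw' : ∀ I : List (Fin N), I.length ≤ 2 → TimeEqui J fun n t => _root_.pdl I (w n t)) :
    TimeEqui J fun n t x => _root_.ell (q n) (b n) (c n) t (w n t) x :=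
  ((TimeEqui.sum _ fun i _ => TimeEqui.sum _ fun j _ =>
    (hq' i j).mul (hw' [i, j] (by simp)) (hq i j) (hw [i, j] (by simp))).add
    (TimeEqui.sum _ fun j _ => (hb' j).mul (hw' [j] (by simp)) (hb j) (hw [j] (by simp)))).add
    (hc'.mul (hw' [] (by simp)) hc (hw [] (by simp)))

theorem ulim_solution {m : ℕ} (hm : 2 ≤ m) (hs : ∀ n, ∀ t ∈ J, Smooth (w n t))
    (hw : ∀ I : List (Fin N), I.length ≤ m + 1 → LocBdd J fun n t => pdl I (w n t))
    (ht : TimeEqui J w) {Q : ℝ → Fin N → Fin N → ES N → ℝ} {B : ℝ → Fin N → ES N → ℝ}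
    {C : ℝ → ES N → ℝ} {t : ℝ} (htJ : t ∈ J) {x : ES N}
    (hQ : ∀ i j, Tendsto (fun n => q n t i j x) atTop (𝓝 (Q t i j x)))
    (hB : ∀ j, Tendsto (fun n => b n t j x) atTop (𝓝 (B t j x)))
    (hC : Tendsto (fun n => c n t x) atTop (𝓝 (C t x)))
    (h : ∀ ε > 0, ∃ δ > 0, ∃ η : ℕ → ℝ, Tendsto η atTop (𝓝 0) ∧ ∀ᶠ n in atTop, ∀ t' ∈ J,
      |t' - t| < δ → |w n t' x - w n t x - (t' - t) * ell (q n) (b n) (c n) t (w n t) x|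
        ≤ ε * |t' - t| + η n) :
    HasDerivWithinAt (fun t' => ulim w t' x) (ell Q B C t (ulim w t) x) J t := by
  have hr := (ulim_regularity hs hw ht).2
  refine ulim_hasDerivWithinAt htJ (hw [] (by simp)) (F := fun n t x =>
    ell (q n) (b n) (c n) t (w n t) x) ?_ h
  refine ((tendsto_finsetSum _ fun i _ => tendsto_finsetSum _ fun j _ => ?_).add
    (tendsto_finsetSum _ fun j _ => ?_)).add ?_
  · exact ((hQ i j).mono_left hyp_le).mul ((hr [i, j] (by simpa using hm)).1 t htJ x)
  · exact ((hB j).mono_left hyp_le).mul ((hr [j] (by simp; omega)).1 t htJ x)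
  · exact (hC.mono_left hyp_le).mul ((hr [] (by simp)).1 t htJ x)

end Operator

/-! ### Consistency of the scheme -/

section Consistency

variable {N : ℕ} {σ : ℝ → Fin N → Fin N → ES N → ℝ} {q : ℝ → Fin N → Fin N → ES N → ℝ}
  {b : ℝ → Fin N → ES N → ℝ} {c : ℝ → ES N → ℝ}

lemma norm_le_of_abs_le {y : ES N} {B : ℝ} (h : ∀ i, |y i| ≤ B) : ‖y‖ ≤ N * B := by
  rw [eq_sum_single y]
  calc ‖∑ i, y i • EuclideanSpace.single i (1 : ℝ)‖ ≤ ∑ i, ‖y i • EuclideanSpace.single i (1 : ℝ)‖ :=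
        norm_sum_le _ _
    _ ≤ ∑ _i : Fin N, B := Finset.sum_le_sum fun i _ => by simpa [norm_smul] using h i
    _ = N * B := by simp

lemma UB.exists_bound {ι P : Type*} [Finite ι] {g : ι → P → ES N → ℝ} (hg : ∀ a, UB (g a)) :
    ∃ B ≥ 0, ∀ a p x, |g a p x| ≤ B := by
  choose C hC using fun a => (hg a).bdd
  obtain ⟨M, hM⟩ := (finite_range C).bddAbove
  exact ⟨max M 0, le_max_right _ _, fun a p x =>
    (hC a p x).trans ((hM ⟨a, rfl⟩).trans (le_max_left _ _))⟩

lemma abs_sum_sum_mul_le {u v : Fin N → ℝ} {a : Fin N → Fin N → ℝ} {B G : ℝ}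
    (hu : ∀ i, |u i| ≤ B) (hv : ∀ i, |v i| ≤ B) (ha : ∀ i j, |a i j| ≤ G) :
    |∑ i, ∑ j, u i * v j * a i j| ≤ (N : ℝ) ^ 2 * B ^ 2 * G := by
  calc |∑ i, ∑ j, u i * v j * a i j| ≤ ∑ i, |∑ j, u i * v j * a i j| :=
        Finset.abs_sum_le_sum_abs _ _
    _ ≤ ∑ i, ∑ j, |u i * v j * a i j| :=
        Finset.sum_le_sum fun i _ => Finset.abs_sum_le_sum_abs _ _
    _ ≤ ∑ _i : Fin N, ∑ _j : Fin N, B * B * G := by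
        refine Finset.sum_le_sum fun i _ => Finset.sum_le_sum fun j _ => ?_
        rw [abs_mul, abs_mul]
        have hB : 0 ≤ B := (abs_nonneg _).trans (hu i)
        gcongr
        exacts [hu i, hv j, ha i j]
    _ = _ := by simp; ring

theorem step_consistency (hN : 1 ≤ N) (hσ : ∀ k i, UB fun t => σ t k i)
    (hb : ∀ i, UB fun t => b t i) (hc : UB c)
    (hq : ∀ t i j x, ∑ k, σ t k i x * σ t k j x = 2 * N * q t i j x) :
    ∃ K ≥ 0, ∀ (p : Par) (f : ES N → ℝ), Smooth f → ∀ G,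
      (∀ I : List (Fin N), I.length ≤ 3 → ∀ x, |pdl I f x| ≤ G) → ∀ x,
        |step σ b c p f x - f x - (p.2 : ℝ) ^ 2 * ell q b c p.1 f x| ≤ K * G * (p.2 : ℝ) ^ 3 := by
  obtain ⟨B₁, hB₁, hB₁'⟩ := UB.exists_bound (ι := Fin N × Fin N) fun a => hσ a.1 a.2
  obtain ⟨B₂, hB₂, hB₂'⟩ := UB.exists_bound hb
  obtain ⟨B₃, hB₃'⟩ := hc.bdd
  set B := max B₁ (max B₂ B₃) with hB
  have hB0 : 0 ≤ B := hB₁.trans (le_max_left _ _)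
  have bσ : ∀ t k i x, |σ t k i x| ≤ B := fun t k i x => (hB₁' (k, i) t x).trans (le_max_left _ _)
  have bb : ∀ t i x, |b t i x| ≤ B := fun t i x =>
    (hB₂' i t x).trans ((le_max_left _ _).trans (le_max_right _ _))
  have bc : ∀ t x, |c t x| ≤ B := fun t x =>
    (hB₃' t x).trans ((le_max_right _ _).trans (le_max_right _ _))
  set Λ : ℝ := N * (N * (2 * B)) with hΛ
  have hΛ0 : 0 ≤ Λ := by positivity
  refine ⟨Λ ^ 3 + N ^ 2 * B ^ 2 + B * Λ, by positivity, fun p f hf G hG x => ?_⟩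
  obtain ⟨t, r, hr0, hr1⟩ := p
  simp only
  have hG0 : 0 ≤ G := (abs_nonneg _).trans (hG [] (by simp) x)
  set p : Par := (t, ⟨r, hr0, hr1⟩) with hp
  let y : Fin N → Bool → ES N := fun k e =>
    WithLp.toLp 2 fun i => r * sg e * σ t k i x + r ^ 2 * b t i x
  have hY : ∀ k e, stepPt σ b p k e x = x + y k e := by
    intro k e
    ext i
    simp [stepPt, y, hp, add_assoc]
  have hy : ∀ k e, N * ‖y k e‖ ≤ Λ * r := by
    intro k e
    have : ‖y k e‖ ≤ N * (2 * B * r) := norm_le_of_abs_le fun i => by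
      have h1 : |r * sg e * σ t k i x| ≤ r * B := by
        rw [abs_mul, abs_mul, abs_sg, abs_of_nonneg hr0, mul_one]
        exact mul_le_mul_of_nonneg_left (bσ t k i x) hr0
      have h2 : |r ^ 2 * b t i x| ≤ r * B := by
        rw [abs_mul, abs_of_nonneg (sq_nonneg r)]
        exact mul_le_mul (by nlinarith) (bb t i x) (abs_nonneg _) hr0
      refine (abs_add_le _ _).trans ?_
      linarith
    calc (N : ℝ) * ‖y k e‖ ≤ N * (N * (2 * B * r)) := by gcongr
      _ = Λ * r := by rw [hΛ]; ring
  let E : Fin N → Bool → ℝ := fun k e => f (x + y k e) - f x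
  let U : Fin N → Bool → ℝ := fun k e => ∑ i, y k e i * pd1 f i x
    + 1 / 2 * ∑ i, ∑ j, y k e i * y k e j * pd1 (pd1 f i) j x
  have hE : ∀ k e, |E k e| ≤ Λ * r * G := fun k e =>
    (taylor_one hf convex_univ (K := G) (fun i z _ => hG [i] (by simp) z) (mem_univ x)
      (mem_univ (x + y k e))).trans (mul_le_mul_of_nonneg_right (hy k e) hG0)
  have hEU : ∀ k e, |E k e - U k e| ≤ (Λ * r) ^ 3 * G := by
    intro k e
    have h1 := taylor_three hf convex_univ (K := G) (fun i j k z _ => hG [k, j, i] (by simp) z)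
      (mem_univ x) (mem_univ (x + y k e))
    rw [abs_of_nonneg hG0, sub_sub] at h1
    refine h1.trans (mul_le_mul_of_nonneg_right ?_ hG0)
    exact pow_le_pow_left₀ (by positivity) (hy k e) 3
  have hN0 : (0 : ℝ) < 2 * N := by positivity
  have avg_le : ∀ {a : Fin N → Bool → ℝ} {M : ℝ}, (∀ k e, |a k e| ≤ M) →
      |(2 * N : ℝ)⁻¹ * ∑ k, ∑ e, a k e| ≤ M := by
    intro a M ha
    rw [abs_mul, abs_of_pos (inv_pos.2 hN0), inv_mul_le_iff₀ hN0]
    calc |∑ k, ∑ e, a k e| ≤ ∑ k, |∑ e, a k e| := Finset.abs_sum_le_sum_abs _ _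
      _ ≤ ∑ k, ∑ e, |a k e| := Finset.sum_le_sum fun k _ => Finset.abs_sum_le_sum_abs _ _
      _ ≤ ∑ _k : Fin N, ∑ _e : Bool, M := Finset.sum_le_sum fun k _ =>
          Finset.sum_le_sum fun e _ => ha k e
      _ = 2 * N * M := by simp; ring
  set aE := (2 * N : ℝ)⁻¹ * ∑ k, ∑ e, E k e with haE
  have h1 : step σ b c p f x = (1 + r ^ 2 * c t x) * (f x + aE) := by
    have : ∀ k e, (1 + r ^ 2 * c t x) * f (stepPt σ b p k e x)
        = (1 + r ^ 2 * c t x) * f x + (1 + r ^ 2 * c t x) * E k e := by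
      intro k e
      rw [hY]; simp only [E]; ring
    simp only [step, hp] at this ⊢
    simp only [this, Finset.sum_add_distrib, ← Finset.mul_sum, Finset.sum_const, haE]
    simp only [Finset.card_univ, Fintype.card_fin, Fintype.card_bool, nsmul_eq_mul]
    field_simp
    ring
  have h2 : (2 * N : ℝ)⁻¹ * ∑ k, ∑ e, U k e = r ^ 2 * ((∑ i, ∑ j, q t i j x * pdl [i, j] f x)
      + ∑ j, b t j x * pdl [j] f x)
      + r ^ 4 / 2 * ∑ i, ∑ j, b t i x * b t j x * pd1 (pd1 f i) j x := by
    have g1 : ∀ k, ∑ e, U k e = 2 * r ^ 2 * ∑ j, b t j x * pd1 f j x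
        + r ^ 2 * ∑ i, ∑ j, σ t k i x * σ t k j x * pd1 (pd1 f i) j x
        + r ^ 4 * ∑ i, ∑ j, b t i x * b t j x * pd1 (pd1 f i) j x := by
      intro k
      simp only [Fintype.sum_bool, U, y, sg, Finset.mul_sum, ← Finset.sum_add_distrib]
      refine Finset.sum_congr rfl fun i _ => ?_
      simp only [if_true, Bool.false_eq_true, if_false]
      have g2 : ∀ A₁ A₂ S₁ S₂ B₀ S₃ S₄ : ℝ, A₁ + A₂ = B₀ → S₁ + S₂ = S₃ + S₄ →
        A₁ + S₁ + (A₂ + S₂) = B₀ + S₃ + S₄ := by intros; linarith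
      refine g2 _ _ _ _ _ _ _ (by ring) ?_
      rw [← Finset.sum_add_distrib, ← Finset.sum_add_distrib]
      exact Finset.sum_congr rfl fun j _ => by ring
    simp only [g1, Finset.sum_add_distrib, ← Finset.mul_sum, Finset.sum_const, Finset.card_univ,
      Fintype.card_fin, nsmul_eq_mul]
    have g3 : ∑ k, ∑ i, ∑ j, σ t k i x * σ t k j x * pd1 (pd1 f i) j x
        = 2 * N * ∑ i, ∑ j, q t i j x * pdl [i, j] f x := by
      rw [Finset.sum_comm]
      have : ∀ i, ∑ k, ∑ j, σ t k i x * σ t k j x * pd1 (pd1 f i) j x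
          = ∑ j, 2 * N * (q t j i x * pdl [j, i] f x) := by
        intro i
        rw [Finset.sum_comm]
        refine Finset.sum_congr rfl fun j _ => ?_
        rw [← mul_assoc, ← hq, Finset.sum_mul]
        exact Finset.sum_congr rfl fun k _ => by simp only [pdl_cons, pdl_nil]; ring
      rw [Finset.sum_congr rfl fun i _ => this i, Finset.sum_comm]
      simp only [Finset.mul_sum]
    rw [g3]
    simp only [pdl_cons, pdl_nil]
    field_simp
    ring
  have h3 : |aE - (2 * N : ℝ)⁻¹ * ∑ k, ∑ e, U k e| ≤ (Λ * r) ^ 3 * G := by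
    have := avg_le hEU
    simpa only [Finset.sum_sub_distrib, mul_sub] using this
  have h4 : |aE| ≤ Λ * r * G := avg_le hE
  have h5 := abs_sum_sum_mul_le (bb t · x) (bb t · x)
    (fun i j => hG [j, i] (by simp) x)
  simp only [pdl_cons, pdl_nil] at h5
  set Z := ∑ i, ∑ j, b t i x * b t j x * pd1 (pd1 f i) j x
  have h6 : step σ b c p f x - f x - r ^ 2 * ell q b c t f x
      = (aE - (2 * N : ℝ)⁻¹ * ∑ k, ∑ e, U k e) + (r ^ 4 / 2 * Z + r ^ 2 * c t x * aE) := by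
    rw [h1, h2, ell]; ring
  rw [h6]
  have h7 : |r ^ 4 / 2 * Z| ≤ r ^ 3 * (N ^ 2 * B ^ 2 * G) := by
    rw [abs_mul, abs_of_nonneg (by positivity)]
    refine mul_le_mul ?_ h5 (abs_nonneg _) (by positivity)
    have : r ^ 4 ≤ r ^ 3 := pow_le_pow_of_le_one hr0 hr1 (by norm_num)
    nlinarith [pow_nonneg hr0 3]
  have h8 : |r ^ 2 * c t x * aE| ≤ r ^ 2 * B * (Λ * r * G) := by
    rw [abs_mul, abs_mul, abs_of_nonneg (sq_nonneg r)]
    exact mul_le_mul (mul_le_mul_of_nonneg_left (bc t x) (sq_nonneg r)) h4 (abs_nonneg _)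
      (by positivity)
  have h9 := abs_add_le (aE - (2 * N : ℝ)⁻¹ * ∑ k, ∑ e, U k e)
    (r ^ 4 / 2 * Z + r ^ 2 * c t x * aE)
  have h10 := abs_add_le (r ^ 4 / 2 * Z) (r ^ 2 * c t x * aE)
  calc _ ≤ (Λ * r) ^ 3 * G + (r ^ 3 * (N ^ 2 * B ^ 2 * G) + r ^ 2 * B * (Λ * r * G)) := by linarith
    _ = _ := by ring

end Consistency

/-! ### Solvability with smooth bounded coefficients and data -/

section BoundedCoefficients

variable {N : ℕ}

/-- Uniform continuity in time, locally uniformly in space. -/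
def TimeCont (a : ℝ → ES N → ℝ) : Prop :=
  ∀ R : ℝ, ∀ ε > 0, ∃ δ > 0, ∀ t t', |t - t'| < δ →
    ∀ x ∈ closedBall (0 : ES N) R, |a t x - a t' x| ≤ ε

/-- Coefficients that are smooth and bounded together with their space derivatives, symmetric and
uniformly elliptic, with potential bounded above by `c₀`. -/
structure BoundedCoeff (q : ℝ → Fin N → Fin N → ES N → ℝ) (b : ℝ → Fin N → ES N → ℝ)
    (c : ℝ → ES N → ℝ) (ν c₀ : ℝ) : Prop where
  ubq : ∀ i j, UB fun t => q t i j
  ubb : ∀ i, UB fun t => b t i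
  ubc : UB c
  tq : ∀ i j, TimeCont fun t => q t i j
  tb : ∀ i, TimeCont fun t => b t i
  tc : TimeCont c
  symm : ∀ t i j x, q t i j x = q t j i x
  pos : 0 < ν
  ellip : ∀ t x (ξ : Fin N → ℝ), ν * ∑ i, ξ i ^ 2 ≤ ∑ i, ∑ j, q t i j x * ξ i * ξ j
  c_le : ∀ t x, c t x ≤ c₀
  c₀_nonneg : 0 ≤ c₀

/-- The parameters of the `j`-th step of the scheme with step size `1/n`. -/
def schemePar (n j : ℕ) : Par :=
  (j / n, ⟨√((n : ℝ)⁻¹), Real.sqrt_nonneg _, Real.sqrt_le_one.2 (Nat.cast_inv_le_one n)⟩)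

lemma schemePar_sq (n j : ℕ) : ((schemePar n j).2 : ℝ) ^ 2 = (n : ℝ)⁻¹ :=
  Real.sq_sqrt (by positivity)

/-- The iterates of the scheme with step size `1/n`. -/
def iter (σ : ℝ → Fin N → Fin N → ES N → ℝ) (b : ℝ → Fin N → ES N → ℝ) (c : ℝ → ES N → ℝ)
    (f : ES N → ℝ) (n : ℕ) : ℕ → ES N → ℝ
  | 0 => f
  | j + 1 => step σ b c (schemePar n j) (iter σ b c f n j)

variable {σ : ℝ → Fin N → Fin N → ES N → ℝ} {q : ℝ → Fin N → Fin N → ES N → ℝ}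
  {b : ℝ → Fin N → ES N → ℝ} {c : ℝ → ES N → ℝ} {f : ES N → ℝ}

lemma smooth_iter (hσ : ∀ k i, UB fun t => σ t k i) (hb : ∀ i, UB fun t => b t i) (hc : UB c)
    (hf : Smooth f) (n j : ℕ) : Smooth (iter σ b c f n j) := by
  induction j with
  | zero => exact hf
  | succ j ih => exact smooth_step hσ hb hc _ ih

lemma iter_bound (hN : 1 ≤ N) (hσ : ∀ k i, UB fun t => σ t k i) (hb : ∀ i, UB fun t => b t i)
    (hc : UB c) (hf : UB fun _ : Unit => f) (m : ℕ) (S : ℝ) :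
    ∃ G ≥ 0, ∀ᶠ n : ℕ in atTop, ∀ j : ℕ, (j : ℝ) ≤ S * n → ∀ I : List (Fin N), I.length ≤ m →
      ∀ x, |pdl I (iter σ b c f n j) x| ≤ G := by
  obtain ⟨ι, _, w, Θ, C, hcl, hw⟩ := exists_stepClosure hσ hb hc m
  obtain ⟨K, hK, hst⟩ := hcl.stable hN
  choose D hD using fun a => hf.2 (w a)
  set G₀ := ∑ a, D a ^ 2 with hG₀
  have hG₀0 : 0 ≤ G₀ := Finset.sum_nonneg fun a _ => sq_nonneg _
  refine ⟨Real.exp (2 * K * S) * G₀ + 1, by positivity, ?_⟩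
  filter_upwards [eventually_ge_atTop 1, eventually_ge_atTop ⌈2 * K⌉₊] with n hn1 hn2 j hj I hI x
  have hn0 : (0 : ℝ) < n := by exact_mod_cast hn1
  have hKn : K * (n : ℝ)⁻¹ ≤ 1 / 2 := by
    rw [← div_eq_mul_inv, div_le_iff₀ hn0]
    have := Nat.ceil_le.1 hn2
    linarith
  have hKn0 : 0 ≤ K * (n : ℝ)⁻¹ := by positivity
  have key : ∀ j : ℕ, ∀ x, ∑ a, pdl (w a) (iter σ b c f n j) x ^ 2
      ≤ Real.exp (2 * (K * (n : ℝ)⁻¹)) ^ j * G₀ := by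
    intro j
    induction j with
    | zero =>
      intro x
      simp only [pow_zero, one_mul, hG₀]
      exact Finset.sum_le_sum fun a _ => sq_le_sq' (abs_le.1 (hD a () x)).1
        (abs_le.1 (hD a () x)).2
    | succ j ih =>
      intro x
      have h1 := hst (schemePar n j) _ (smooth_iter hσ hb hc (hf.smooth ()) n j) _ ih x
      rw [schemePar_sq] at h1
      have h2 := Real.add_one_le_exp (2 * (K * (n : ℝ)⁻¹))
      set y := K * (n : ℝ)⁻¹
      change ∑ a, pdl (w a) (step σ b c (schemePar n j) (iter σ b c f n j)) x ^ 2 ≤ _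
      set X := ∑ a, pdl (w a) (step σ b c (schemePar n j) (iter σ b c f n j)) x ^ 2
      have hX : 0 ≤ X := Finset.sum_nonneg fun a _ => sq_nonneg _
      have h3 : 1 ≤ (1 - y) * Real.exp (2 * y) := by nlinarith
      calc X ≤ X * ((1 - y) * Real.exp (2 * y)) := le_mul_of_one_le_right hX h3
        _ = (1 - y) * X * Real.exp (2 * y) := by ring
        _ ≤ Real.exp (2 * y) ^ j * G₀ * Real.exp (2 * y) := by gcongr
        _ = _ := by ring
  obtain ⟨a, rfl⟩ := hw I hI
  have h1 : pdl (w a) (iter σ b c f n j) x ^ 2 ≤ Real.exp (2 * K * S) * G₀ := by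
    refine (Finset.single_le_sum (f := fun a => pdl (w a) (iter σ b c f n j) x ^ 2)
      (fun a _ => sq_nonneg _) (Finset.mem_univ a)).trans ((key j x).trans ?_)
    gcongr
    rw [← Real.exp_nat_mul, Real.exp_le_exp]
    have : (j : ℝ) * (n : ℝ)⁻¹ ≤ S := by rwa [← div_eq_mul_inv, div_le_iff₀ hn0]
    nlinarith
  nlinarith [sq_abs (pdl (w a) (iter σ b c f n j) x), sq_nonneg (|pdl (w a) (iter σ b c f n j) x| - 1),
    abs_nonneg (pdl (w a) (iter σ b c f n j) x)]

lemma iter_sup_bound (hN : 1 ≤ N) (hc : UB c) {c₀ M : ℝ}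
    (hc₀ : ∀ t x, c t x ≤ c₀) (hM : ∀ x, |f x| ≤ M) :
    ∀ᶠ n : ℕ in atTop, ∀ j x, |iter σ b c f n j x| ≤ Real.exp (c₀ * (j / n)) * M := by
  obtain ⟨B, hB⟩ := hc.bdd
  filter_upwards [eventually_ge_atTop 1, eventually_ge_atTop ⌈B⌉₊] with n hn1 hn2 j
  have hn0 : (0 : ℝ) < n := by exact_mod_cast hn1
  have hM0 : 0 ≤ M := (abs_nonneg _).trans (hM 0)
  induction j with
  | zero => simpa [iter] using hM
  | succ j ih =>
    intro x
    have hnB := Nat.ceil_le.1 hn2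
    set p := schemePar n j with hp
    have h1 : |1 + (p.2 : ℝ) ^ 2 * c p.1 x| ≤ Real.exp (c₀ * (1 / n)) := by
      rw [hp, schemePar_sq]
      have h2 : -1 ≤ (n : ℝ)⁻¹ * c (schemePar n j).1 x := by
        rw [neg_le, ← mul_neg, inv_mul_le_iff₀ hn0, mul_one]
        exact (neg_le_abs _).trans ((hB _ _).trans hnB)
      rw [abs_of_nonneg (by linarith)]
      have h3 := Real.add_one_le_exp (c₀ * (1 / n))
      have h4 : (n : ℝ)⁻¹ * c (schemePar n j).1 x ≤ (n : ℝ)⁻¹ * c₀ :=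
        mul_le_mul_of_nonneg_left (hc₀ _ _) (by positivity)
      rw [one_div, mul_comm c₀] at h3 ⊢
      linarith
    change |step σ b c p (iter σ b c f n j) x| ≤ _
    have hN0 : (0 : ℝ) < 2 * N := by positivity
    rw [step, abs_mul, abs_of_pos (inv_pos.2 hN0), inv_mul_le_iff₀ hN0]
    calc |∑ k, ∑ e, (1 + (p.2 : ℝ) ^ 2 * c p.1 x) * iter σ b c f n j (stepPt σ b p k e x)|
        ≤ ∑ k, ∑ e, |(1 + (p.2 : ℝ) ^ 2 * c p.1 x) * iter σ b c f n j (stepPt σ b p k e x)| :=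
          (Finset.abs_sum_le_sum_abs _ _).trans
            (Finset.sum_le_sum fun k _ => Finset.abs_sum_le_sum_abs _ _)
      _ ≤ ∑ _k : Fin N, ∑ _e : Bool, Real.exp (c₀ * (1 / n)) * (Real.exp (c₀ * (j / n)) * M) := by
          refine Finset.sum_le_sum fun k _ => Finset.sum_le_sum fun e _ => ?_
          rw [abs_mul]
          exact mul_le_mul h1 (ih _) (abs_nonneg _) (Real.exp_nonneg _)
      _ = 2 * N * (Real.exp (c₀ * ((j + 1 : ℕ) / n)) * M) := by
          rw [← mul_assoc (Real.exp _), ← Real.exp_add]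
          simp only [Finset.sum_const, Finset.card_univ, Fintype.card_fin, Fintype.card_bool,
            nsmul_eq_mul]
          push_cast
          ring_nf

lemma abs_telescope_le {a : ℕ → ℝ} {κ Ψ : ℝ} (i₀ i₁ : ℕ)
    (h : ∀ i, min i₀ i₁ ≤ i → i < max i₀ i₁ → |a (i + 1) - a i - Ψ| ≤ κ) :
    |a i₁ - a i₀ - ((i₁ : ℝ) - i₀) * Ψ| ≤ |(i₁ : ℝ) - i₀| * κ := by
  have key : ∀ i d : ℕ, (∀ k, i ≤ k → k < i + d → |a (k + 1) - a k - Ψ| ≤ κ) →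
      |a (i + d) - a i - d * Ψ| ≤ d * κ := by
    intro i d
    induction d with
    | zero => simp
    | succ d ih =>
      intro hk
      have h1 := ih fun k h1 h2 => hk k h1 (by omega)
      have h2 := hk (i + d) (by omega) (by omega)
      have h3 := abs_add_le (a (i + d) - a i - d * Ψ) (a (i + d + 1) - a (i + d) - Ψ)
      push_cast
      rw [show a (i + (d + 1)) - a i - ((d : ℝ) + 1) * Ψ
        = (a (i + d) - a i - d * Ψ) + (a (i + d + 1) - a (i + d) - Ψ) by
          rw [← add_assoc]; ring]
      linarith
  rcases le_total i₀ i₁ with hi | hi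
  · obtain ⟨d, rfl⟩ := Nat.exists_eq_add_of_le hi
    have := key i₀ d fun k h1 h2 => h k (by omega) (by omega)
    push_cast
    rwa [add_sub_cancel_left, Nat.abs_cast]
  · obtain ⟨d, rfl⟩ := Nat.exists_eq_add_of_le hi
    have := key i₁ d fun k h1 h2 => h k (by omega) (by omega)
    push_cast
    rw [sub_add_cancel_left, abs_neg, Nat.abs_cast, ← abs_neg]
    rwa [show -(a i₁ - a (i₁ + d) - -(d : ℝ) * Ψ) = a (i₁ + d) - a i₁ - d * Ψ by ring]

/-- The grid index of a time. -/
def gridIdx (n : ℕ) (t : ℝ) : ℕ := ⌊t * n⌋₊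

lemma gridIdx_le {n : ℕ} {t S : ℝ} (h0 : 0 ≤ t) (h1 : t ≤ S) : (gridIdx n t : ℝ) ≤ S * n :=
  (Nat.floor_le (by positivity)).trans (mul_le_mul_of_nonneg_right h1 (by positivity))

lemma gridIdx_div {n : ℕ} (hn : 0 < n) (i : ℕ) : gridIdx n ((i : ℝ) / n) = i := by
  have : (n : ℝ) ≠ 0 := by positivity
  rw [gridIdx, div_mul_cancel₀ _ this, Nat.floor_natCast]

lemma abs_gridIdx_div_sub_le {n : ℕ} (hn : 0 < n) {t : ℝ} (ht : 0 ≤ t) :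
    |(gridIdx n t : ℝ) / n - t| ≤ 1 / n := by
  have hn' : (0 : ℝ) < n := by positivity
  have h1 := Nat.floor_le (a := t * n) (by positivity)
  have h2 := Nat.lt_floor_add_one (t * n)
  rw [abs_le, gridIdx]
  constructor
  · rw [neg_le_sub_iff_le_add, ← add_div, le_div_iff₀ hn']; linarith
  · rw [sub_le_iff_le_add, div_add' _ _ _ hn'.ne', div_le_div_iff_of_pos_right hn']; linarith

lemma abs_gridIdx_sub_le {n : ℕ} (hn : 0 < n) {t t' : ℝ} (ht : 0 ≤ t) (ht' : 0 ≤ t') :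
    |(gridIdx n t' - gridIdx n t : ℝ) / n - (t' - t)| ≤ 1 / n := by
  have hn' : (0 : ℝ) < n := by positivity
  have h1 := Nat.floor_le (a := t * n) (by positivity)
  have h2 := Nat.lt_floor_add_one (t * n)
  have h3 := Nat.floor_le (a := t' * n) (by positivity)
  have h4 := Nat.lt_floor_add_one (t' * n)
  rw [abs_le, gridIdx, gridIdx]
  constructor
  · rw [neg_le_sub_iff_le_add, ← add_div, le_div_iff₀ hn']; linarith
  · rw [sub_le_iff_le_add, div_add' _ _ _ hn'.ne', div_le_div_iff_of_pos_right hn']; linarith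

lemma UB.locBdd {a : ℝ → ES N → ℝ} (h : UB a) (J : Set ℝ) (φ : ℕ → ℝ → ℝ) :
    LocBdd J fun n t => a (φ n t) := fun _ =>
  h.bdd.imp fun _ hC => Eventually.of_forall fun _ _ _ _ _ => hC _ _

lemma TimeCont.timeEqui {a : ℝ → ES N → ℝ} (h : TimeCont a) {J : Set ℝ} (hJ : ∀ t ∈ J, 0 ≤ t) :
    TimeEqui J fun n t => a ((gridIdx n t : ℝ) / n) := by
  intro R ε hε
  obtain ⟨δ, hδ, h⟩ := h R ε hε
  refine ⟨δ / 2, by positivity, ?_⟩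
  have h0 : ∀ᶠ n : ℕ in atTop, 1 / (n : ℝ) < δ / 2 :=
    tendsto_one_div_atTop_nhds_zero_nat.eventually_lt_const (by positivity)
  filter_upwards [h0, eventually_gt_atTop 0] with n h0 hn t ht t' ht' htt x hx
  refine h _ _ ?_ x hx
  have := abs_gridIdx_sub_le hn (hJ t' ht') (hJ t ht)
  rw [sub_div] at this
  have h2 := abs_sub_abs_le_abs_sub ((gridIdx n t : ℝ) / n - gridIdx n t' / n) (t - t')
  linarith

lemma TimeCont.tendsto {a : ℝ → ES N → ℝ} (h : TimeCont a) {t : ℝ} (ht : 0 ≤ t) (x : ES N) :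
    Tendsto (fun n => a ((gridIdx n t : ℝ) / n) x) atTop (𝓝 (a t x)) := by
  rw [Metric.tendsto_nhds]
  intro ε hε
  obtain ⟨δ, hδ, h⟩ := h ‖x‖ (ε / 2) (by positivity)
  have h0 : ∀ᶠ n : ℕ in atTop, 1 / (n : ℝ) < δ :=
    tendsto_one_div_atTop_nhds_zero_nat.eventually_lt_const hδ
  filter_upwards [h0, eventually_gt_atTop 0] with n h0 hn
  rw [Real.dist_eq]
  exact (h _ _ ((abs_gridIdx_div_sub_le hn ht).trans_lt h0) x (by simp)).trans_lt (by linarith)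

end BoundedCoefficients

section SmoothSolution

variable {N : ℕ} {q : ℝ → Fin N → Fin N → ES N → ℝ} {b : ℝ → Fin N → ES N → ℝ}
  {c : ℝ → ES N → ℝ} {ν c₀ : ℝ} {f : ES N → ℝ}

lemma abs_ell_le {B G t : ℝ} {x : ES N} {g : ES N → ℝ} (hq : ∀ i j, |q t i j x| ≤ B)
    (hb : ∀ j, |b t j x| ≤ B) (hc : |c t x| ≤ B)
    (hg : ∀ I : List (Fin N), I.length ≤ 2 → |pdl I g x| ≤ G) :
    |ell q b c t g x| ≤ ((N : ℝ) ^ 2 + N + 1) * B * G := by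
  have hB : 0 ≤ B := (abs_nonneg _).trans hc
  have m : ∀ {u v : ℝ}, |u| ≤ B → |v| ≤ G → |u * v| ≤ B * G := fun hu hv => by
    rw [abs_mul]; exact mul_le_mul hu hv (abs_nonneg _) hB
  have h1 : |∑ i, ∑ j, q t i j x * pdl [i, j] g x| ≤ (N : ℝ) ^ 2 * (B * G) := by
    calc _ ≤ ∑ i, ∑ j, |q t i j x * pdl [i, j] g x| := (Finset.abs_sum_le_sum_abs _ _).trans
          (Finset.sum_le_sum fun i _ => Finset.abs_sum_le_sum_abs _ _)
      _ ≤ ∑ _i : Fin N, ∑ _j : Fin N, B * G := Finset.sum_le_sum fun i _ =>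
          Finset.sum_le_sum fun j _ => m (hq i j) (hg _ (by simp))
      _ = _ := by simp; ring
  have h2 : |∑ j, b t j x * pdl [j] g x| ≤ N * (B * G) := by
    calc _ ≤ ∑ j, |b t j x * pdl [j] g x| := Finset.abs_sum_le_sum_abs _ _
      _ ≤ ∑ _j : Fin N, B * G := Finset.sum_le_sum fun j _ => m (hb j) (hg _ (by simp))
      _ = _ := by simp
  have h3 := m hc (hg [] (by simp))
  refine (abs_add_three _ _ _).trans ?_
  simp only [pdl_nil] at h3
  linarith

theorem BoundedCoeff.exists_solution (hN : 1 ≤ N) (h : BoundedCoeff q b c ν c₀) (S : ℝ)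
    (hf : UB fun _ : Unit => f) {M : ℝ} (hM : ∀ x, |f x| ≤ M) :
    ∃ u : ℝ → ES N → ℝ, (∀ t ∈ Icc 0 S, Smooth (u t)) ∧
      (∀ I, ∃ C, ∀ t ∈ Icc 0 S, ∀ x, |pdl I (u t) x| ≤ C) ∧
      (∀ I, ContinuousOn (fun p : ℝ × ES N => pdl I (u p.1) p.2) (Icc 0 S ×ˢ univ)) ∧
      (∀ t ∈ Icc 0 S, ∀ x, HasDerivWithinAt (fun t' => u t' x) (ell q b c t (u t) x) (Icc 0 S) t) ∧
      (∀ x, u 0 x = f x) ∧ ∀ t ∈ Icc 0 S, ∀ x, |u t x| ≤ Real.exp (c₀ * t) * M := by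
  obtain ⟨σ, hσ, hσq⟩ := exists_smooth_factorization (q := fun t i j x => 2 * N * q t i j x)
    (ν := 2 * N * ν) (mul_pos (by positivity) h.pos) (fun i j => (h.ubq i j).const_mul _)
    (fun t i j x => by rw [h.symm]) (fun t x ξ => by
      have := mul_le_mul_of_nonneg_left (h.ellip t x ξ) (by positivity : (0 : ℝ) ≤ 2 * N)
      simp only [Finset.mul_sum, ← mul_assoc] at this ⊢
      exact this)
  obtain ⟨K, hK, hcons⟩ := step_consistency hN hσ h.ubb h.ubc fun t i j x => hσq t x i j
  obtain ⟨Bq, hBq, hBq'⟩ := UB.exists_bound (ι := Fin N × Fin N) fun a => h.ubq a.1 a.2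
  obtain ⟨Bb, hBb, hBb'⟩ := UB.exists_bound h.ubb
  obtain ⟨Bc, hBc'⟩ := h.ubc.bdd
  set B := max Bq (max Bb Bc)
  have hB : 0 ≤ B := hBq.trans (le_max_left _ _)
  set J := Icc 0 S with hJ
  set w : ℕ → ℝ → ES N → ℝ := fun n t => iter σ b c f n (gridIdx n t) with hw
  have hs : ∀ n, ∀ t ∈ J, Smooth (w n t) := fun n t _ =>
    smooth_iter hσ h.ubb h.ubc (hf.smooth ()) n _
  have hwb : ∀ I, ∃ G, ∀ᶠ n in atTop, ∀ t ∈ J, ∀ x, |pdl I (w n t) x| ≤ G := by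
    intro I
    obtain ⟨G, -, hG⟩ := iter_bound hN hσ h.ubb h.ubc hf I.length S
    exact ⟨G, hG.mono fun n hn t ht x => hn _ (gridIdx_le ht.1 ht.2) I le_rfl x⟩
  have hwl : ∀ I, LocBdd J fun n t => pdl I (w n t) := fun I _ =>
    (hwb I).imp fun G hG => hG.mono fun n hn t ht x _ => hn t ht x
  obtain ⟨G, hG0, hG⟩ := iter_bound hN hσ h.ubb h.ubc hf 3 S
  have hell : ∀ t x {g : ES N → ℝ}, (∀ I : List (Fin N), I.length ≤ 2 → |pdl I g x| ≤ G) →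
      |ell q b c t g x| ≤ ((N : ℝ) ^ 2 + N + 1) * B * G := fun t x g hg =>
    abs_ell_le (fun i j => (hBq' (i, j) t x).trans (le_max_left _ _))
      (fun j => (hBb' j t x).trans ((le_max_left _ _).trans (le_max_right _ _)))
      ((hBc' t x).trans ((le_max_right _ _).trans (le_max_right _ _))) hg
  set L := ((N : ℝ) ^ 2 + N + 1) * B * G
  have hL : 0 ≤ L := by positivity
  set F : ℕ → ℕ → ES N → ℝ := fun n i => ell q b c ((i : ℝ) / n) (iter σ b c f n i) with hF
  have hinc : ∀ᶠ n : ℕ in atTop, ∀ i : ℕ, (i : ℝ) ≤ S * n → ∀ x, |F n i x| ≤ L ∧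
      |iter σ b c f n (i + 1) x - iter σ b c f n i x - (n : ℝ)⁻¹ * F n i x|
        ≤ (n : ℝ)⁻¹ * (K * G * √((n : ℝ)⁻¹)) := by
    filter_upwards [hG] with n hn i hi x
    refine ⟨hell _ x fun I hI => hn i hi I (by omega) x, ?_⟩
    have := hcons (schemePar n i) _ (smooth_iter hσ h.ubb h.ubc (hf.smooth ()) n i) G (hn i hi) x
    rw [pow_succ ((schemePar n i).2 : ℝ) 2, schemePar_sq] at this
    refine this.trans (le_of_eq ?_)
    change K * G * ((n : ℝ)⁻¹ * √((n : ℝ)⁻¹)) = _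
    ring
  have hT : TimeEqui J w := by
    intro R ε hε
    set L' := L + K * G + 1
    have hL' : 0 < L' := by positivity
    refine ⟨ε / (2 * L'), by positivity, ?_⟩
    have h0 : ∀ᶠ n : ℕ in atTop, 1 / (n : ℝ) < ε / (2 * L') :=
      tendsto_one_div_atTop_nhds_zero_nat.eventually_lt_const (by positivity)
    filter_upwards [hinc, h0, eventually_gt_atTop 0] with n hn h0 hn0 t ht t' ht' htt x _
    have hn0' : (0 : ℝ) < n := by positivity
    have h1 := abs_telescope_le (a := fun i => iter σ b c f n i x) (κ := (n : ℝ)⁻¹ * L') (Ψ := 0)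
      (gridIdx n t') (gridIdx n t) fun i _ hi => by
        have hi' : (i : ℝ) ≤ S * n := by
          rcases lt_max_iff.1 hi with hi | hi
          · exact (Nat.cast_le.2 hi.le).trans (gridIdx_le ht'.1 ht'.2)
          · exact (Nat.cast_le.2 hi.le).trans (gridIdx_le ht.1 ht.2)
        obtain ⟨h1, h2⟩ := hn i hi' x
        have h3 : √((n : ℝ)⁻¹) ≤ 1 := Real.sqrt_le_one.2 (Nat.cast_inv_le_one n)
        have h4 : (n : ℝ)⁻¹ * (K * G * √((n : ℝ)⁻¹)) ≤ (n : ℝ)⁻¹ * (K * G) :=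
          mul_le_mul_of_nonneg_left (mul_le_of_le_one_right (by positivity) h3) (by positivity)
        have h5 : |(n : ℝ)⁻¹ * F n i x| ≤ (n : ℝ)⁻¹ * L := by
          rw [abs_mul, abs_of_pos (inv_pos.2 hn0')]
          gcongr
        have h6 := abs_add_le (iter σ b c f n (i + 1) x - iter σ b c f n i x
          - (n : ℝ)⁻¹ * F n i x) ((n : ℝ)⁻¹ * F n i x)
        rw [sub_add_cancel] at h6
        rw [sub_zero]
        have h7 : 0 ≤ (n : ℝ)⁻¹ := by positivity
        have h8 : (n : ℝ)⁻¹ * L' = (n : ℝ)⁻¹ * (K * G) + (n : ℝ)⁻¹ * L + (n : ℝ)⁻¹ := by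
          simp only [L']; ring
        linarith
    rw [mul_zero, sub_zero, ← mul_assoc, ← abs_of_pos (inv_pos.2 hn0'), ← abs_mul,
      ← div_eq_mul_inv] at h1
    have h2 := abs_gridIdx_sub_le hn0 ht'.1 ht.1
    have h3 := abs_sub_abs_le_abs_sub ((gridIdx n t - gridIdx n t' : ℝ) / n) (t - t')
    calc |w n t x - w n t' x| ≤ _ := h1
      _ ≤ (ε / (2 * L') + ε / (2 * L')) * L' := by gcongr; linarith
      _ = ε := by field_simp; ring
  have hJ0 : ∀ t ∈ J, 0 ≤ t := fun t ht => ht.1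
  have hreg := fun m => ulim_regularity (m := m) hs (fun I _ => hwl I) hT
  refine ⟨ulim w, fun t ht => contDiff_infty.2 fun m => (hreg m).1 t ht, fun I => ?_,
    fun I => ((hreg I.length).2 I le_rfl).2, fun t ht x => ?_, fun x => ?_, fun t ht x => ?_⟩
  · obtain ⟨C, hC⟩ := hwb I
    refine ⟨C, fun t ht x => ?_⟩
    exact le_of_tendsto (((hreg I.length).2 I le_rfl).1 t ht x).abs
      ((hC.filter_mono hyp_le).mono fun n hn => hn t ht x)
  · have hb1 := fun i j => (h.ubq i j).locBdd J fun n t => (gridIdx n t : ℝ) / n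
    have hb2 := fun j => (h.ubb j).locBdd J fun n t => (gridIdx n t : ℝ) / n
    have hb3 := h.ubc.locBdd J fun n t => (gridIdx n t : ℝ) / n
    have hE : TimeEqui J fun n t => F n (gridIdx n t) := TimeEqui.ell
      (q := fun n t => q ((gridIdx n t : ℝ) / n)) (b := fun n t => b ((gridIdx n t : ℝ) / n))
      (c := fun n t => c ((gridIdx n t : ℝ) / n)) (w := w) hb1 hb2 hb3 (fun I _ => hwl I)
      (fun i j => (h.tq i j).timeEqui hJ0) (fun j => (h.tb j).timeEqui hJ0) (h.tc.timeEqui hJ0)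
      (TimeEqui.pdl (m := 2) hs hT fun I _ => hwl I)
    refine ulim_solution (m := 2) (q := fun n t => q ((gridIdx n t : ℝ) / n))
      (b := fun n t => b ((gridIdx n t : ℝ) / n)) (c := fun n t => c ((gridIdx n t : ℝ) / n))
      le_rfl hs (fun I _ => hwl I) hT ht (fun i j => (h.tq i j).tendsto ht.1 x)
      (fun j => (h.tb j).tendsto ht.1 x) (h.tc.tendsto ht.1 x) fun ε hε => ?_
    obtain ⟨δ, hδ, hE⟩ := hE ‖x‖ ε hε
    refine ⟨δ / 2, by positivity, fun n => (n : ℝ)⁻¹ * ε + (S + (n : ℝ)⁻¹) * (K * G * √((n : ℝ)⁻¹))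
      + (n : ℝ)⁻¹ * L, ?_, ?_⟩
    · have h1 : Tendsto (fun n : ℕ => (n : ℝ)⁻¹) atTop (𝓝 0) := tendsto_inv_atTop_nhds_zero_nat
      have h2 := (h1.mul_const ε).add ((((h1.const_add S)).mul (h1.sqrt.const_mul (K * G))))
        |>.add (h1.mul_const L)
      simpa using h2
    have h0 : ∀ᶠ n : ℕ in atTop, 1 / (n : ℝ) < δ / 2 :=
      tendsto_one_div_atTop_nhds_zero_nat.eventually_lt_const (by positivity)
    filter_upwards [hinc, hE, h0, eventually_gt_atTop 0] with n hn hE h0 hn0 t' ht' htt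
    have hn0' : (0 : ℝ) < n := by positivity
    set i₀ := gridIdx n t with hi₀
    set i₁ := gridIdx n t' with hi₁
    have hi₀S : (i₀ : ℝ) ≤ S * n := gridIdx_le ht.1 ht.2
    have hi₁S : (i₁ : ℝ) ≤ S * n := gridIdx_le ht'.1 ht'.2
    have g0 := abs_gridIdx_div_sub_le hn0 ht.1
    have g1 := abs_gridIdx_div_sub_le hn0 ht'.1
    rw [← hi₀, abs_le] at g0
    rw [← hi₁, abs_le] at g1
    have h1 := abs_telescope_le (a := fun i => iter σ b c f n i x)
      (κ := (n : ℝ)⁻¹ * (ε + K * G * √((n : ℝ)⁻¹))) (Ψ := (n : ℝ)⁻¹ * F n i₀ x) i₀ i₁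
      fun i hi hi' => by
        have hiS : (i : ℝ) ≤ S * n := by
          rcases lt_max_iff.1 hi' with hi | hi
          · exact (Nat.cast_le.2 hi.le).trans hi₀S
          · exact (Nat.cast_le.2 hi.le).trans hi₁S
        have hiJ : (i : ℝ) / n ∈ J := ⟨by positivity, by rwa [div_le_iff₀ hn0']⟩
        have hit : |(i : ℝ) / n - t| < δ := by
          have hmono : ∀ {k l : ℕ}, k ≤ l → (k : ℝ) / n ≤ l / n := fun hkl => by gcongr
          rw [abs_lt] at htt ⊢
          constructor
          · rcases min_le_iff.1 hi with hi | hi <;> have := hmono hi <;> linarith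
          · rcases lt_max_iff.1 hi' with hi | hi <;> have := hmono hi.le <;> linarith
        have h2 := hE _ hiJ t ht hit x (by simp)
        rw [gridIdx_div hn0] at h2
        have h3 := (hn i hiS x).2
        have h4 : |(n : ℝ)⁻¹ * (F n i x - F n i₀ x)| ≤ (n : ℝ)⁻¹ * ε := by
          rw [abs_mul, abs_of_pos (inv_pos.2 hn0')]
          gcongr
        have h5 := abs_add_le (iter σ b c f n (i + 1) x - iter σ b c f n i x
          - (n : ℝ)⁻¹ * F n i x) ((n : ℝ)⁻¹ * (F n i x - F n i₀ x))
        rw [show iter σ b c f n (i + 1) x - iter σ b c f n i x - (n : ℝ)⁻¹ * F n i x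
          + (n : ℝ)⁻¹ * (F n i x - F n i₀ x) = iter σ b c f n (i + 1) x - iter σ b c f n i x
          - (n : ℝ)⁻¹ * F n i₀ x by ring] at h5
        linarith
    rw [← mul_assoc, ← mul_assoc, ← div_eq_mul_inv] at h1
    have h2 : |(i₁ : ℝ) - i₀| * (n : ℝ)⁻¹ = |((i₁ : ℝ) - i₀) / n| := by
      rw [← abs_of_pos (inv_pos.2 hn0'), ← abs_mul, ← div_eq_mul_inv]
    rw [h2] at h1
    have h3 := abs_gridIdx_sub_le hn0 ht.1 ht'.1
    rw [← hi₀, ← hi₁] at h3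
    set D := ((i₁ : ℝ) - i₀) / n with hD
    have h4 := abs_sub_abs_le_abs_sub D (t' - t)
    have hF0 := (hn i₀ hi₀S x).1
    have h5 : |(D - (t' - t)) * F n i₀ x| ≤ (n : ℝ)⁻¹ * L := by
      rw [abs_mul, ← one_div]
      exact mul_le_mul h3 hF0 (abs_nonneg _) (by positivity)
    have h6 := abs_add_le (iter σ b c f n i₁ x - iter σ b c f n i₀ x - D * F n i₀ x)
      ((D - (t' - t)) * F n i₀ x)
    rw [show iter σ b c f n i₁ x - iter σ b c f n i₀ x - D * F n i₀ x + (D - (t' - t)) * F n i₀ x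
      = iter σ b c f n i₁ x - iter σ b c f n i₀ x - (t' - t) * F n i₀ x by ring] at h6
    have h7 : |t' - t| ≤ S := abs_le.2 ⟨by linarith [ht'.1, ht.2], by linarith [ht'.2, ht.1]⟩
    set sq := K * G * √((n : ℝ)⁻¹) with hsq
    have hsq0 : 0 ≤ sq := by positivity
    have h8 : |D| ≤ |t' - t| + (n : ℝ)⁻¹ := by rw [← one_div]; linarith
    have h9 : |D| * (ε + sq) ≤ (|t' - t| + (n : ℝ)⁻¹) * ε + (S + (n : ℝ)⁻¹) * sq := by
      have h10 : |D| * ε ≤ (|t' - t| + (n : ℝ)⁻¹) * ε := by gcongr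
      have h11 : |D| * sq ≤ (S + (n : ℝ)⁻¹) * sq := by gcongr; linarith
      linarith
    change |iter σ b c f n i₁ x - iter σ b c f n i₀ x - (t' - t) * F n i₀ x| ≤ _
    linarith
  · refine ulim_eq (tendsto_const_nhds.congr fun n => ?_)
    simp [hw, gridIdx, iter]
  · have hexp : Tendsto (fun n : ℕ => Real.exp (c₀ * ((gridIdx n t : ℝ) / n)) * M) atTop
        (𝓝 (Real.exp (c₀ * t) * M)) := by
      have h1 : Tendsto (fun n : ℕ => (gridIdx n t : ℝ) / n) atTop (𝓝 t) := by
        rw [tendsto_iff_dist_tendsto_zero]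
        refine squeeze_zero' (Eventually.of_forall fun _ => dist_nonneg) ?_
          tendsto_one_div_atTop_nhds_zero_nat
        filter_upwards [eventually_gt_atTop 0] with n hn
        exact abs_gridIdx_div_sub_le hn ht.1
      exact ((Real.continuous_exp.tendsto _).comp (h1.const_mul c₀)).mul_const M
    refine le_of_tendsto_of_tendsto (((hwl []).tendsto_ulim ht x).abs) (hexp.mono_left hyp_le) ?_
    exact ((iter_sup_bound hN h.ubc h.c_le hM).filter_mono hyp_le).mono fun n hn => hn _ x

end SmoothSolution

/-! ### A weak maximum principle on cylinders -/

section MaxPrinciple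

variable {N : ℕ}

lemma second_deriv_nonpos_of_isLocalMax {V : ES N → ℝ} (hV : ContDiff ℝ 2 V) {x : ES N}
    (hx : IsLocalMax V x) (ξ : Fin N → ℝ) : ∑ i, ∑ j, ξ i * ξ j * pdl [i, j] V x ≤ 0 := by
  set y : ES N := WithLp.toLp 2 ξ with hy
  set g : ℝ → ℝ := fun τ => V (x + τ • y) with hg
  have h1 : ∀ τ, HasDerivAt g (∑ j, ξ j * pd1 V j (x + τ • y)) τ := fun τ =>
    HasDerivAt.of_line (hV.differentiable (by simp)) x y τ
  have hg' : deriv g = fun τ => ∑ j, ξ j * pd1 V j (x + τ • y) := funext fun τ => (h1 τ).deriv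
  have h2 : HasDerivAt (deriv g) (∑ j, ξ j * ∑ i, ξ i * pdl [i, j] V x) 0 := by
    rw [hg']
    refine HasDerivAt.fun_sum fun j _ => HasDerivAt.const_mul _ ?_
    have h3 : ContDiff ℝ 1 (pd1 V j) := hV.pd1 (by norm_num) j
    simpa using HasDerivAt.of_line (h3.differentiable (by simp)) x y 0
  have hmax : IsLocalMax g 0 := by
    have hc : ContinuousAt (fun τ : ℝ => x + τ • y) 0 := by fun_prop
    have : Tendsto (fun τ : ℝ => x + τ • y) (𝓝 0) (𝓝 x) := by simpa using hc.tendsto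
    filter_upwards [this.eventually hx] with τ hτ
    simpa [hg] using hτ
  have h4 : deriv (deriv g) 0 ≤ 0 := by
    by_contra! hpos
    have hmin := isLocalMin_of_deriv_deriv_pos hpos hmax.deriv_eq_zero (h1 0).continuousAt
    have hconst : g =ᶠ[𝓝 0] fun _ => g 0 := by
      filter_upwards [hmin, hmax] with τ a b using le_antisymm b a
    have := hconst.deriv.deriv_eq
    simp at this
    exact absurd this hpos.ne'
  rw [h2.deriv] at h4
  rw [Finset.sum_comm]
  refine le_of_eq_of_le (Finset.sum_congr rfl fun j _ => ?_) h4
  rw [Finset.mul_sum]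
  exact Finset.sum_congr rfl fun i _ => by ring

open scoped MatrixOrder in
lemma sum_mul_nonpos_of_posSemidef {q H : Fin N → Fin N → ℝ} (hs : ∀ i j, q i j = q j i)
    (hq : ∀ ξ : Fin N → ℝ, 0 ≤ ∑ i, ∑ j, q i j * ξ i * ξ j)
    (hH : ∀ ξ : Fin N → ℝ, ∑ i, ∑ j, ξ i * ξ j * H i j ≤ 0) : ∑ i, ∑ j, q i j * H i j ≤ 0 := by
  have hp : (Matrix.of q).PosSemidef := by
    refine Matrix.PosSemidef.of_dotProduct_mulVec_nonneg ?_ fun ξ => ?_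
    · ext i j; simp [hs i j]
    · refine (hq ξ).trans_eq ?_
      simp only [dotProduct, Matrix.mulVec, Finset.mul_sum, Matrix.of_apply, Pi.star_apply,
        star_trivial]
      exact Finset.sum_congr rfl fun i _ => Finset.sum_congr rfl fun j _ => by ring
  obtain ⟨A, hA⟩ := CStarAlgebra.nonneg_iff_eq_star_mul_self.1 hp.nonneg
  have hA' : ∀ i j, q i j = ∑ k, A k i * A k j := fun i j => by
    have := congrFun (congrFun hA i) j
    simpa [Matrix.mul_apply] using this
  calc ∑ i, ∑ j, q i j * H i j = ∑ k, ∑ i, ∑ j, A k i * A k j * H i j := by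
        simp only [hA', Finset.sum_mul]
        rw [Finset.sum_comm (γ := Fin N) (s := Finset.univ) (t := Finset.univ)
          (f := fun k i => ∑ j, A k i * A k j * H i j)]
        exact Finset.sum_congr rfl fun i _ => Finset.sum_comm
    _ ≤ 0 := Finset.sum_nonpos fun k _ => hH (A k)

theorem max_principle {α β r : ℝ} {x₀ : ES N} {V V' : ℝ → ES N → ℝ}
    {q : ℝ → Fin N → Fin N → ES N → ℝ}
    (hc : ContinuousOn (fun p : ℝ × ES N => V p.1 p.2) (Icc α β ×ˢ closedBall x₀ r))
    (hV : ∀ t ∈ Ioc α β, ContDiff ℝ 2 (V t))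
    (ht : ∀ t ∈ Ioc α β, ∀ x ∈ ball x₀ r,
      HasDerivWithinAt (fun t' => V t' x) (V' t x) (Icc α β) t)
    (hs : ∀ t ∈ Ioc α β, ∀ x i j, q t i j x = q t j i x)
    (hq : ∀ t ∈ Ioc α β, ∀ x (ξ : Fin N → ℝ), 0 ≤ ∑ i, ∑ j, q t i j x * ξ i * ξ j)
    (hlt : ∀ t ∈ Ioc α β, ∀ x ∈ ball x₀ r, 0 < V t x → (∀ i, pd1 (V t) i x = 0) →
      V' t x < ∑ i, ∑ j, q t i j x * pdl [i, j] (V t) x)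
    (h0 : ∀ x ∈ closedBall x₀ r, V α x ≤ 0)
    (hb : ∀ t ∈ Icc α β, ∀ x ∈ sphere x₀ r, V t x ≤ 0) :
    ∀ t ∈ Icc α β, ∀ x ∈ closedBall x₀ r, V t x ≤ 0 := by
  intro t₁ ht₁ x₁ hx₁
  by_contra! hpos
  obtain ⟨⟨t, x⟩, ⟨htm, hxm⟩, hmax⟩ := (isCompact_Icc.prod (isCompact_closedBall x₀ r)).exists_isMaxOn
    ⟨(t₁, x₁), ht₁, hx₁⟩ hc
  simp only at htm hxm
  have hmax' : ∀ t' ∈ Icc α β, ∀ x' ∈ closedBall x₀ r, V t' x' ≤ V t x := fun t' h1 x' h2 =>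
    hmax (show (t', x') ∈ Icc α β ×ˢ closedBall x₀ r from ⟨h1, h2⟩)
  have hp : 0 < V t x := hpos.trans_le (hmax' _ ht₁ _ hx₁)
  have htα : α < t := by
    rcases htm.1.eq_or_lt with h | h
    · subst h; exact absurd hp (h0 x hxm).not_gt
    · exact h
  have hxb : x ∈ ball x₀ r := by
    rw [mem_ball]
    refine lt_of_le_of_ne hxm fun h => ?_
    exact absurd hp (hb t htm x h).not_gt
  have htI : t ∈ Ioc α β := ⟨htα, htm.2⟩
  have hloc : IsLocalMax (V t) x := by
    filter_upwards [isOpen_ball.mem_nhds hxb] with y hy using hmax' t htm y (ball_subset_closedBall hy)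
  have hgrad : ∀ i, pd1 (V t) i x = 0 := fun i => by simp [pd1, hloc.fderiv_eq_zero]
  have h1 := hlt t htI x hxb hp hgrad
  have h2 : ∑ i, ∑ j, q t i j x * pdl [i, j] (V t) x ≤ 0 := sum_mul_nonpos_of_posSemidef
    (hs t htI x) (hq t htI x) (second_deriv_nonpos_of_isLocalMax (hV t htI) hloc)
  have h3 : HasDerivWithinAt (fun t' => V t' x) (V' t x) (Iio t) t :=
    (ht t htI x hxb).mono_of_mem_nhdsWithin (mem_of_superset (Ico_mem_nhdsLT htα)
      fun z hz => ⟨hz.1, hz.2.le.trans htm.2⟩)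
  rw [hasDerivWithinAt_iff_tendsto_slope' (by simp)] at h3
  have h4 : 0 ≤ V' t x := by
    refine ge_of_tendsto h3 ?_
    filter_upwards [Ico_mem_nhdsLT htα] with z hz
    rw [slope_def_field]
    exact div_nonneg_of_nonpos (sub_nonpos.2 (hmax' z ⟨hz.1, hz.2.le.trans htm.2⟩ x hxm))
      (sub_nonpos.2 hz.2.le)
  linarith

end MaxPrinciple

/-! ### Linearity of the problem, a priori bound and uniqueness -/

section Uniqueness

variable {N : ℕ} {T : ℝ} {q : ℝ → ES N → Fin N → Fin N → ℝ} {b : ℝ → ES N → Fin N → ℝ}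
  {c : ℝ → ES N → ℝ}

lemma pd1_lin {f g : ES N → ℝ} (hf : Differentiable ℝ f) (hg : Differentiable ℝ g) (a a' k : ℝ)
    (i : Fin N) : pd1 (fun x => a * f x - k - a' * g x) i = fun x => a * pd1 f i x - a' * pd1 g i x := by
  ext x
  have h1 := (hf x).const_mul a
  have h2 := (hg x).const_mul a'
  rw [pd1_sub (h1.fun_sub (differentiableAt_const k)) h2,
    pd1_sub h1 (differentiableAt_const k), pd1_const_mul _ (hf x), pd1_const_mul _ (hg x), pd1_const]
  ring

lemma pdl_lin {f g : ES N → ℝ} (hf : ContDiff ℝ 2 f) (hg : ContDiff ℝ 2 g) (a a' k : ℝ)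
    (i j : Fin N) : pdl [i, j] (fun x => a * f x - k - a' * g x)
      = fun x => a * pdl [i, j] f x - a' * pdl [i, j] g x := by
  have h1 : ContDiff ℝ 1 (pd1 f j) := hf.pd1 (by norm_num) j
  have h2 : ContDiff ℝ 1 (pd1 g j) := hg.pd1 (by norm_num) j
  have h3 := pd1_lin (h1.differentiable (by simp)) (h2.differentiable (by simp)) a a' 0 i
  simp only [sub_zero] at h3
  simp only [pdl_cons, pdl_nil]
  rw [pd1_lin (hf.differentiable (by simp)) (hg.differentiable (by simp)), h3]

lemma Aop_sub {f g : ES N → ℝ} (hf : ContDiff ℝ 2 f) (hg : ContDiff ℝ 2 g) (t : ℝ) (x : ES N) :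
    Aop q b c (fun y => f y - g y) t x = Aop q b c f t x - Aop q b c g t x := by
  have h1 := fun i => pd1_lin (hf.differentiable (by simp)) (hg.differentiable (by simp)) 1 1 0 i
  have h2 := fun i j => pdl_lin hf hg 1 1 0 i j
  simp only [one_mul, sub_zero, pdl_cons, pdl_nil] at h1 h2
  simp only [Aop, pd2, h1]
  simp only [h1] at h2
  simp only [h2, mul_sub, Finset.sum_sub_distrib]
  ring

lemma IsBCSol.sub {s τ : ℝ} {f g : ES N → ℝ} {u v : ℝ → ES N → ℝ} (hu : IsBCSol q b c s τ f u)
    (hv : IsBCSol q b c s τ g v) :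
    IsBCSol q b c s τ (fun x => f x - g x) fun t x => u t x - v t x := by
  obtain ⟨⟨M₁, u1⟩, u2, u3, u4, u5, u6, u7, u8, u9⟩ := hu
  obtain ⟨⟨M₂, v1⟩, v2, v3, v4, v5, v6, v7, v8, v9⟩ := hv
  have hd : ∀ t ∈ Ioc s τ, ∀ x, deriv (fun t' => u t' x - v t' x) t
      = deriv (fun t' => u t' x) t - deriv (fun t' => v t' x) t := fun t ht x =>
    deriv_fun_sub (u4 x t ht) (v4 x t ht)
  have h1 : ∀ t ∈ Ioc s τ, ∀ i, pd1 (fun x => u t x - v t x) i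
      = fun x => pd1 (u t) i x - pd1 (v t) i x := fun t ht i => by
    simpa using pd1_lin ((u3 t ht).differentiable (by simp)) ((v3 t ht).differentiable (by simp))
      1 1 0 i
  have h2 : ∀ t ∈ Ioc s τ, ∀ i j, pd2 (fun x => u t x - v t x) i j
      = fun x => pd2 (u t) i j x - pd2 (v t) i j x := fun t ht i j => by
    simpa [pd2] using pdl_lin (u3 t ht) (v3 t ht) 1 1 0 i j
  refine ⟨⟨M₁ + M₂, fun t ht x => (abs_sub _ _).trans (add_le_add (u1 t ht x) (v1 t ht x))⟩,
    u2.sub v2, fun t ht => (u3 t ht).sub (v3 t ht), fun x t ht => (u4 x t ht).fun_sub (v4 x t ht),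
    (u5.sub v5).congr fun p hp => hd _ hp.1 _, fun i => ((u6 i).sub (v6 i)).congr fun p hp => ?_,
    fun i j => ((u7 i j).sub (v7 i j)).congr fun p hp => ?_, fun t ht x => ?_, fun x => ?_⟩
  · exact congrFun (h1 _ hp.1 i) _
  · exact congrFun (h2 _ hp.1 i j) _
  · rw [hd t ht x, u8 t ht x, v8 t ht x, Aop_sub (u3 t ht) (v3 t ht)]
  · simp only [u9, v9]

lemma isBCSol_zero (s τ : ℝ) : IsBCSol q b c s τ (fun _ => 0) fun _ _ => 0 := by
  have h1 : ∀ i, pd1 (fun _ : ES N => (0 : ℝ)) i = fun _ => 0 := pd1_const 0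
  refine ⟨⟨0, by simp⟩, continuousOn_const, fun t _ => contDiff_const, by simp, ?_, ?_, ?_, ?_,
    by simp⟩
  · simpa using continuousOn_const
  · simp only [h1]; exact fun _ => continuousOn_const
  · simp only [pd2, h1]; exact fun _ _ => continuousOn_const
  · simp [Aop, pd2, h1]

theorem IsBCSol.le_exp_mul (H : Hyp N T q b c) {s : ℝ} (hs : s ∈ Ico 0 T) {f : ES N → ℝ}
    {v : ℝ → ES N → ℝ} (hv : IsBCSol q b c s T f v) {M : ℝ} (hM : ∀ x, f x ≤ M) (hM0 : 0 ≤ M) :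
    ∀ t ∈ Icc s T, ∀ x, v t x ≤ Real.exp (H.c₀ * (t - s)) * M := by
  obtain ⟨φ, lam, hlam, hφ, hφ2, hφt, M', hM'⟩ := H.liap
  obtain ⟨x₁, hx₁⟩ := hφ2.continuous.exists_forall_le hφt
  obtain ⟨⟨Mv, v1⟩, v2, v3, v4, -, -, -, v8, v9⟩ := hv
  set μ := lam + |M'| / φ x₁ + |H.c₀| + 1 with hμ
  have hμ0 : 0 ≤ μ := by have := hφ x₁; positivity
  have hsub : ∀ t ∈ Ioc s T, t ∈ Icc 0 T := fun t ht => ⟨hs.1.trans ht.1.le, ht.2⟩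
  have hA : ∀ t ∈ Ioc s T, ∀ x, Aop q b c φ t x - H.c₀ * φ x - μ * φ x ≤ -φ x := by
    intro t ht x
    have h1 := hM' t (hsub t ht) x
    have h2 : M' ≤ |M'| / φ x₁ * φ x := by
      refine (le_abs_self _).trans ?_
      rw [div_mul_eq_mul_div, le_div_iff₀ (hφ x₁)]
      exact mul_le_mul_of_nonneg_left (hx₁ x) (abs_nonneg _)
    have h3 : -H.c₀ * φ x ≤ |H.c₀| * φ x := mul_le_mul_of_nonneg_right (neg_le_abs _) (hφ x).le
    rw [hμ]; linarith
  have key : ∀ ε > 0, ∀ t ∈ Icc s T, ∀ x, Real.exp (-H.c₀ * (t - s)) * v t x - M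
      - ε * Real.exp (μ * (t - s)) * φ x ≤ 0 := by
    intro ε hε t₁ ht₁ x₂
    set K := Real.exp (|H.c₀| * (T - s)) * |Mv| with hK
    obtain ⟨R, hR⟩ := closedBall_compl_subset_of_mem_cocompact
      (hφt.eventually (eventually_ge_atTop (K / ε))) 0
    set ρ := max (R + 1) (‖x₂‖ + 1)
    refine max_principle (r := ρ) (x₀ := 0) (V := fun t x => Real.exp (-H.c₀ * (t - s)) * v t x - M
      - ε * Real.exp (μ * (t - s)) * φ x) (V' := fun t x => Real.exp (-H.c₀ * (t - s)) *
        (Aop q b c (v t) t x - H.c₀ * v t x) - ε * Real.exp (μ * (t - s)) * (μ * φ x))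
      (q := fun t i j x => q t x i j) ?_ ?_ ?_ ?_ ?_ ?_ ?_ ?_ t₁ ht₁ x₂
      (mem_closedBall_zero_iff.2 ((lt_add_one ‖x₂‖).le.trans (le_max_right _ _)))
    · have h1 : ContinuousOn (fun p : ℝ × ES N => v p.1 p.2) (Icc s T ×ˢ closedBall 0 ρ) :=
        v2.mono (prod_mono_right (subset_univ _))
      have h2 : Continuous fun p : ℝ × ES N => Real.exp (-H.c₀ * (p.1 - s)) := by fun_prop
      have h3 : Continuous fun p : ℝ × ES N => ε * Real.exp (μ * (p.1 - s)) := by fun_prop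
      exact ((h2.continuousOn.mul h1).sub continuousOn_const).sub
        (h3.mul (hφ2.continuous.comp continuous_snd)).continuousOn
    · intro t ht
      exact ((contDiff_const.mul (v3 t ht)).sub contDiff_const).sub (contDiff_const.mul hφ2)
    · intro t ht x _
      have h1 : HasDerivAt (fun t' => v t' x) (Aop q b c (v t) t x) t := by
        rw [← v8 t ht x]; exact (v4 x t ht).hasDerivAt
      have h2 : ∀ k : ℝ, HasDerivAt (fun t' => Real.exp (k * (t' - s)))
          (Real.exp (k * (t - s)) * k) t := fun k => by
        simpa using (((hasDerivAt_id t).sub_const s).const_mul k).exp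
      have h3 := ((((h2 (-H.c₀)).mul h1).sub_const M).sub (((h2 μ).const_mul ε).mul_const (φ x)))
      refine (h3.congr_deriv ?_).hasDerivWithinAt
      ring
    · exact fun t ht x i j => H.q_symm t (hsub t ht) x i j
    · intro t ht x ξ
      have h1 := H.ellip t (hsub t ht) x (WithLp.toLp 2 ξ)
      exact (mul_nonneg (H.ν₀_pos.le.trans (H.ν_lb t (hsub t ht) x)) (sq_nonneg _)).trans h1
    · intro t ht x _ hpos hgrad
      set e₁ := Real.exp (-H.c₀ * (t - s))
      set e₂ := ε * Real.exp (μ * (t - s)) with he₂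
      have he₂0 : 0 < e₂ := by positivity
      have hg : ∀ i, e₁ * pd1 (v t) i x = e₂ * pd1 φ i x := fun i => by
        have := hgrad i
        rw [pd1_lin ((v3 t ht).differentiable (by simp)) (hφ2.differentiable (by simp))] at this
        linarith
      have h2 : ∑ i, ∑ j, q t x i j * pdl [i, j] (fun x => e₁ * v t x - M - e₂ * φ x) x
          = e₁ * (∑ i, ∑ j, q t x i j * pd2 (v t) i j x)
            - e₂ * ∑ i, ∑ j, q t x i j * pd2 φ i j x := by
        simp only [pdl_lin (v3 t ht) hφ2, Finset.mul_sum, ← Finset.sum_sub_distrib]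
        exact Finset.sum_congr rfl fun i _ => Finset.sum_congr rfl fun j _ => by
          simp only [pdl_cons, pdl_nil, pd2]; ring
      have h3 : e₁ * ∑ j, b t x j * pd1 (v t) j x = e₂ * ∑ j, b t x j * pd1 φ j x := by
        rw [Finset.mul_sum, Finset.mul_sum]
        refine Finset.sum_congr rfl fun j _ => ?_
        linear_combination b t x j * hg j
      rw [h2]
      have h4 := hA t ht x
      have h5 : 0 ≤ (H.c₀ - c t x) * (e₁ * v t x - e₂ * φ x) :=
        mul_nonneg (sub_nonneg.2 (H.c_ub t (hsub t ht) x)) (by linarith)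
      have h6 : e₂ * (Aop q b c φ t x - H.c₀ * φ x - μ * φ x) < 0 :=
        mul_neg_of_pos_of_neg he₂0 (h4.trans_lt (neg_neg_of_pos (hφ x)))
      simp only [Aop] at h6 ⊢
      linarith
    · intro x _
      have := mul_pos hε (hφ x)
      simp only [sub_self, mul_zero, Real.exp_zero, one_mul, mul_one, v9]
      linarith [hM x]
    · intro t ht x hx
      have h1 : K / ε ≤ φ x := hR (by
        rw [mem_compl_iff, mem_closedBall, not_le]
        rw [mem_sphere] at hx
        rw [hx]
        exact (lt_add_one R).trans_le (le_max_left _ _))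
      have h2 : 1 ≤ Real.exp (μ * (t - s)) :=
        Real.one_le_exp (mul_nonneg hμ0 (sub_nonneg.2 ht.1))
      have h3 : Real.exp (-H.c₀ * (t - s)) * v t x ≤ K := by
        refine (mul_le_mul_of_nonneg_left ((le_abs_self _).trans ((v1 t ht x).trans
          (le_abs_self _))) (Real.exp_nonneg _)).trans
          (mul_le_mul_of_nonneg_right (Real.exp_le_exp.2 ?_) (abs_nonneg _))
        exact (mul_le_mul_of_nonneg_right (neg_le_abs _) (sub_nonneg.2 ht.1)).trans
          (mul_le_mul_of_nonneg_left (sub_le_sub_right ht.2 _) (abs_nonneg _))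
      have h4 : K ≤ ε * φ x := by rw [mul_comm]; exact (div_le_iff₀ hε).1 h1
      have h5 : ε * φ x ≤ ε * Real.exp (μ * (t - s)) * φ x := by
        rw [mul_right_comm]
        exact le_mul_of_one_le_right (mul_pos hε (hφ x)).le h2
      linarith
  intro t ht x
  have h1 : Real.exp (-H.c₀ * (t - s)) * v t x - M ≤ 0 := by
    have hlim : Tendsto (fun ε : ℝ => Real.exp (-H.c₀ * (t - s)) * v t x - M
        - ε * Real.exp (μ * (t - s)) * φ x) (𝓝[>] 0)
        (𝓝 (Real.exp (-H.c₀ * (t - s)) * v t x - M)) := by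
      have : Continuous fun ε : ℝ => Real.exp (-H.c₀ * (t - s)) * v t x - M
        - ε * Real.exp (μ * (t - s)) * φ x := by fun_prop
      simpa using (this.tendsto 0).mono_left nhdsWithin_le_nhds
    exact le_of_tendsto hlim (by filter_upwards [self_mem_nhdsWithin] with ε hε using key ε hε t ht x)
  have h2 : Real.exp (H.c₀ * (t - s)) * Real.exp (-H.c₀ * (t - s)) = 1 := by
    rw [← Real.exp_add]; simp
  have h3 := mul_le_mul_of_nonneg_left (sub_nonpos.1 h1) (Real.exp_nonneg (H.c₀ * (t - s)))
  rwa [← mul_assoc, h2, one_mul] at h3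

theorem IsBCSol.abs_le_exp_mul (H : Hyp N T q b c) {s : ℝ} (hs : s ∈ Ico 0 T) {f : ES N → ℝ}
    {v : ℝ → ES N → ℝ} (hv : IsBCSol q b c s T f v) {M : ℝ} (hM : ∀ x, |f x| ≤ M) :
    ∀ t ∈ Icc s T, ∀ x, |v t x| ≤ Real.exp (H.c₀ * (t - s)) * M := by
  intro t ht x
  have hM0 : 0 ≤ M := (abs_nonneg _).trans (hM 0)
  have h1 := hv.le_exp_mul H hs (fun x => (abs_le.1 (hM x)).2) hM0 t ht x
  have h2 := ((isBCSol_zero s T).sub hv).le_exp_mul H hs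
    (fun x => by linarith [(abs_le.1 (hM x)).1]) hM0 t ht x
  exact abs_le.2 ⟨by linarith, h1⟩

end Uniqueness

/-! ### Differentiated equations -/

section LowerOrder

variable {N : ℕ} {P : Type*}

/-- The families that are finite sums of products `D^I a · D^J u` with `a ∈ A`, `|I| ≤ d` and
`|J| ≤ r`. -/
inductive LowerOrder (A : Set (P → ES N → ℝ)) (u : P → ES N → ℝ) (d r : ℕ) :
    (P → ES N → ℝ) → Prop
  | zero : LowerOrder A u d r fun _ _ => 0
  | term {a : P → ES N → ℝ} (ha : a ∈ A) (I J : List (Fin N)) (hI : I.length ≤ d)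
      (hJ : J.length ≤ r) : LowerOrder A u d r fun p x => pdl I (a p) x * pdl J (u p) x
  | add {f g : P → ES N → ℝ} (hf : LowerOrder A u d r f) (hg : LowerOrder A u d r g) :
      LowerOrder A u d r fun p x => f p x + g p x

variable {A : Set (P → ES N → ℝ)} {u : P → ES N → ℝ} {d r : ℕ} {f g : P → ES N → ℝ}

lemma LowerOrder.congr (hf : LowerOrder A u d r f) (h : ∀ p x, g p x = f p x) :
    LowerOrder A u d r g := by
  rwa [show g = f from funext fun p => funext (h p)]

lemma LowerOrder.sum {ι : Type*} (s : Finset ι) {f : ι → P → ES N → ℝ}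
    (hf : ∀ a ∈ s, LowerOrder A u d r (f a)) : LowerOrder A u d r fun p x => ∑ a ∈ s, f a p x := by
  induction s using Finset.induction_on with
  | empty => simpa using LowerOrder.zero
  | insert a s ha ih =>
    simp only [Finset.sum_insert ha]
    exact (hf a (by simp)).add (ih fun b hb => hf b (by simp [hb]))

lemma LowerOrder.smooth (h : LowerOrder A u d r f) (hA : ∀ a ∈ A, ∀ p, Smooth (a p))
    (hu : ∀ p, Smooth (u p)) (p : P) : Smooth (f p) := by
  induction h with
  | zero => exact contDiff_const
  | term ha I J _ _ => exact ((hA _ ha p).pdl I).mul ((hu p).pdl J)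
  | add _ _ h1 h2 => exact h1.add h2

lemma LowerOrder.pd1 (h : LowerOrder A u d r f) (hA : ∀ a ∈ A, ∀ p, Smooth (a p))
    (hu : ∀ p, Smooth (u p)) (k : Fin N) :
    LowerOrder A u (d + 1) (r + 1) fun p => _root_.pd1 (f p) k := by
  induction h with
  | zero => simpa only [pd1_const] using LowerOrder.zero
  | @term a ha I J hI hJ =>
    have h1 : (fun p => _root_.pd1 (fun x => pdl I (a p) x * pdl J (u p) x) k) = fun p x =>
        pdl (k :: I) (a p) x * pdl J (u p) x + pdl I (a p) x * pdl (k :: J) (u p) x := by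
      ext p x
      exact pd1_mul (((hA _ ha p).pdl I).differentiable x) (((hu p).pdl J).differentiable x) k
    rw [h1]
    exact (LowerOrder.term ha _ _ (by simpa using hI) (by omega)).add
      (LowerOrder.term ha _ _ (by omega) (by simpa using hJ))
  | @add f g hf hg h1 h2 =>
    have h3 : (fun p => _root_.pd1 (fun x => f p x + g p x) k) = fun p x =>
        _root_.pd1 (f p) k x + _root_.pd1 (g p) k x := by
      ext p x
      exact pd1_add ((hf.smooth hA hu p).differentiable x) ((hg.smooth hA hu p).differentiable x) k
    rw [h3]
    exact h1.add h2

lemma LowerOrder.exists_bound (h : LowerOrder A u d r f) : ∃ C, 0 ≤ C ∧ ∀ p x B Y,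
    (∀ a ∈ A, ∀ I : List (Fin N), I.length ≤ d → |pdl I (a p) x| ≤ B) →
    (∀ J : List (Fin N), J.length ≤ r → |pdl J (u p) x| ≤ Y) → |f p x| ≤ C * (B * Y) := by
  induction h with
  | zero => exact ⟨0, le_rfl, by simp⟩
  | @term a ha I J hI hJ =>
    refine ⟨1, zero_le_one, fun p x B Y hB hY => ?_⟩
    rw [abs_mul, one_mul]
    exact mul_le_mul (hB a ha I hI) (hY J hJ) (abs_nonneg _)
      ((abs_nonneg _).trans (hB a ha I hI))
  | add _ _ h1 h2 =>
    obtain ⟨C, hC, h1⟩ := h1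
    obtain ⟨D, hD, h2⟩ := h2
    refine ⟨C + D, add_nonneg hC hD, fun p x B Y hB hY => ?_⟩
    rw [add_mul]
    exact (abs_add_le _ _).trans (add_le_add (h1 p x B Y hB hY) (h2 p x B Y hB hY))

lemma LowerOrder.continuousOn {Z : Type*} [TopologicalSpace Z] {s : Set Z} {φ : Z → P}
    {ξ : Z → ES N} (h : LowerOrder A u d r f)
    (hA : ∀ a ∈ A, ∀ I : List (Fin N), ContinuousOn (fun z => pdl I (a (φ z)) (ξ z)) s)
    (hu : ∀ J : List (Fin N), ContinuousOn (fun z => pdl J (u (φ z)) (ξ z)) s) :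
    ContinuousOn (fun z => f (φ z) (ξ z)) s := by
  induction h with
  | zero => exact continuousOn_const
  | term ha I J _ _ => exact (hA _ ha I).mul (hu J)
  | add _ _ h1 h2 => exact h1.add h2

/-- The set of coefficients of an operator. -/
def coeffSet (q : P → Fin N → Fin N → ES N → ℝ) (b : P → Fin N → ES N → ℝ) (c : P → ES N → ℝ) :
    Set (P → ES N → ℝ) :=
  {a | (∃ i j, a = fun p => q p i j) ∨ (∃ j, a = fun p => b p j) ∨ a = c}

lemma Smooth.contDiff_two {f : ES N → ℝ} (hf : Smooth f) : ContDiff ℝ 2 f :=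
  contDiff_infty.1 hf 2

lemma pdl_swap {f : ES N → ℝ} (hf : Smooth f) (k i j : Fin N) (I : List (Fin N)) :
    pdl (k :: i :: j :: I) f = pdl (i :: j :: k :: I) f := by
  have h := hf.pdl I
  simp only [pdl_cons]
  rw [pd1_comm (f := pd1 (pdl I f) j) (h.pd1 j).contDiff_two i k,
    pd1_comm (f := pdl I f) h.contDiff_two j k]

lemma lowerOrder_commutator {q : P → Fin N → Fin N → ES N → ℝ} {b : P → Fin N → ES N → ℝ}
    {c : P → ES N → ℝ} (hA : ∀ a ∈ coeffSet q b c, ∀ p, Smooth (a p)) (hu : ∀ p, Smooth (u p))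
    (I : List (Fin N)) : LowerOrder (coeffSet q b c) u I.length (I.length + 1) fun p x =>
      pdl I (fun y => (∑ i, ∑ j, q p i j y * pdl [i, j] (u p) y)
        + (∑ j, b p j y * pdl [j] (u p) y) + c p y * u p y) x
      - ∑ i, ∑ j, q p i j x * pdl (i :: j :: I) (u p) x := by
  have hq : ∀ i j, (fun p => q p i j) ∈ coeffSet q b c := fun i j => Or.inl ⟨i, j, rfl⟩
  have hb : ∀ j, (fun p => b p j) ∈ coeffSet q b c := fun j => Or.inr (Or.inl ⟨j, rfl⟩)
  have hc : c ∈ coeffSet q b c := Or.inr (Or.inr rfl)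
  induction I with
  | nil =>
    have h1 : LowerOrder (coeffSet q b c) u 0 1 fun p x =>
        (∑ j, pdl [] (b p j) x * pdl [j] (u p) x) + pdl [] (c p) x * pdl [] (u p) x :=
      (LowerOrder.sum _ fun j _ => LowerOrder.term (hb j) [] [j] (by simp) (by simp)).add
        (LowerOrder.term hc [] [] (by simp) (by simp))
    refine h1.congr fun p x => ?_
    simp only [pdl_nil]
    ring
  | cons k I ih =>
    have h1 := (ih.pd1 hA hu k).add (LowerOrder.sum Finset.univ fun i _ =>
      LowerOrder.sum Finset.univ fun j _ => LowerOrder.term (d := I.length + 1)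
        (r := I.length + 1 + 1) (hq i j) [k] (i :: j :: I) (by simp) (by simp))
    refine h1.congr fun p x => ?_
    set E : ES N → ℝ := fun y => (∑ i, ∑ j, q p i j y * pdl [i, j] (u p) y)
        + (∑ j, b p j y * pdl [j] (u p) y) + c p y * u p y with hE
    have sE : Smooth E := by
      refine ContDiff.add (ContDiff.add ?_ ?_) ((hA _ hc p).mul (hu p))
      · exact ContDiff.sum fun i _ => ContDiff.sum fun j _ =>
          (hA _ (hq i j) p).mul ((hu p).pdl [i, j])
      · exact ContDiff.sum fun j _ => (hA _ (hb j) p).mul ((hu p).pdl [j])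
    have d1 : ∀ i j, DifferentiableAt ℝ (q p i j) x := fun i j =>
      (hA _ (hq i j) p).differentiable x
    have d2 : ∀ i j, DifferentiableAt ℝ (pdl (i :: j :: I) (u p)) x := fun i j =>
      ((hu p).pdl (i :: j :: I)).differentiable x
    have d3 : ∀ i j, DifferentiableAt ℝ (fun x => q p i j x * pdl (i :: j :: I) (u p) x) x :=
      fun i j => (d1 i j).mul (d2 i j)
    have d4 : ∀ i, DifferentiableAt ℝ (fun x => ∑ j, q p i j x * pdl (i :: j :: I) (u p) x) x :=
      fun i => DifferentiableAt.fun_sum fun j _ => d3 i j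
    rw [pd1_sub ((sE.pdl I).differentiable x) (DifferentiableAt.fun_sum fun i _ => d4 i),
      pd1_sum _ fun i _ => d4 i]
    have h2 : ∀ i, pd1 (fun x => ∑ j, q p i j x * pdl (i :: j :: I) (u p) x) k x
        = (∑ j, pdl [k] (q p i j) x * pdl (i :: j :: I) (u p) x)
          + ∑ j, q p i j x * pdl (i :: j :: k :: I) (u p) x := fun i => by
      rw [pd1_sum _ fun j _ => d3 i j, ← Finset.sum_add_distrib]
      refine Finset.sum_congr rfl fun j _ => ?_
      rw [pd1_mul (d1 i j) (d2 i j), ← pdl_swap (hu p) k i j I]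
      rfl
    simp only [h2, Finset.sum_add_distrib]
    rw [show pdl (k :: I) E x = pd1 (pdl I E) k x from rfl]
    ring

end LowerOrder

section MixedDerivatives

variable {N : ℕ} {J : Set ℝ} {g G : ℝ → ES N → ℝ}

lemma hasDerivWithinAt_pd1 (hJ : Convex ℝ J) (hg : ∀ t ∈ J, Smooth (g t))
    (hG : ∀ t ∈ J, Smooth (G t))
    (h : ∀ t ∈ J, ∀ x, HasDerivWithinAt (fun t' => g t' x) (G t x) J t) (i : Fin N)
    (hc : ContinuousOn (fun p : ℝ × ES N => pd1 (G p.1) i p.2) (J ×ˢ univ)) {t : ℝ} (ht : t ∈ J)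
    (x : ES N) : HasDerivWithinAt (fun t' => pd1 (g t') i x) (pd1 (G t) i x) J t := by
  rw [hasDerivWithinAt_iff_isLittleO, Asymptotics.isLittleO_iff]
  intro ε hε
  obtain ⟨δ, hδ, hd⟩ := Metric.continuousOn_iff.1 hc (t, x) ⟨ht, mem_univ _⟩ (ε / 2) (by positivity)
  set e : ES N := EuclideanSpace.single i 1 with he
  have key : ∀ t' ∈ J, |t' - t| < δ → ∀ τ ∈ Ioo (0 : ℝ) δ,
      |(g t' (x + τ • e) - g t (x + τ • e) - (t' - t) * G t (x + τ • e))
        - (g t' x - g t x - (t' - t) * G t x)| ≤ ε * |t' - t| * τ := by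
    intro t' ht' htt τ hτ
    have hsub : uIcc t t' ⊆ J := by rw [← segment_eq_uIcc]; exact hJ.segment_subset ht ht'
    have hx : ∀ r ∈ uIcc t t', |(G r (x + τ • e) - G r x) - (G t (x + τ • e) - G t x)| ≤ ε * τ := by
      intro r hr
      have hrJ := hsub hr
      have hrt : |r - t| < δ := (abs_sub_left_of_mem_uIcc hr).trans_lt htt
      have h1 : ∀ r ∈ J, ∀ σ, HasDerivAt (fun σ : ℝ => G r (x + σ • e)) (pd1 (G r) i (x + σ • e)) σ := by
        intro r hr σ
        have := HasDerivAt.of_line (hG r hr).differentiable x e σ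
        simpa [he, Pi.single_apply] using this
      have h2 := Convex.norm_image_sub_le_of_norm_hasDerivWithin_le (𝕜 := ℝ)
        (f := fun σ : ℝ => G r (x + σ • e) - G t (x + σ • e))
        (f' := fun σ => pd1 (G r) i (x + σ • e) - pd1 (G t) i (x + σ • e)) (C := ε)
        (s := Icc (0 : ℝ) τ) (x := 0) (y := τ)
        (fun σ _ => ((h1 r hrJ σ).sub (h1 t ht σ)).hasDerivWithinAt) ?_ (convex_Icc 0 τ)
        (by simp [hτ.1.le]) (by simp [hτ.1.le])
      · simp only [zero_smul, add_zero, sub_zero, Real.norm_eq_abs, abs_of_pos hτ.1] at h2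
        refine le_trans (le_of_eq ?_) h2
        congr 1
        ring
      · intro σ hσ
        have hn : dist (x + σ • e) x < δ := by
          rw [dist_eq_norm, add_sub_cancel_left, norm_smul, he, Real.norm_eq_abs,
            abs_of_nonneg hσ.1]
          simpa using hσ.2.trans_lt hτ.2
        have e1 := hd (r, x + σ • e) ⟨hrJ, mem_univ _⟩ (max_lt (by rwa [Real.dist_eq]) hn)
        have e2 := hd (t, x + σ • e) ⟨ht, mem_univ _⟩ (max_lt (by simpa using hδ) hn)
        rw [Real.dist_eq] at e1 e2
        rw [Real.norm_eq_abs]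
        rw [abs_lt] at e1 e2
        rw [abs_le]
        constructor <;> linarith [e1.1, e1.2, e2.1, e2.2]
    have h3 := Convex.norm_image_sub_le_of_norm_hasDerivWithin_le (𝕜 := ℝ)
      (f := fun r => (g r (x + τ • e) - g r x) - r * (G t (x + τ • e) - G t x))
      (f' := fun r => (G r (x + τ • e) - G r x) - (G t (x + τ • e) - G t x)) (C := ε * τ)
      (s := uIcc t t') (x := t) (y := t') (fun r hr => ?_) (fun r hr => hx r hr)
      (convex_uIcc t t') left_mem_uIcc right_mem_uIcc
    · simp only [Real.norm_eq_abs] at h3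
      refine le_trans (le_of_eq ?_) (h3.trans_eq (by ring))
      congr 1
      ring
    · have h4 := ((h r (hsub hr) (x + τ • e)).sub (h r (hsub hr) x)).sub
        ((hasDerivWithinAt_id r J).mul_const (G t (x + τ • e) - G t x))
      simp only [one_mul] at h4
      exact h4.mono hsub
  filter_upwards [inter_mem_nhdsWithin J (ball_mem_nhds t hδ)] with t' ht'
  have htt : |t' - t| < δ := by simpa [Real.dist_eq] using ht'.2
  set φ : ES N → ℝ := fun y => g t' y - g t y - (t' - t) * G t y with hφ
  have d1 := (hg t' ht'.1).differentiable
  have d2 := (hg t ht).differentiable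
  have d3 := (hG t ht).differentiable
  have sφ : Differentiable ℝ φ := (d1.sub d2).sub (d3.const_mul _)
  have h5 : pd1 φ i x = pd1 (g t') i x - pd1 (g t) i x - (t' - t) * pd1 (G t) i x := by
    rw [hφ, pd1_sub ((d1 x).fun_sub (d2 x)) ((d3 x).const_mul _), pd1_sub (d1 x) (d2 x),
      pd1_const_mul _ (d3 x)]
  have h6 : HasDerivAt (fun σ : ℝ => φ (x + σ • e)) (pd1 φ i x) 0 := by
    have := HasDerivAt.of_line sφ x e 0
    simpa [he, Pi.single_apply] using this
  have h7 := hasDerivAt_iff_tendsto_slope.1 h6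
  have h8 : |pd1 φ i x| ≤ ε * |t' - t| := by
    refine le_of_tendsto (h7.mono_left (y := 𝓝[>] 0) ?_).abs ?_
    · exact nhdsWithin_mono _ fun z (hz : 0 < z) => hz.ne'
    · filter_upwards [Ioo_mem_nhdsGT hδ] with τ hτ
      rw [slope_def_field, abs_div, sub_zero, abs_of_pos hτ.1, div_le_iff₀ hτ.1]
      simpa using key t' ht'.1 htt τ hτ
  rw [h5] at h8
  simpa using h8

lemma hasDerivWithinAt_pdl (hJ : Convex ℝ J) (hg : ∀ t ∈ J, Smooth (g t))
    (hG : ∀ t ∈ J, Smooth (G t))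
    (h : ∀ t ∈ J, ∀ x, HasDerivWithinAt (fun t' => g t' x) (G t x) J t)
    (hc : ∀ I : List (Fin N), ContinuousOn (fun p : ℝ × ES N => pdl I (G p.1) p.2) (J ×ˢ univ))
    (I : List (Fin N)) : ∀ t ∈ J, ∀ x,
      HasDerivWithinAt (fun t' => pdl I (g t') x) (pdl I (G t) x) J t := by
  induction I with
  | nil => exact h
  | cons i I ih =>
    intro t ht x
    exact hasDerivWithinAt_pd1 hJ (fun t ht => (hg t ht).pdl I) (fun t ht => (hG t ht).pdl I) ih i
      (hc (i :: I)) ht x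

end MixedDerivatives

/-! ### Interior gradient estimates of Bernstein type -/

section Bernstein

variable {N : ℕ}

/-- The second order part of an elliptic operator with frozen coefficients. -/
def secondPart (A : Fin N → Fin N → ℝ) (f : ES N → ℝ) (x : ES N) : ℝ :=
  ∑ i, ∑ j, A i j * pdl [i, j] f x

/-- The bilinear form of the gradients associated with a matrix. -/
def gradForm (A : Fin N → Fin N → ℝ) (f g : ES N → ℝ) (x : ES N) : ℝ :=
  ∑ i, ∑ j, A i j * (pd1 f i x * pd1 g j x)

variable {A : Fin N → Fin N → ℝ} {f g : ES N → ℝ}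

lemma pdl_two_add (hf : Smooth f) (hg : Smooth g) (i j : Fin N) (x : ES N) :
    pdl [i, j] (fun y => f y + g y) x = pdl [i, j] f x + pdl [i, j] g x := by
  have h1 : pd1 (fun y => f y + g y) j = fun y => pd1 f j y + pd1 g j y := funext fun y =>
    pd1_add (hf.differentiable y) (hg.differentiable y) j
  simp only [pdl_cons, pdl_nil, h1]
  exact pd1_add ((hf.pd1 j).differentiable x) ((hg.pd1 j).differentiable x) i

lemma pdl_two_mul (hf : Smooth f) (hg : Smooth g) (i j : Fin N) (x : ES N) :
    pdl [i, j] (fun y => f y * g y) x = pdl [i, j] f x * g x + f x * pdl [i, j] g x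
      + (pd1 f i x * pd1 g j x + pd1 f j x * pd1 g i x) := by
  have h1 : pd1 (fun y => f y * g y) j = fun y => pd1 f j y * g y + f y * pd1 g j y := funext fun y =>
    pd1_mul (hf.differentiable y) (hg.differentiable y) j
  have h2 := (hf.pd1 j).differentiable x
  have h3 := (hg.pd1 j).differentiable x
  simp only [pdl_cons, pdl_nil, h1]
  rw [pd1_add (h2.fun_mul (hg.differentiable x)) ((hf.differentiable x).fun_mul h3),
    pd1_mul h2 (hg.differentiable x), pd1_mul (hf.differentiable x) h3]
  ring

lemma secondPart_add (hf : Smooth f) (hg : Smooth g) (x : ES N) :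
    secondPart A (fun y => f y + g y) x = secondPart A f x + secondPart A g x := by
  simp only [secondPart, pdl_two_add hf hg, mul_add, Finset.sum_add_distrib]

lemma secondPart_mul (hA : ∀ i j, A i j = A j i) (hf : Smooth f) (hg : Smooth g) (x : ES N) :
    secondPart A (fun y => f y * g y) x
      = secondPart A f x * g x + f x * secondPart A g x + 2 * gradForm A f g x := by
  have h1 : ∑ i, ∑ j, A i j * (pd1 f j x * pd1 g i x) = gradForm A f g x := by
    rw [Finset.sum_comm, gradForm]
    exact Finset.sum_congr rfl fun j _ => Finset.sum_congr rfl fun i _ => by rw [hA]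
  rw [two_mul]
  nth_rw 2 [← h1]
  simp only [secondPart, gradForm, pdl_two_mul hf hg, Finset.sum_mul, Finset.mul_sum,
    ← Finset.sum_add_distrib]
  exact Finset.sum_congr rfl fun i _ => Finset.sum_congr rfl fun j _ => by ring

lemma secondPart_const (k : ℝ) (x : ES N) : secondPart A (fun _ => k) x = 0 := by
  have : ∀ i j, pdl [i, j] (fun _ : ES N => k) = fun _ => 0 := fun i j => by
    simp only [pdl_cons, pdl_nil, pd1_const]
  simp [secondPart, this]

lemma secondPart_const_mul (hf : Smooth f) (k : ℝ) (x : ES N) :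
    secondPart A (fun y => k * f y) x = k * secondPart A f x := by
  have h1 : ∀ i j, pdl [i, j] (fun y => k * f y) x = k * pdl [i, j] f x := fun i j => by
    have h1 : pd1 (fun y => k * f y) j = fun y => k * pd1 f j y := funext fun y =>
      pd1_const_mul k (hf.differentiable y) j
    simp only [pdl_cons, pdl_nil, h1]
    exact pd1_const_mul k ((hf.pd1 j).differentiable x) i
  simp only [secondPart, h1, Finset.mul_sum]
  exact Finset.sum_congr rfl fun i _ => Finset.sum_congr rfl fun j _ => by ring

lemma secondPart_sum {ι : Type*} (s : Finset ι) {f : ι → ES N → ℝ} (hf : ∀ a, Smooth (f a))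
    (x : ES N) : secondPart A (fun y => ∑ a ∈ s, f a y) x = ∑ a ∈ s, secondPart A (f a) x := by
  induction s using Finset.induction_on with
  | empty => simpa using secondPart_const 0 x
  | insert a s ha ih =>
    simp only [Finset.sum_insert ha]
    rw [secondPart_add (hf a) (ContDiff.sum fun b _ => hf b), ih]

lemma gradForm_mul_self_right (hg : Smooth g) (x : ES N) :
    gradForm A f (fun y => g y * g y) x = 2 * (g x * gradForm A f g x) := by
  simp only [gradForm, pd1_mul (hg.differentiable x) (hg.differentiable x), Finset.mul_sum]
  exact Finset.sum_congr rfl fun i _ => Finset.sum_congr rfl fun j _ => by ring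

lemma gradForm_mul_self_left (hf : Smooth f) (x : ES N) :
    gradForm A (fun y => f y * f y) g x = 2 * (f x * gradForm A f g x) := by
  simp only [gradForm, pd1_mul (hf.differentiable x) (hf.differentiable x), Finset.mul_sum]
  exact Finset.sum_congr rfl fun i _ => Finset.sum_congr rfl fun j _ => by ring

lemma gradForm_sum_right {ι : Type*} (s : Finset ι) {g : ι → ES N → ℝ} (hg : ∀ a, Smooth (g a))
    (x : ES N) : gradForm A f (fun y => ∑ a ∈ s, g a y) x = ∑ a ∈ s, gradForm A f (g a) x := by
  simp only [gradForm, pd1_sum s fun a _ => (hg a).differentiable x, Finset.mul_sum]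
  rw [Finset.sum_comm (s := s)]
  refine Finset.sum_congr rfl fun i _ => ?_
  rw [Finset.sum_comm]

lemma abs_gradForm_le {K B : ℝ} {x : ES N} (hA : ∀ i j, |A i j| ≤ K) (hf : ∀ i, |pd1 f i x| ≤ B) :
    |gradForm A f g x| ≤ N * K * B * ∑ j, |pd1 g j x| := by
  calc |gradForm A f g x| ≤ ∑ i : Fin N, ∑ j, K * B * |pd1 g j x| := by
        refine (Finset.abs_sum_le_sum_abs _ _).trans (Finset.sum_le_sum fun i _ =>
          (Finset.abs_sum_le_sum_abs _ _).trans (Finset.sum_le_sum fun j _ => ?_))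
        rw [abs_mul, abs_mul, ← mul_assoc]
        exact mul_le_mul_of_nonneg_right (mul_le_mul (hA i j) (hf i) (abs_nonneg _)
          ((abs_nonneg _).trans (hA i j))) (abs_nonneg _)
    _ = N * K * B * ∑ j, |pd1 g j x| := by
        simp only [← Finset.mul_sum, Finset.sum_const, Finset.card_univ, Fintype.card_fin,
          nsmul_eq_mul]
        ring

lemma abs_secondPart_le {K B : ℝ} {x : ES N} (hA : ∀ i j, |A i j| ≤ K)
    (hf : ∀ i j, |pdl [i, j] f x| ≤ B) : |secondPart A f x| ≤ N * N * (K * B) := by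
  calc |secondPart A f x| ≤ ∑ _i : Fin N, ∑ _j : Fin N, K * B := by
        refine (Finset.abs_sum_le_sum_abs _ _).trans (Finset.sum_le_sum fun i _ =>
          (Finset.abs_sum_le_sum_abs _ _).trans (Finset.sum_le_sum fun j _ => ?_))
        rw [abs_mul]
        exact mul_le_mul (hA i j) (hf i j) (abs_nonneg _) ((abs_nonneg _).trans (hA i j))
    _ = N * N * (K * B) := by simp; ring

lemma mul_le_weighted {w : ℝ} (hw : 0 < w) (X Y : ℝ) : X * Y ≤ w * Y ^ 2 + X ^ 2 / w := by
  have h1 : w * (w * Y ^ 2 + X ^ 2 / w) = (w * Y) ^ 2 + X ^ 2 := by field_simp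
  refine le_of_mul_le_mul_left ?_ hw
  nlinarith [sq_nonneg (w * Y - X), sq_nonneg (w * Y), sq_nonneg X]

lemma bernstein_scalar {ν a τ₀ p₀ n₁ n₂ : ℝ} (hν : 0 < ν) (ha : 0 ≤ a) (hτ₀ : 0 ≤ τ₀)
    (hn₁ : 0 ≤ n₁) (hn₂ : 0 ≤ n₂) : ∃ lam C : ℝ, 0 ≤ lam ∧ 0 ≤ C ∧
      ∀ p τ e h E H : ℝ, 0 ≤ p → p ≤ p₀ → 0 ≤ τ → τ ≤ τ₀ → 0 ≤ e → 0 ≤ h → 0 ≤ E → 0 ≤ H →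
        e ^ 2 ≤ n₁ * E → h ^ 2 ≤ n₂ * H →
        p * p * E + τ * (p * p) * (a * e * (1 + e + h) - 2 * (ν * H)) + τ * (E * a)
          + τ * p * (a * e * h) + lam * (a * (1 + e) - 2 * (ν * E)) - C < 0 := by
  set κ := a ^ 2 * n₁ * (n₂ + 1) / ν with hκ
  have hκ0 : 0 ≤ κ := by positivity
  set D := p₀ ^ 2 + τ₀ * p₀ ^ 2 * (2 * a * n₁ + κ) + τ₀ * a + τ₀ * κ with hD
  have hD0 : 0 ≤ D := by positivity
  refine ⟨D / ν, τ₀ * p₀ ^ 2 * a + D / ν * (a + a ^ 2 * n₁ / ν) + 1, by positivity, by positivity, ?_⟩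
  intro p τ e h E H hp hp0 hτ hττ he hh hE hH h1 h2
  have hpp : p * p ≤ p₀ ^ 2 := by nlinarith
  have hpp0 : 0 ≤ p * p := by positivity
  have e1 : ∀ s : ℝ, 0 ≤ s → s * (a * e * h) ≤ ν * (s ^ 2 * H) + κ * E := by
    intro s hs
    have hw : 0 < ν / (n₂ + 1) := by positivity
    have f1 := mul_le_weighted hw (a * e) (s * h)
    have f2 : ν / (n₂ + 1) * (s * h) ^ 2 ≤ ν * (s ^ 2 * H) := by
      rw [div_mul_eq_mul_div, div_le_iff₀ (by positivity), mul_assoc]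
      refine mul_le_mul_of_nonneg_left ?_ hν.le
      have f3 : h ^ 2 ≤ H * (n₂ + 1) := by nlinarith
      have := mul_le_mul_of_nonneg_left f3 (sq_nonneg s)
      rw [mul_pow]
      linarith
    have f4 : (a * e) ^ 2 / (ν / (n₂ + 1)) ≤ κ * E := by
      rw [hκ, div_div_eq_mul_div, div_mul_eq_mul_div]
      refine div_le_div_of_nonneg_right ?_ hν.le
      have f5 := mul_le_mul_of_nonneg_left h1 (by positivity : 0 ≤ a ^ 2 * (n₂ + 1))
      linarith
    linarith
  have g1 : τ * (p * p) * (a * e * (1 + e + h) - 2 * (ν * H)) + τ * p * (a * e * h)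
      ≤ τ₀ * p₀ ^ 2 * (a + (2 * a * n₁ + κ) * E) + τ₀ * κ * E := by
    have f1 := e1 1 zero_le_one
    have f2 := e1 p hp
    have f3 : e ≤ 1 + n₁ * E := by nlinarith [sq_nonneg (e - 1)]
    have f4 : a * e * (1 + e) ≤ a + 2 * a * n₁ * E := by
      have : e * (1 + e) ≤ 1 + 2 * (n₁ * E) := by nlinarith
      linarith [mul_le_mul_of_nonneg_left this ha]
    have f5 : p * p * (a * e * (1 + e + h) - 2 * (ν * H)) + p * (a * e * h)
        ≤ p * p * (a + (2 * a * n₁ + κ) * E) + κ * E := by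
      have f6 : a * e * (1 + e + h) ≤ a + (2 * a * n₁ + κ) * E + ν * H := by
        simp only [one_mul, one_pow] at f1
        linarith
      have := mul_le_mul_of_nonneg_left f6 hpp0
      linarith
    have f6 : 0 ≤ a + (2 * a * n₁ + κ) * E := by positivity
    calc _ = τ * (p * p * (a * e * (1 + e + h) - 2 * (ν * H)) + p * (a * e * h)) := by ring
      _ ≤ τ * (p * p * (a + (2 * a * n₁ + κ) * E) + κ * E) := mul_le_mul_of_nonneg_left f5 hτ
      _ ≤ τ₀ * (p₀ ^ 2 * (a + (2 * a * n₁ + κ) * E) + κ * E) := by gcongr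
      _ = _ := by ring
  have g2 : τ * (E * a) ≤ τ₀ * a * E := by
    have := mul_le_mul_of_nonneg_right hττ (mul_nonneg hE ha)
    linarith
  have g3 : p * p * E ≤ p₀ ^ 2 * E := mul_le_mul_of_nonneg_right hpp hE
  have g4 : a * (1 + e) - 2 * (ν * E) ≤ a + a ^ 2 * n₁ / ν - ν * E := by
    by_cases hn : n₁ = 0
    · subst hn
      have : e = 0 := by nlinarith
      subst this
      have := mul_nonneg hν.le hE
      simp; linarith
    have hn' : 0 < n₁ := lt_of_le_of_ne hn₁ (Ne.symm hn)
    have f1 := mul_le_weighted (w := ν / n₁) (by positivity) a e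
    have f2 : ν / n₁ * e ^ 2 ≤ ν * E := by
      rw [div_mul_eq_mul_div, div_le_iff₀ hn']
      nlinarith
    have f3 : a ^ 2 / (ν / n₁) = a ^ 2 * n₁ / ν := by rw [div_div_eq_mul_div]
    linarith
  have g5 := mul_le_mul_of_nonneg_left g4 (by positivity : 0 ≤ D / ν)
  have g6 : D / ν * (a + a ^ 2 * n₁ / ν - ν * E) = D / ν * (a + a ^ 2 * n₁ / ν) - D * E := by
    field_simp
  rw [g6] at g5
  have g7 : D * E = p₀ ^ 2 * E + τ₀ * p₀ ^ 2 * ((2 * a * n₁ + κ) * E) + τ₀ * a * E + τ₀ * κ * E := by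
    rw [hD]; ring
  linarith

end Bernstein

section BernsteinEstimate

variable {N : ℕ}

/-- The cutoff function of the interior estimates. -/
def cutoffSq (N : ℕ) (R : ℝ) (x : ES N) : ℝ := R ^ 2 - ‖x‖ ^ 2

lemma smooth_cutoffSq (R : ℝ) : Smooth (cutoffSq N R) :=
  contDiff_const.sub (contDiff_norm_sq ℝ)

lemma exists_bound_pdl_of_smooth {f : ES N → ℝ} (hf : Smooth f) (R : ℝ) (m : ℕ) :
    ∃ B, 0 ≤ B ∧ ∀ I : List (Fin N), I.length ≤ m → ∀ x ∈ closedBall (0 : ES N) R, |pdl I f x| ≤ B := by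
  have h1 : ∀ I : List (Fin N), ∃ B, ∀ x ∈ closedBall (0 : ES N) R, |pdl I f x| ≤ B := fun I =>
    (isCompact_closedBall 0 R).exists_bound_of_continuousOn (hf.pdl I).continuous.continuousOn
  choose B hB using h1
  have hfin : {I : List (Fin N) | I.length ≤ m}.Finite := List.finite_length_le _ _
  refine ⟨∑ I ∈ hfin.toFinset, |B I|, Finset.sum_nonneg fun _ _ => abs_nonneg _, fun I hI x hx => ?_⟩
  refine (hB I x hx).trans ((le_abs_self _).trans ?_)
  exact Finset.single_le_sum (f := fun I => |B I|) (fun _ _ => abs_nonneg _)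
    (hfin.mem_toFinset.2 hI)

theorem bernstein_estimate {ι κ : Type} [Fintype ι] [Fintype κ] {ν K R α β : ℝ} (hν : 0 < ν)
    (hK : 0 ≤ K) (hαβ : α ≤ β) : ∃ C, ∀ (q : ℝ → Fin N → Fin N → ES N → ℝ)
      (W f : ι → ℝ → ES N → ℝ) (Z g : κ → ℝ → ES N → ℝ),
      (∀ t i j x, q t i j x = q t j i x) →
      (∀ t x (ξ : Fin N → ℝ), ν * ∑ i, ξ i ^ 2 ≤ ∑ i, ∑ j, q t i j x * ξ i * ξ j) →
      (∀ t ∈ Icc α β, ∀ x ∈ closedBall (0 : ES N) R, ∀ i j, |q t i j x| ≤ K) →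
      (∀ a, ∀ t ∈ Icc α β, Smooth (W a t)) → (∀ a, ∀ t ∈ Icc α β, Smooth (Z a t)) →
      (∀ a, ContinuousOn (fun p : ℝ × ES N => W a p.1 p.2) (Icc α β ×ˢ univ)) →
      (∀ a, ContinuousOn (fun p : ℝ × ES N => Z a p.1 p.2) (Icc α β ×ˢ univ)) →
      (∀ a, ∀ t ∈ Icc α β, ∀ x, HasDerivWithinAt (fun t' => W a t' x)
        (secondPart (fun i j => q t i j x) (W a t) x + f a t x) (Icc α β) t) →
      (∀ a, ∀ t ∈ Icc α β, ∀ x, HasDerivWithinAt (fun t' => Z a t' x)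
        (secondPart (fun i j => q t i j x) (Z a t) x + g a t x) (Icc α β) t) →
      (∀ t ∈ Icc α β, ∀ x ∈ closedBall (0 : ES N) R, ∀ a, |W a t x| ≤ K) →
      (∀ t ∈ Icc α β, ∀ x ∈ closedBall (0 : ES N) R, ∀ a, |f a t x| ≤ K * (1 + ∑ b, |Z b t x|)) →
      (∀ t ∈ Icc α β, ∀ x ∈ closedBall (0 : ES N) R, ∀ a,
        |g a t x| ≤ K * (1 + ∑ b, |Z b t x| + ∑ b, ∑ j, |pd1 (Z b t) j x|)) →
      (∀ t ∈ Icc α β, ∀ x, ∑ b, Z b t x ^ 2 = ∑ a, ∑ k, pd1 (W a t) k x ^ 2) →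
      ∀ t ∈ Icc α β, ∀ x ∈ closedBall (0 : ES N) R,
        (t - α) * (R ^ 2 - ‖x‖ ^ 2) ^ 2 * ∑ b, Z b t x ^ 2 ≤ C := by
  obtain ⟨B, hB0, hB⟩ := exists_bound_pdl_of_smooth (smooth_cutoffSq (N := N) R) R 1
  obtain ⟨B', hB'0, hB'⟩ := exists_bound_pdl_of_smooth
    (f := fun y => cutoffSq N R y * cutoffSq N R y)
    ((smooth_cutoffSq R).mul (smooth_cutoffSq R)) R 2
  set n : ℝ := (Fintype.card ι : ℝ) with hn
  have hn0 : 0 ≤ n := by positivity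
  set a₀ : ℝ := 2 * K + N * N * (K * B') + 8 * (N * K * B) + 2 * (n * (K * K)) with ha₀
  have ha0 : 0 ≤ a₀ := by positivity
  obtain ⟨lam, C', hlam, hC', hsc⟩ := bernstein_scalar (a := a₀) (τ₀ := β - α) (p₀ := R ^ 2)
    (n₁ := Fintype.card κ) (n₂ := Fintype.card (κ × Fin N)) hν ha0 (sub_nonneg.2 hαβ)
    (by positivity) (by positivity)
  refine ⟨lam * (n * (K * K)) + C' * (β - α), ?_⟩
  intro q W f Z g hqs hqe hqK sW sZ cW cZ dW dZ bW bf bg hE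
  set p := cutoffSq N R with hp
  have sp : Smooth p := smooth_cutoffSq R
  have spp : Smooth fun y => p y * p y := sp.mul sp
  have hp0 : ∀ x ∈ closedBall (0 : ES N) R, 0 ≤ p x := fun x hx => by
    rw [mem_closedBall_zero_iff] at hx
    exact sub_nonneg.2 (pow_le_pow_left₀ (norm_nonneg _) hx 2)
  have hpR : ∀ x, p x ≤ R ^ 2 := fun x => sub_le_self _ (sq_nonneg _)
  set V : ℝ → ES N → ℝ := fun t x => (t - α) * ((p x * p x) * ∑ b, Z b t x * Z b t x)
    + (lam * (∑ a, W a t x * W a t x) + (-(lam * (n * (K * K)) + C' * (t - α)))) with hV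
  have sEt : ∀ t ∈ Icc α β, Smooth fun x => ∑ b, Z b t x * Z b t x := fun t ht =>
    ContDiff.sum fun b _ => (sZ b t ht).mul (sZ b t ht)
  have sSt : ∀ t ∈ Icc α β, Smooth fun x => ∑ a, W a t x * W a t x := fun t ht =>
    ContDiff.sum fun b _ => (sW b t ht).mul (sW b t ht)
  have hW2 : ∀ t ∈ Icc α β, ∀ x ∈ closedBall (0 : ES N) R, ∑ a, W a t x * W a t x ≤ n * (K * K) := by
    intro t ht x hx
    refine (Finset.sum_le_card_nsmul _ _ (K * K) fun a _ => ?_).trans_eq (by simp [hn])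
    rw [← abs_mul_abs_self]
    exact mul_self_le_mul_self (abs_nonneg _) (bW t ht x hx a)
  have key := max_principle (α := α) (β := β) (r := R) (x₀ := 0) (V := V)
    (V' := fun t x => (p x * p x) * (∑ b, Z b t x * Z b t x) + (t - α) * ((p x * p x) *
      ∑ b, 2 * (Z b t x * (secondPart (fun i j => q t i j x) (Z b t) x + g b t x)))
      + (lam * (∑ a, 2 * (W a t x * (secondPart (fun i j => q t i j x) (W a t) x + f a t x))) - C'))
    (q := q) ?_ ?_ ?_ (fun t _ x i j => hqs t i j x) ?_ ?_ ?_ ?_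
  · intro t ht x hx
    have h1 := key t ht x hx
    have h2 : 0 ≤ lam * ∑ a, W a t x * W a t x :=
      mul_nonneg hlam (Finset.sum_nonneg fun a _ => mul_self_nonneg _)
    have h3 : C' * (t - α) ≤ C' * (β - α) := mul_le_mul_of_nonneg_left (by linarith [ht.2]) hC'
    simp only [hV] at h1
    have h4 : (t - α) * (R ^ 2 - ‖x‖ ^ 2) ^ 2 * ∑ b, Z b t x ^ 2
        = (t - α) * ((p x * p x) * ∑ b, Z b t x * Z b t x) := by
      simp only [hp, cutoffSq, sq (Z _ t x)]; ring
    rw [h4]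
    linarith
  · have hm : Icc α β ×ˢ closedBall (0 : ES N) R ⊆ Icc α β ×ˢ univ := prod_mono_right (subset_univ _)
    have c1 : Continuous fun z : ℝ × ES N => p z.2 := sp.continuous.comp continuous_snd
    have c2 : ContinuousOn (fun z : ℝ × ES N => ∑ b, Z b z.1 z.2 * Z b z.1 z.2) (Icc α β ×ˢ univ) :=
      continuousOn_finsetSum _ fun b _ => (cZ b).mul (cZ b)
    have c3 : ContinuousOn (fun z : ℝ × ES N => ∑ b, W b z.1 z.2 * W b z.1 z.2) (Icc α β ×ˢ univ) :=
      continuousOn_finsetSum _ fun b _ => (cW b).mul (cW b)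
    have c4 : Continuous fun z : ℝ × ES N => z.1 - α := by fun_prop
    refine ContinuousOn.mono ?_ hm
    exact (c4.continuousOn.mul ((c1.mul c1).continuousOn.mul c2)).add
      ((continuousOn_const.mul c3).add (by fun_prop))
  · intro t ht
    have ht' := Ioc_subset_Icc_self ht
    exact Smooth.contDiff_two (f := V t) ((contDiff_const.mul (spp.mul (sEt t ht'))).add
      ((contDiff_const.mul (sSt t ht')).add contDiff_const))
  · intro t ht x _
    have ht' := Ioc_subset_Icc_self ht
    have d1 : HasDerivWithinAt (fun t' => ∑ b, Z b t' x * Z b t' x) (∑ b, 2 * (Z b t x *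
        (secondPart (fun i j => q t i j x) (Z b t) x + g b t x))) (Icc α β) t :=
      HasDerivWithinAt.fun_sum fun b _ => ((dZ b t ht' x).mul (dZ b t ht' x)).congr_deriv (by ring)
    have d2 : HasDerivWithinAt (fun t' => ∑ b, W b t' x * W b t' x) (∑ b, 2 * (W b t x *
        (secondPart (fun i j => q t i j x) (W b t) x + f b t x))) (Icc α β) t :=
      HasDerivWithinAt.fun_sum fun b _ => ((dW b t ht' x).mul (dW b t ht' x)).congr_deriv (by ring)
    have d3 : HasDerivWithinAt (fun t' : ℝ => t' - α) 1 (Icc α β) t :=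
      (hasDerivWithinAt_id t _).sub_const α
    have d4 := (d3.mul (d1.const_mul (p x * p x))).add
      ((d2.const_mul lam).add ((d3.const_mul C').const_add (lam * (n * (K * K)))).neg)
    refine d4.congr_deriv ?_
    ring
  · exact fun t _ x ξ => (mul_nonneg hν.le (Finset.sum_nonneg fun i _ => sq_nonneg _)).trans
      (hqe t x ξ)
  · intro t ht x hx _ _
    have ht' := Ioc_subset_Icc_self ht
    have hx' := ball_subset_closedBall hx
    set A : Fin N → Fin N → ℝ := fun i j => q t i j x with hA
    have hAs : ∀ i j, A i j = A j i := fun i j => hqs t i j x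
    set E := ∑ b, Z b t x * Z b t x with hEdef
    set H := ∑ b, ∑ j, pd1 (Z b t) j x ^ 2 with hH
    set e := ∑ b, |Z b t x| with he
    set h := ∑ b, ∑ j, |pd1 (Z b t) j x| with hh
    have e0 : 0 ≤ e := Finset.sum_nonneg fun _ _ => abs_nonneg _
    have h0 : 0 ≤ h := Finset.sum_nonneg fun _ _ => Finset.sum_nonneg fun _ _ => abs_nonneg _
    have E0 : 0 ≤ E := Finset.sum_nonneg fun _ _ => mul_self_nonneg _
    have H0 : 0 ≤ H := Finset.sum_nonneg fun _ _ => Finset.sum_nonneg fun _ _ => sq_nonneg _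
    have heE : e ^ 2 ≤ Fintype.card κ * E := by
      have := sq_sum_le_card_mul_sum_sq (s := Finset.univ) (f := fun b => |Z b t x|)
      simpa [sq_abs, sq (Z _ t x)] using this
    have hhH : h ^ 2 ≤ Fintype.card (κ × Fin N) * H := by
      have := sq_sum_le_card_mul_sum_sq (s := Finset.univ)
        (f := fun b : κ × Fin N => |pd1 (Z b.1 t) b.2 x|)
      rw [Fintype.sum_prod_type, Fintype.sum_prod_type] at this
      simpa only [sq_abs, Finset.card_univ] using this
    have main := hsc (p x) (t - α) e h E H (hp0 x hx') (hpR x) (by linarith [ht.1])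
      (by linarith [ht.2]) e0 h0 E0 H0 heE hhH
    have L1 : secondPart A (fun x => ∑ b, Z b t x * Z b t x) x
        = ∑ b, (2 * (Z b t x * secondPart A (Z b t) x) + 2 * gradForm A (Z b t) (Z b t) x) := by
      rw [secondPart_sum _ fun b => (sZ b t ht').mul (sZ b t ht')]
      refine Finset.sum_congr rfl fun b _ => ?_
      rw [secondPart_mul hAs (sZ b t ht') (sZ b t ht')]
      ring
    have L2 : secondPart A (fun x => ∑ b, W b t x * W b t x) x
        = ∑ b, (2 * (W b t x * secondPart A (W b t) x) + 2 * gradForm A (W b t) (W b t) x) := by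
      rw [secondPart_sum _ fun b => (sW b t ht').mul (sW b t ht')]
      refine Finset.sum_congr rfl fun b _ => ?_
      rw [secondPart_mul hAs (sW b t ht') (sW b t ht')]
      ring
    have L3 : gradForm A (fun y => p y * p y) (fun x => ∑ b, Z b t x * Z b t x) x
        = 4 * (p x * ∑ b, Z b t x * gradForm A p (Z b t) x) := by
      rw [gradForm_mul_self_left sp, gradForm_sum_right _ fun b => (sZ b t ht').mul (sZ b t ht')]
      simp only [gradForm_mul_self_right (sZ _ t ht'), ← Finset.mul_sum]
      ring
    have L : ∑ i, ∑ j, q t i j x * pdl [i, j] (V t) x = (t - α) * ((p x * p x) *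
        (∑ b, (2 * (Z b t x * secondPart A (Z b t) x) + 2 * gradForm A (Z b t) (Z b t) x))
        + secondPart A (fun y => p y * p y) x * E
        + 8 * (p x * ∑ b, Z b t x * gradForm A p (Z b t) x))
        + lam * ∑ b, (2 * (W b t x * secondPart A (W b t) x)
          + 2 * gradForm A (W b t) (W b t) x) := by
      change secondPart A (V t) x = _
      have s1 : Smooth fun x => (p x * p x) * ∑ b, Z b t x * Z b t x := spp.mul (sEt t ht')
      rw [hV, secondPart_add (contDiff_const.mul s1)
        ((contDiff_const.mul (sSt t ht')).add contDiff_const),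
        secondPart_add (contDiff_const.mul (sSt t ht')) contDiff_const,
        secondPart_const, secondPart_const_mul s1, secondPart_const_mul (sSt t ht'),
        secondPart_mul hAs spp (sEt t ht'), L1, L2, L3]
      ring
    have gpos : ∀ φ : ES N → ℝ, ν * ∑ k, pd1 φ k x ^ 2 ≤ gradForm A φ φ x := fun φ => by
      refine (hqe t x fun k => pd1 φ k x).trans_eq ?_
      simp only [gradForm, hA, mul_assoc]
    have T1 : ∑ b, 2 * (Z b t x * g b t x) ≤ a₀ * e * (1 + e + h) := by
      calc ∑ b, 2 * (Z b t x * g b t x) ≤ ∑ b, 2 * (|Z b t x| * (K * (1 + e + h))) := by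
            refine Finset.sum_le_sum fun b _ => mul_le_mul_of_nonneg_left ?_ zero_le_two
            refine (le_abs_self _).trans ?_
            rw [abs_mul]
            exact mul_le_mul_of_nonneg_left (bg t ht' x hx' b) (abs_nonneg _)
        _ = 2 * K * (e * (1 + e + h)) := by
            rw [← Finset.mul_sum, ← Finset.sum_mul]; ring
        _ ≤ a₀ * (e * (1 + e + h)) := by
            refine mul_le_mul_of_nonneg_right ?_ (by positivity)
            have : 0 ≤ (N : ℝ) * N * (K * B') + 8 * (N * K * B) + 2 * (n * (K * K)) := by positivity
            linarith
        _ = _ := by ring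
    have T2 : ν * H ≤ ∑ b, gradForm A (Z b t) (Z b t) x := by
      rw [hH, Finset.mul_sum]
      exact Finset.sum_le_sum fun b _ => gpos _
    have T3 : -(secondPart A (fun y => p y * p y) x) ≤ a₀ := by
      have := abs_secondPart_le (A := A) (x := x) (hqK t ht' x hx')
        (fun i j => hB' [i, j] (by simp) x hx')
      have h2 : 0 ≤ 2 * K + 8 * (N * K * B) + 2 * (n * (K * K)) := by positivity
      have := (neg_le_abs _).trans this
      linarith
    have T4 : -(8 * ∑ b, Z b t x * gradForm A p (Z b t) x) ≤ a₀ * e * h := by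
      have h1 : ∀ b, |gradForm A p (Z b t) x| ≤ N * K * B * h := fun b => by
        refine (abs_gradForm_le (hqK t ht' x hx') fun i => hB [i] (by simp) x hx').trans ?_
        refine mul_le_mul_of_nonneg_left ?_ (by positivity)
        exact Finset.single_le_sum (f := fun b => ∑ j, |pd1 (Z b t) j x|)
          (fun b _ => Finset.sum_nonneg fun _ _ => abs_nonneg _) (Finset.mem_univ b)
      have h2 : |∑ b, Z b t x * gradForm A p (Z b t) x| ≤ e * (N * K * B * h) := by
        rw [he, Finset.sum_mul]
        refine (Finset.abs_sum_le_sum_abs _ _).trans (Finset.sum_le_sum fun b _ => ?_)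
        rw [abs_mul]
        exact mul_le_mul_of_nonneg_left (h1 b) (abs_nonneg _)
      have h3 : 0 ≤ (2 * K + N * N * (K * B') + 2 * (n * (K * K))) * (e * h) := by positivity
      have := (neg_le_abs _).trans h2
      rw [ha₀]
      linarith
    have T5 : ∑ a, 2 * (W a t x * f a t x) ≤ a₀ * (1 + e) := by
      calc ∑ a, 2 * (W a t x * f a t x) ≤ ∑ _a : ι, 2 * (K * (K * (1 + e))) := by
            refine Finset.sum_le_sum fun b _ => mul_le_mul_of_nonneg_left ?_ zero_le_two
            refine (le_abs_self _).trans ?_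
            rw [abs_mul]
            exact mul_le_mul (bW t ht' x hx' b) (bf t ht' x hx' b) (abs_nonneg _) hK
        _ = 2 * (n * (K * K)) * (1 + e) := by simp [hn]; ring
        _ ≤ a₀ * (1 + e) := by
            refine mul_le_mul_of_nonneg_right ?_ (by positivity)
            have : 0 ≤ 2 * K + (N : ℝ) * N * (K * B') + 8 * (N * K * B) := by positivity
            linarith
    have T6 : ν * E ≤ ∑ a, gradForm A (W a t) (W a t) x := by
      have h1 : E = ∑ a, ∑ k, pd1 (W a t) k x ^ 2 := by
        rw [← hE t ht' x, hEdef]; simp only [sq]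
      rw [h1, Finset.mul_sum]
      exact Finset.sum_le_sum fun b _ => gpos _
    have hpx := hp0 x hx'
    have hτ : 0 ≤ t - α := by linarith [ht.1]
    have U1 := mul_le_mul_of_nonneg_left (show ∑ b, 2 * (Z b t x * g b t x)
      - 2 * ∑ b, gradForm A (Z b t) (Z b t) x ≤ a₀ * e * (1 + e + h) - 2 * (ν * H) by linarith)
      (mul_nonneg hτ (mul_nonneg hpx hpx))
    have U2 := mul_le_mul_of_nonneg_left (mul_le_mul_of_nonneg_left T3 E0) hτ
    have U3 := mul_le_mul_of_nonneg_left T4 (mul_nonneg hτ hpx)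
    have U4 := mul_le_mul_of_nonneg_left (show ∑ b, 2 * (W b t x * f b t x)
      - 2 * ∑ b, gradForm A (W b t) (W b t) x ≤ a₀ * (1 + e) - 2 * (ν * E) by linarith) hlam
    rw [L]
    simp only [mul_add, Finset.sum_add_distrib, ← Finset.mul_sum] at U1 U2 U3 U4 main ⊢
    linarith
  · intro x hx
    have hαm : α ∈ Icc α β := left_mem_Icc.2 hαβ
    have := mul_le_mul_of_nonneg_left (hW2 α hαm x hx) hlam
    simp only [hV, sub_self, zero_mul, mul_zero]
    linarith
  · intro t ht x hx
    have hx' : ‖x‖ = R := by simpa using hx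
    have hpz : p x = 0 := by rw [hp, cutoffSq, hx', sub_self]
    have := mul_le_mul_of_nonneg_left (hW2 t ht x (sphere_subset_closedBall hx)) hlam
    have h3 : 0 ≤ C' * (t - α) := mul_nonneg hC' (by linarith [ht.1])
    simp only [hV, hpz, zero_mul, mul_zero]
    linarith

end BernsteinEstimate

/-! ### Interior estimates for all derivatives -/

section InteriorEstimates

variable {N : ℕ}

/-- Smooth coefficients together with a smooth function. -/
structure SmoothData (N : ℕ) where
  /-- the second order coefficients -/
  q : Fin N → Fin N → ES N → ℝ
  /-- the first order coefficients -/
  b : Fin N → ES N → ℝ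
  /-- the potential -/
  c : ES N → ℝ
  /-- the function -/
  u : ES N → ℝ
  smooth_q : ∀ i j, Smooth (q i j)
  smooth_b : ∀ j, Smooth (b j)
  smooth_c : Smooth c
  smooth_u : Smooth u

/-- The pointwise and local properties of a smooth solution of a parabolic equation on `[α, β]`. -/
structure SmoothSol (q : ℝ → Fin N → Fin N → ES N → ℝ) (b : ℝ → Fin N → ES N → ℝ)
    (c : ℝ → ES N → ℝ) (ν : ℝ) (u : ℝ → ES N → ℝ) (α β : ℝ) : Prop where
  symm : ∀ t i j x, q t i j x = q t j i x
  ellip : ∀ t x (ξ : Fin N → ℝ), ν * ∑ i, ξ i ^ 2 ≤ ∑ i, ∑ j, q t i j x * ξ i * ξ j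
  sq : ∀ t i j, Smooth (q t i j)
  sb : ∀ t j, Smooth (b t j)
  sc : ∀ t, Smooth (c t)
  su : ∀ t, Smooth (u t)
  cq : ∀ i j I, ContinuousOn (fun p : ℝ × ES N => pdl I (q p.1 i j) p.2) (Icc α β ×ˢ univ)
  cb : ∀ j I, ContinuousOn (fun p : ℝ × ES N => pdl I (b p.1 j) p.2) (Icc α β ×ˢ univ)
  cc : ∀ I, ContinuousOn (fun p : ℝ × ES N => pdl I (c p.1) p.2) (Icc α β ×ˢ univ)
  cu : ∀ I, ContinuousOn (fun p : ℝ × ES N => pdl I (u p.1) p.2) (Icc α β ×ˢ univ)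
  eqn : ∀ t ∈ Icc α β, ∀ x, HasDerivWithinAt (fun t' => u t' x) (ell q b c t (u t) x) (Icc α β) t

variable {q : ℝ → Fin N → Fin N → ES N → ℝ} {b : ℝ → Fin N → ES N → ℝ} {c : ℝ → ES N → ℝ}
  {u : ℝ → ES N → ℝ} {ν α α' β K R R' : ℝ}

lemma SmoothSol.mono (h : SmoothSol q b c ν u α β) (hα : α ≤ α') : SmoothSol q b c ν u α' β where
  symm := h.symm
  ellip := h.ellip
  sq := h.sq
  sb := h.sb
  sc := h.sc
  su := h.su
  cq i j I := (h.cq i j I).mono (prod_mono_left (Icc_subset_Icc_left hα))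
  cb j I := (h.cb j I).mono (prod_mono_left (Icc_subset_Icc_left hα))
  cc I := (h.cc I).mono (prod_mono_left (Icc_subset_Icc_left hα))
  cu I := (h.cu I).mono (prod_mono_left (Icc_subset_Icc_left hα))
  eqn t ht x := (h.eqn t (Icc_subset_Icc_left hα ht) x).mono (Icc_subset_Icc_left hα)

/-- The derivatives of order at most `m` of the coefficients are bounded by `K` on a cylinder. -/
def CoeffBound (q : ℝ → Fin N → Fin N → ES N → ℝ) (b : ℝ → Fin N → ES N → ℝ) (c : ℝ → ES N → ℝ)
    (m : ℕ) (K α β R : ℝ) : Prop :=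
  ∀ I : List (Fin N), I.length ≤ m → ∀ t ∈ Icc α β, ∀ x ∈ closedBall (0 : ES N) R,
    (∀ i j, |pdl I (q t i j) x| ≤ K) ∧ (∀ j, |pdl I (b t j) x| ≤ K) ∧ |pdl I (c t) x| ≤ K

lemma CoeffBound.mono {m m' : ℕ} {K' : ℝ} (h : CoeffBound q b c m K α β R) (hm : m' ≤ m)
    (hK : K ≤ K') (hα : α ≤ α') (hR : R' ≤ R) : CoeffBound q b c m' K' α' β R' := by
  intro I hI t ht x hx
  obtain ⟨h1, h2, h3⟩ := h I (hI.trans hm) t (Icc_subset_Icc_left hα ht) x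
    (closedBall_subset_closedBall hR hx)
  exact ⟨fun i j => (h1 i j).trans hK, fun j => (h2 j).trans hK, h3.trans hK⟩

/-- The commutator of a derivative with the second order part. -/
def SmoothData.commutator (p : SmoothData N) (I : List (Fin N)) (x : ES N) : ℝ :=
  pdl I (fun y => (∑ i, ∑ j, p.q i j y * pdl [i, j] p.u y)
    + (∑ j, p.b j y * pdl [j] p.u y) + p.c y * p.u y) x
    - ∑ i, ∑ j, p.q i j x * pdl (i :: j :: I) p.u x

lemma SmoothData.commutator_bound (I : List (Fin N)) : ∃ C, 0 ≤ C ∧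
    ∀ (p : SmoothData N) (x : ES N) (B Y : ℝ),
      (∀ J : List (Fin N), J.length ≤ I.length →
        (∀ i j, |pdl J (p.q i j) x| ≤ B) ∧ (∀ j, |pdl J (p.b j) x| ≤ B) ∧ |pdl J p.c x| ≤ B) →
      (∀ J : List (Fin N), J.length ≤ I.length + 1 → |pdl J p.u x| ≤ Y) →
      |p.commutator I x| ≤ C * (B * Y) := by
  have hA : ∀ a ∈ coeffSet SmoothData.q SmoothData.b (SmoothData.c (N := N)), ∀ p, Smooth (a p) := by
    rintro a (⟨i, j, rfl⟩ | ⟨j, rfl⟩ | rfl) p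
    exacts [p.smooth_q i j, p.smooth_b j, p.smooth_c]
  obtain ⟨C, hC, h⟩ := (lowerOrder_commutator hA SmoothData.smooth_u I).exists_bound
  refine ⟨C, hC, fun p x B Y hB hY => h p x B Y ?_ hY⟩
  rintro a (⟨i, j, rfl⟩ | ⟨j, rfl⟩ | rfl) J hJ
  exacts [(hB J hJ).1 i j, (hB J hJ).2.1 j, (hB J hJ).2.2]

/-- The data of a smooth solution at a given time. -/
def SmoothSol.data (h : SmoothSol q b c ν u α β) (t : ℝ) : SmoothData N :=
  ⟨q t, b t, c t, u t, h.sq t, h.sb t, h.sc t, h.su t⟩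

lemma SmoothSol.pdl_ell_eq (h : SmoothSol q b c ν u α β) (I : List (Fin N)) (t : ℝ) (x : ES N) :
    pdl I (ell q b c t (u t)) x
      = secondPart (fun i j => q t i j x) (pdl I (u t)) x + (h.data t).commutator I x := by
  simp only [SmoothData.commutator, SmoothSol.data, secondPart, pdl_cons, pdl_nil]
  exact (add_sub_cancel _ _).symm

lemma SmoothSol.continuousOn_pdl_ell (h : SmoothSol q b c ν u α β) (I : List (Fin N)) :
    ContinuousOn (fun p : ℝ × ES N => pdl I (ell q b c p.1 (u p.1)) p.2) (Icc α β ×ˢ univ) := by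
  have hA : ∀ a ∈ coeffSet q b c, ∀ p, Smooth (a p) := by
    rintro a (⟨i, j, rfl⟩ | ⟨j, rfl⟩ | rfl) p
    exacts [h.sq p i j, h.sb p j, h.sc p]
  have h1 : ContinuousOn (fun p : ℝ × ES N => (h.data p.1).commutator I p.2) (Icc α β ×ˢ univ) := by
    refine (lowerOrder_commutator hA h.su I).continuousOn (φ := Prod.fst) (ξ := Prod.snd) ?_ h.cu
    rintro a (⟨i, j, rfl⟩ | ⟨j, rfl⟩ | rfl) J
    exacts [h.cq i j J, h.cb j J, h.cc J]
  simp only [h.pdl_ell_eq I]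
  refine ContinuousOn.add ?_ h1
  exact continuousOn_finsetSum _ fun i _ => continuousOn_finsetSum _ fun j _ =>
    (h.cq i j []).mul (h.cu (i :: j :: I))

lemma SmoothSol.hasDerivWithinAt (h : SmoothSol q b c ν u α β) (I : List (Fin N)) :
    ∀ t ∈ Icc α β, ∀ x, HasDerivWithinAt (fun t' => pdl I (u t') x)
      (secondPart (fun i j => q t i j x) (pdl I (u t)) x + (h.data t).commutator I x)
      (Icc α β) t := by
  intro t ht x
  rw [← h.pdl_ell_eq]
  refine hasDerivWithinAt_pdl (convex_Icc α β) (fun t _ => h.su t) (fun t _ => ?_) h.eqn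
    h.continuousOn_pdl_ell I t ht x
  exact ((ContDiff.sum fun i _ => ContDiff.sum fun j _ => (h.sq t i j).mul ((h.su t).pdl [i, j])).add
    (ContDiff.sum fun j _ => (h.sb t j).mul ((h.su t).pdl [j]))).add ((h.sc t).mul (h.su t))

lemma exists_ofFn_eq {A : Type*} {m : ℕ} (I : List A) (hI : I.length = m) :
    ∃ a : Fin m → A, List.ofFn a = I := by
  subst hI
  exact ⟨I.get, List.ofFn_get I⟩

lemma exists_bound_pdl_succ (m : ℕ) (hν : 0 < ν) (hK : 0 ≤ K) (hα : α < α') (hβ : α' ≤ β)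
    (hR' : 0 ≤ R') (hR : R' < R) : ∃ C, ∀ (q : ℝ → Fin N → Fin N → ES N → ℝ)
      (b : ℝ → Fin N → ES N → ℝ) (c u : ℝ → ES N → ℝ), SmoothSol q b c ν u α β →
      CoeffBound q b c (m + 1) K α β R →
      (∀ I : List (Fin N), I.length ≤ m → ∀ t ∈ Icc α β, ∀ x ∈ closedBall (0 : ES N) R,
        |pdl I (u t) x| ≤ K) →
      ∀ I : List (Fin N), I.length = m + 1 → ∀ t ∈ Icc α' β, ∀ x ∈ closedBall (0 : ES N) R',
        |pdl I (u t) x| ≤ C := by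
  choose C hC0 hC using SmoothData.commutator_bound (N := N)
  set wd : (Fin m → Fin N) → List (Fin N) := fun a => List.ofFn a with hwd
  set wd' : Fin N × (Fin m → Fin N) → List (Fin N) := fun a => a.1 :: List.ofFn a.2 with hwd'
  set D : ℝ := (∑ a, C (wd a)) + ∑ a, C (wd' a) with hD
  have hD1 : ∀ a, C (wd a) ≤ D := fun a =>
    (Finset.single_le_sum (f := fun a => C (wd a)) (fun _ _ => hC0 _) (Finset.mem_univ a)).trans
      (le_add_of_nonneg_right (Finset.sum_nonneg fun _ _ => hC0 _))
  have hD2 : ∀ a, C (wd' a) ≤ D := fun a =>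
    (Finset.single_le_sum (f := fun a => C (wd' a)) (fun _ _ => hC0 _) (Finset.mem_univ a)).trans
      (le_add_of_nonneg_left (Finset.sum_nonneg fun _ _ => hC0 _))
  have hD0 : 0 ≤ D := add_nonneg (Finset.sum_nonneg fun _ _ => hC0 _)
    (Finset.sum_nonneg fun _ _ => hC0 _)
  set K' : ℝ := K + D * (K * (K + 1)) with hK'
  have hK'0 : 0 ≤ K' := by positivity
  obtain ⟨C', hC'⟩ := bernstein_estimate (N := N) (ι := Fin m → Fin N)
    (κ := Fin N × (Fin m → Fin N)) (R := R) hν hK'0 (hα.le.trans hβ)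
  set κ : ℝ := (α' - α) * (R ^ 2 - R' ^ 2) ^ 2 with hκ
  have hR2 : 0 < R ^ 2 - R' ^ 2 := by nlinarith
  have hκ0 : 0 < κ := mul_pos (sub_pos.2 hα) (pow_pos hR2 2)
  refine ⟨C' / κ + 1, ?_⟩
  intro q b c u h hc hu I hI t ht x hx
  have hKK : K ≤ K' := le_add_of_nonneg_right (by positivity)
  have gen : ∀ (e : ℝ) (c₁ : ℝ), 0 ≤ e → 0 ≤ c₁ → c₁ ≤ D → c₁ * (K * (K + e)) ≤ K' * (1 + e) := by
    intro e c₁ he h0 h1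
    have h2 : K + e ≤ (K + 1) * (1 + e) := by nlinarith
    have h3 : c₁ * (K * (K + e)) ≤ D * (K * ((K + 1) * (1 + e))) :=
      mul_le_mul h1 (mul_le_mul_of_nonneg_left h2 hK) (by positivity) hD0
    have h4 : 0 ≤ K * (1 + e) := by positivity
    rw [hK']
    linarith
  have key := hC' q (fun a t => pdl (wd a) (u t)) (fun a t x => (h.data t).commutator (wd a) x)
    (fun a t => pdl (wd' a) (u t)) (fun a t x => (h.data t).commutator (wd' a) x)
    h.symm h.ellip (fun t ht x hx i j => ((hc [] (by simp) t ht x hx).1 i j).trans hKK)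
    (fun a t _ => (h.su t).pdl _) (fun a t _ => (h.su t).pdl _) (fun a => h.cu _) (fun a => h.cu _)
    (fun a => h.hasDerivWithinAt _) (fun a => h.hasDerivWithinAt _)
    (fun t ht x hx a => (hu _ (by simp [hwd]) t ht x hx).trans hKK) ?_ ?_ ?_
  · have h1 := key t (Icc_subset_Icc_left hα.le ht) x (closedBall_subset_closedBall hR.le hx)
    obtain ⟨k, I', rfl⟩ : ∃ k I', I = k :: I' := by
      cases I with
      | nil => simp at hI
      | cons k I' => exact ⟨k, I', rfl⟩
    obtain ⟨a, rfl⟩ := exists_ofFn_eq I' (by simpa using hI)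
    set z := pdl (k :: List.ofFn a) (u t) x with hz
    have h2 : z ^ 2 ≤ ∑ b, pdl (wd' b) (u t) x ^ 2 :=
      Finset.single_le_sum (f := fun b => pdl (wd' b) (u t) x ^ 2) (fun _ _ => sq_nonneg _)
        (Finset.mem_univ (k, a))
    have hxR : ‖x‖ ^ 2 ≤ R' ^ 2 :=
      pow_le_pow_left₀ (norm_nonneg _) (mem_closedBall_zero_iff.1 hx) 2
    have h3 : κ ≤ (t - α) * (R ^ 2 - ‖x‖ ^ 2) ^ 2 :=
      mul_le_mul (by linarith [ht.1]) (pow_le_pow_left₀ hR2.le (by linarith) 2) (by positivity)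
        (by linarith [ht.1])
    have h4 : κ * z ^ 2 ≤ C' := (mul_le_mul h3 h2 (sq_nonneg _) (hκ0.le.trans h3)).trans h1
    have h5 : z ^ 2 ≤ C' / κ := by rwa [le_div_iff₀ hκ0, mul_comm]
    nlinarith [sq_abs z, sq_nonneg (|z| - 1), abs_nonneg z]
  · intro t ht x hx a
    have he : 0 ≤ ∑ b, |pdl (wd' b) (u t) x| := Finset.sum_nonneg fun _ _ => abs_nonneg _
    refine (hC (wd a) (h.data t) x K (K + ∑ b, |pdl (wd' b) (u t) x|) ?_ ?_).trans
      (gen _ _ he (hC0 _) (hD1 a))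
    · exact fun J hJ => hc J (by simp [hwd] at hJ; omega) t ht x hx
    · intro J hJ
      simp only [hwd, List.length_ofFn] at hJ
      rcases Nat.lt_or_ge m J.length with hm | hm
      · cases J with
        | nil => simp at hm
        | cons k J =>
          obtain ⟨a, rfl⟩ := exists_ofFn_eq (m := m) J (by simp at hJ hm; omega)
          exact (Finset.single_le_sum (f := fun b => |pdl (wd' b) (u t) x|)
            (fun _ _ => abs_nonneg _) (Finset.mem_univ (k, a))).trans (le_add_of_nonneg_left hK)
      · exact (hu J hm t ht x hx).trans (le_add_of_nonneg_right he)
  · intro t ht x hx a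
    have he : 0 ≤ ∑ b, |pdl (wd' b) (u t) x| := Finset.sum_nonneg fun _ _ => abs_nonneg _
    have hh : 0 ≤ ∑ b, ∑ j, |pd1 (pdl (wd' b) (u t)) j x| :=
      Finset.sum_nonneg fun _ _ => Finset.sum_nonneg fun _ _ => abs_nonneg _
    rw [add_assoc]
    refine (hC (wd' a) (h.data t) x K (K + (∑ b, |pdl (wd' b) (u t) x|
      + ∑ b, ∑ j, |pd1 (pdl (wd' b) (u t)) j x|)) ?_ ?_).trans
      (gen _ _ (add_nonneg he hh) (hC0 _) (hD2 a))
    · exact fun J hJ => hc J (by simpa [hwd'] using hJ) t ht x hx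
    · intro J hJ
      simp only [hwd', List.length_ofFn, List.length_cons] at hJ
      rcases Nat.lt_or_ge m J.length with hm | hm
      · rcases Nat.lt_or_ge (m + 1) J.length with hm' | hm'
        · rcases J with _ | ⟨j, _ | ⟨k, J⟩⟩
          · simp at hm
          · simp at hm'
          · obtain ⟨a, rfl⟩ := exists_ofFn_eq (m := m) J (by simp at hJ hm'; omega)
            have h1 : |pdl (j :: k :: List.ofFn a) (u t) x|
                ≤ ∑ b, ∑ j, |pd1 (pdl (wd' b) (u t)) j x| :=
              (Finset.single_le_sum (f := fun j => |pd1 (pdl (wd' (k, a)) (u t)) j x|)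
                (fun _ _ => abs_nonneg _) (Finset.mem_univ j)).trans
              (Finset.single_le_sum (f := fun b => ∑ j, |pd1 (pdl (wd' b) (u t)) j x|)
                (fun _ _ => Finset.sum_nonneg fun _ _ => abs_nonneg _) (Finset.mem_univ (k, a)))
            change |pdl (j :: k :: List.ofFn a) (u t) x| ≤ _
            linarith
        · cases J with
          | nil => simp at hm
          | cons k J =>
            obtain ⟨a, rfl⟩ := exists_ofFn_eq (m := m) J (by simp at hm' hm; omega)
            have h1 : |pdl (k :: List.ofFn a) (u t) x| ≤ ∑ b, |pdl (wd' b) (u t) x| :=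
              Finset.single_le_sum (f := fun b => |pdl (wd' b) (u t) x|)
                (fun _ _ => abs_nonneg _) (Finset.mem_univ (k, a))
            change |pdl (k :: List.ofFn a) (u t) x| ≤ _
            linarith
      · refine (hu J hm t ht x hx).trans ?_
        linarith
  · intro t ht x
    rw [Fintype.sum_prod_type, Finset.sum_comm]
    rfl

theorem exists_interior_bound (hν : 0 < ν) (hK : 0 ≤ K) (m : ℕ) : ∀ {α' R' : ℝ}, α < α' → α' ≤ β →
    0 ≤ R' → R' < R → ∃ C, ∀ (q : ℝ → Fin N → Fin N → ES N → ℝ)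
      (b : ℝ → Fin N → ES N → ℝ) (c u : ℝ → ES N → ℝ), SmoothSol q b c ν u α β →
      CoeffBound q b c m K α β R →
      (∀ t ∈ Icc α β, ∀ x ∈ closedBall (0 : ES N) R, |u t x| ≤ K) →
      ∀ I : List (Fin N), I.length ≤ m → ∀ t ∈ Icc α' β, ∀ x ∈ closedBall (0 : ES N) R',
        |pdl I (u t) x| ≤ C := by
  induction m with
  | zero =>
    intro α' R' hα _ _ hR
    refine ⟨K, fun q b c u _ _ hu I hI t ht x hx => ?_⟩
    obtain rfl : I = [] := List.eq_nil_of_length_eq_zero (by omega)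
    exact hu t (Icc_subset_Icc_left hα.le ht) x (closedBall_subset_closedBall hR.le hx)
  | succ m ih =>
    intro α' R' hα hβ hR' hR
    obtain ⟨C, hC⟩ := ih (α' := (α + α') / 2) (R' := (R + R') / 2) (by linarith) (by linarith)
      (by linarith) (by linarith)
    obtain ⟨C', hC'⟩ := exists_bound_pdl_succ (N := N) (K := max K C) (α := (α + α') / 2) (α' := α')
      (β := β) (R := (R + R') / 2) (R' := R') m hν (hK.trans (le_max_left _ _)) (by linarith) hβ hR'
      (by linarith)
    refine ⟨max C C', fun q b c u h hc hu I hI t ht x hx => ?_⟩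
    have h1 := hC q b c u h (hc.mono (Nat.le_succ m) le_rfl le_rfl le_rfl) hu
    rcases Nat.lt_or_ge m I.length with hm | hm
    · refine (hC' q b c u (h.mono (by linarith)) (hc.mono le_rfl (le_max_left _ _) (by linarith)
        (by linarith)) (fun I hI t ht x hx => (h1 I hI t ht x hx).trans (le_max_right _ _)) I
        (by omega) t ht x hx).trans (le_max_right _ _)
    · exact (h1 I hm t (Icc_subset_Icc_left (by linarith) ht) x
        (closedBall_subset_closedBall (by linarith) hx)).trans (le_max_left _ _)

end InteriorEstimates

/-! ### Passage to the limit in a sequence of approximating problems -/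

section Approximation

variable {N : ℕ}

lemma continuousOn_pdl_of_timeCont {a : ℝ → ES N → ℝ} (ha : UB a) (ht : TimeCont a)
    (I : List (Fin N)) (J : Set ℝ) :
    ContinuousOn (fun p : ℝ × ES N => pdl I (a p.1) p.2) (J ×ˢ univ) := by
  have h1 : TimeEqui J fun (_ : ℕ) t => a t := fun R ε hε => by
    obtain ⟨δ, hδ, h⟩ := ht R ε hε
    exact ⟨δ, hδ, Eventually.of_forall fun _ t _ t' _ htt x hx => h t t' htt x hx⟩
  have h2 := TimeEqui.pdl (m := I.length) (fun _ t _ => ha.smooth t) h1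
    (fun I _ R => (ha.2 I).imp fun C hC => Eventually.of_forall fun _ t _ x _ => hC t x) I le_rfl
  refine continuousOn_of_lipschitz_of_equi (v := fun t => pdl I (a t)) (fun R => ?_) fun R ε hε => ?_
  · choose K hK using fun i => ha.2 (i :: I)
    refine ⟨N * ∑ i, |K i|, fun t _ x _ y _ => ?_⟩
    have := taylor_one ((ha.smooth t).pdl I) convex_univ (K := ∑ i, |K i|)
      (fun i z _ => ((hK i t z).trans (le_abs_self _)).trans
        (Finset.single_le_sum (f := fun i => |K i|) (fun _ _ => abs_nonneg _) (Finset.mem_univ i)))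
      (mem_univ y) (y := x - y) (mem_univ _)
    rw [add_sub_cancel] at this
    linarith
  · obtain ⟨δ, hδ, h⟩ := h2 R ε hε
    exact ⟨δ, hδ, h.exists.choose_spec⟩

theorem BoundedCoeff.exists_smoothSol {q : ℝ → Fin N → Fin N → ES N → ℝ} {b : ℝ → Fin N → ES N → ℝ}
    {c : ℝ → ES N → ℝ} {ν c₀ S M : ℝ} {f : ES N → ℝ} (hN : 1 ≤ N) (h : BoundedCoeff q b c ν c₀)
    (hS : 0 ≤ S) (hf : UB fun _ : Unit => f) (hM : ∀ x, |f x| ≤ M) :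
    ∃ u : ℝ → ES N → ℝ, SmoothSol q b c ν u 0 S ∧ (∀ x, u 0 x = f x) ∧
      ∀ t ∈ Icc 0 S, ∀ x, |u t x| ≤ Real.exp (c₀ * S) * M := by
  obtain ⟨u, h1, -, h3, h4, h5, h6⟩ := h.exists_solution hN S hf hM
  have hpr : ∀ t ∈ Icc 0 S, u (projIcc 0 S hS t) = u t := fun t ht => by
    rw [projIcc_of_mem hS ht]
  refine ⟨fun t => u (projIcc 0 S hS t), ?_, ?_, ?_⟩
  · refine ⟨h.symm, h.ellip, fun t i j => (h.ubq i j).smooth t, fun t j => (h.ubb j).smooth t,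
      fun t => h.ubc.smooth t, fun t => h1 _ (projIcc 0 S hS t).2,
      fun i j I => continuousOn_pdl_of_timeCont (h.ubq i j) (h.tq i j) I _,
      fun j I => continuousOn_pdl_of_timeCont (h.ubb j) (h.tb j) I _,
      fun I => continuousOn_pdl_of_timeCont h.ubc h.tc I _, fun I => ?_, fun t ht x => ?_⟩
    · refine (h3 I).congr ?_
      rintro ⟨t, x⟩ ⟨ht, -⟩
      simp only [hpr t ht]
    · rw [hpr t ht]
      exact (h4 t ht x).congr (fun t' ht' => by rw [hpr t' ht']) (by rw [hpr t ht])
  · intro x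
    simp only [hpr 0 ⟨le_rfl, hS⟩, h5]
  · intro t ht x
    simp only [hpr t ht]
    refine (h6 t ht x).trans ?_
    have hM0 : 0 ≤ M := (abs_nonneg _).trans (hM 0)
    gcongr
    · exact h.c₀_nonneg
    · exact ht.2

/-- Approximation of coefficients by bounded smooth ones, locally uniformly controlled. -/
structure ApproxCoeff (q : ℕ → ℝ → Fin N → Fin N → ES N → ℝ) (b : ℕ → ℝ → Fin N → ES N → ℝ)
    (c : ℕ → ℝ → ES N → ℝ) (Q : ℝ → Fin N → Fin N → ES N → ℝ) (B : ℝ → Fin N → ES N → ℝ)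
    (C : ℝ → ES N → ℝ) (ν c₀ : ℝ) : Prop where
  coeff : ∀ n, BoundedCoeff (q n) (b n) (c n) ν c₀
  loc : ∀ R, ∃ K, ∀ᶠ n in atTop, ∀ α β, CoeffBound (q n) (b n) (c n) 3 K α β R
  eq : ∀ i j, TimeEqui univ fun n t => q n t i j
  eb : ∀ j, TimeEqui univ fun n t => b n t j
  ec : TimeEqui univ c
  lq : ∀ i j t x, Tendsto (fun n => q n t i j x) atTop (𝓝 (Q t i j x))
  lb : ∀ j t x, Tendsto (fun n => b n t j x) atTop (𝓝 (B t j x))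
  lc : ∀ t x, Tendsto (fun n => c n t x) atTop (𝓝 (C t x))

variable {q : ℕ → ℝ → Fin N → Fin N → ES N → ℝ} {b : ℕ → ℝ → Fin N → ES N → ℝ}
  {c : ℕ → ℝ → ES N → ℝ} {Q : ℝ → Fin N → Fin N → ES N → ℝ} {B : ℝ → Fin N → ES N → ℝ}
  {C : ℝ → ES N → ℝ} {ν c₀ α S M : ℝ} {u : ℕ → ℝ → ES N → ℝ} {f : ES N → ℝ}

lemma ApproxCoeff.locBdd (h : ApproxCoeff q b c Q B C ν c₀) (J : Set ℝ) :
    (∀ i j, LocBdd J fun n t => q n t i j) ∧ (∀ j, LocBdd J fun n t => b n t j) ∧ LocBdd J c := by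
  refine ⟨fun i j R => ?_, fun j R => ?_, fun R => ?_⟩ <;> obtain ⟨K, hK⟩ := h.loc R <;>
    refine ⟨K, hK.mono fun n hn t ht x hx => ?_⟩ <;>
    have := hn t t [] (by simp) t ⟨le_rfl, le_rfl⟩ x hx
  exacts [this.1 i j, this.2.1 j, this.2.2]

lemma TimeEqui.mono {J J' : Set ℝ} {g : ℕ → ℝ → ES N → ℝ} (h : TimeEqui J g) (hJ : J' ⊆ J) :
    TimeEqui J' g := fun R ε hε => (h R ε hε).imp fun _ hδ =>
  ⟨hδ.1, hδ.2.mono fun _ hn t ht t' ht' => hn t (hJ ht) t' (hJ ht')⟩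

lemma ApproxCoeff.locBdd_pdl (h : ApproxCoeff q b c Q B C ν c₀)
    (hu : ∀ n, SmoothSol (q n) (b n) (c n) ν (u n) 0 S)
    (hM : ∀ n, ∀ t ∈ Icc 0 S, ∀ x, |u n t x| ≤ M) (hα : 0 < α) (I : List (Fin N))
    (hI : I.length ≤ 3) : LocBdd (Icc α S) fun n t => pdl I (u n t) := by
  intro R
  rcases lt_or_ge S α with hS | hS
  · exact ⟨0, Eventually.of_forall fun n t ht => absurd (ht.1.trans ht.2) hS.not_ge⟩
  obtain ⟨K, hK⟩ := h.loc (|R| + 1)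
  obtain ⟨C, hC⟩ := exists_interior_bound (N := N) (α := 0) (α' := α) (β := S) (R := |R| + 1)
    (R' := |R|) (K := max 0 (max K M)) (h.coeff 0).pos (le_max_left _ _) 3 hα hS (abs_nonneg _)
    (by linarith)
  refine ⟨C, hK.mono fun n hn t ht x hx => ?_⟩
  exact hC (q n) (b n) (c n) (u n) (hu n) ((hn 0 S).mono le_rfl
    ((le_max_left _ _).trans (le_max_right _ _)) le_rfl le_rfl) (fun t ht x _ => (hM n t ht x).trans
      ((le_max_right _ _).trans (le_max_right _ _))) I hI t ht x
    (closedBall_subset_closedBall (le_abs_self R) hx)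

lemma ApproxCoeff.timeEqui_sol (h : ApproxCoeff q b c Q B C ν c₀)
    (hu : ∀ n, SmoothSol (q n) (b n) (c n) ν (u n) 0 S)
    (hM : ∀ n, ∀ t ∈ Icc 0 S, ∀ x, |u n t x| ≤ M) (hα : 0 < α) : TimeEqui (Icc α S) u := by
  intro R ε hε
  obtain ⟨h1, h2, h3⟩ := h.locBdd (Icc α S)
  obtain ⟨L, hL, h4⟩ := (LocBdd.ell h1 h2 h3 fun I hI =>
    h.locBdd_pdl hu hM hα I (by omega)).exists_pos R
  refine ⟨ε / L, by positivity, h4.mono fun n hn t ht t' ht' htt x hx => ?_⟩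
  have hsub : Icc α S ⊆ Icc 0 S := Icc_subset_Icc_left hα.le
  have := (convex_Icc α S).norm_image_sub_le_of_norm_hasDerivWithin_le
    (fun τ hτ => ((hu n).eqn τ (hsub hτ) x).mono hsub) (fun τ hτ => hn τ hτ x hx) ht' ht
  refine this.trans ?_
  rw [Real.norm_eq_abs]
  have := mul_lt_mul_of_pos_left htt hL
  rw [mul_div_cancel₀ _ hL.ne'] at this
  exact this.le

lemma ApproxCoeff.hasDerivWithinAt_ulim (h : ApproxCoeff q b c Q B C ν c₀)
    (hu : ∀ n, SmoothSol (q n) (b n) (c n) ν (u n) 0 S)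
    (hM : ∀ n, ∀ t ∈ Icc 0 S, ∀ x, |u n t x| ≤ M) (hα : 0 < α) {t : ℝ} (ht : t ∈ Icc α S) (x : ES N) :
    HasDerivWithinAt (fun t' => ulim u t' x) (ell Q B C t (ulim u t) x) (Icc α S) t := by
  have hb := h.locBdd_pdl hu hM hα
  have he := h.timeEqui_sol hu hM hα
  obtain ⟨h1, h2, h3⟩ := h.locBdd (Icc α S)
  have hE := TimeEqui.ell h1 h2 h3 (fun I hI => hb I (by omega))
    (fun i j => (h.eq i j).mono (subset_univ _)) (fun j => (h.eb j).mono (subset_univ _))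
    (h.ec.mono (subset_univ _)) fun I hI =>
      TimeEqui.pdl (m := 2) (fun n t _ => (hu n).su t) he hb I hI
  refine ulim_solution (m := 2) le_rfl (fun n t _ => (hu n).su t) hb he ht (h.lq · · t x) (h.lb · t x)
    (h.lc t x) fun ε hε => ?_
  obtain ⟨δ, hδ, hE⟩ := hE ‖x‖ ε hε
  refine ⟨δ, hδ, 0, tendsto_const_nhds, hE.mono fun n hn t' ht' htt => ?_⟩
  have hsub : Icc α S ⊆ Icc 0 S := Icc_subset_Icc_left hα.le
  set E := ell (q n) (b n) (c n) t (u n t) x with hEdef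
  have hcvx : Convex ℝ (Icc α S ∩ ball t δ) := (convex_Icc α S).inter (convex_ball t δ)
  have := hcvx.norm_image_sub_le_of_norm_hasDerivWithin_le (C := ε)
    (f := fun τ => u n τ x - τ * E)
    (f' := fun τ => ell (q n) (b n) (c n) τ (u n τ) x - 1 * E)
    (fun τ hτ => (((hu n).eqn τ (hsub hτ.1) x).mono (inter_subset_left.trans hsub)).sub
      ((hasDerivWithinAt_id τ _).mul_const E))
    (fun τ hτ => by
      rw [one_mul]
      exact hn τ hτ.1 t ht (by simpa [Real.dist_eq] using hτ.2) x (by simp))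
    ⟨ht, mem_ball_self hδ⟩ ⟨ht', by simpa [Real.dist_eq] using htt⟩
  rw [Real.norm_eq_abs, Real.norm_eq_abs] at this
  simp only [Pi.zero_apply, add_zero]
  refine (le_of_eq ?_).trans this
  congr 1
  ring

lemma continuousOn_Ioc_prod {g : ℝ × ES N → ℝ}
    (h : ∀ α, 0 < α → ContinuousOn g (Icc α S ×ˢ univ)) : ContinuousOn g (Ioc 0 S ×ˢ univ) := by
  rintro ⟨t, x⟩ ⟨ht, -⟩
  refine (h (t / 2) (by linarith [ht.1]) (t, x) ⟨⟨by linarith [ht.1], ht.2⟩, mem_univ _⟩).mono_of_mem_nhdsWithin ?_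
  have h1 : Ioi (t / 2) ×ˢ (univ : Set (ES N)) ∈ 𝓝 (t, x) :=
    prod_mem_nhds (Ioi_mem_nhds (by linarith [ht.1])) univ_mem
  filter_upwards [self_mem_nhdsWithin, mem_nhdsWithin_of_mem_nhds h1] with p hp hp'
  exact ⟨⟨(le_of_lt hp'.1), hp.1.2⟩, mem_univ _⟩

end Approximation

/-! ### Attainment of the initial datum -/

section InitialLayer

variable {N : ℕ}

/-- The squared distance to `x₀`. -/
def distSq (x₀ x : ES N) : ℝ := ∑ k, (x k - x₀ k) ^ 2

lemma distSq_eq (x₀ x : ES N) : distSq x₀ x = ‖x - x₀‖ ^ 2 := by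
  rw [EuclideanSpace.norm_sq_eq, distSq]
  simp

lemma contDiff_distSq (x₀ : ES N) : Smooth (distSq x₀) := by
  unfold Smooth distSq
  fun_prop

lemma pd1_distSq (x₀ : ES N) (i : Fin N) : pd1 (distSq x₀) i = fun x => 2 * (x i - x₀ i) := by
  ext x
  have h : ∀ k, HasFDerivAt (fun y : ES N => (y k - x₀ k) ^ 2)
      ((2 * (x k - x₀ k)) • (EuclideanSpace.proj k : ES N →L[ℝ] ℝ)) x := fun k => by
    have := (((EuclideanSpace.proj k : ES N →L[ℝ] ℝ).hasFDerivAt (x := x)).sub_const (x₀ k)).pow 2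
    simpa using this
  have := HasFDerivAt.fun_sum (u := Finset.univ) fun k _ => h k
  change fderiv ℝ (fun x => ∑ k, (x k - x₀ k) ^ 2) x _ = _
  rw [this.fderiv]
  simp

lemma pdl_distSq (x₀ : ES N) (i j : Fin N) (x : ES N) :
    pdl [i, j] (distSq x₀) x = if i = j then 2 else 0 := by
  have h : HasFDerivAt (fun x : ES N => 2 * (x j - x₀ j))
      ((2 : ℝ) • (EuclideanSpace.proj j : ES N →L[ℝ] ℝ)) x :=
    (((EuclideanSpace.proj j : ES N →L[ℝ] ℝ).hasFDerivAt (x := x)).sub_const (x₀ j)).const_mul 2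
  simp only [pdl_cons, pdl_nil, pd1_distSq]
  rw [pd1, h.fderiv]
  simp [eq_comm]

lemma SmoothSol.initial_layer {q : ℝ → Fin N → Fin N → ES N → ℝ} {b : ℝ → Fin N → ES N → ℝ}
    {c : ℝ → ES N → ℝ} {u : ℝ → ES N → ℝ} {ν K M R S r ε σ a : ℝ} {x₀ : ES N} (hν : 0 < ν)
    (hu : SmoothSol q b c ν u 0 S) (hK : CoeffBound q b c 0 K 0 S R)
    (hM : ∀ t ∈ Icc 0 S, ∀ x, |u t x| ≤ M) (hσ : |σ| = 1) (ha : |a| ≤ M) (hr : 0 < r) (hr1 : r ≤ 1)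
    (hx : closedBall x₀ r ⊆ closedBall 0 R) (hε : 0 ≤ ε)
    (h0 : ∀ x ∈ closedBall x₀ r, σ * (u 0 x - a) ≤ ε) :
    ∀ t ∈ Icc 0 S, σ * (u t x₀ - a) ≤ ε + (2 * M / r ^ 2 * (4 * N * K) + K * M + 1) * t := by
  intro t₁ ht₁
  set D := 2 * M / r ^ 2 with hD
  set L := D * (4 * N * K) + K * M + 1 with hL
  have hM0 : 0 ≤ M := (abs_nonneg _).trans ha
  have hD0 : 0 ≤ D := by positivity
  have hb : ∀ t ∈ Icc 0 S, ∀ x ∈ closedBall x₀ r,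
      (∀ i j, |q t i j x| ≤ K) ∧ (∀ j, |b t j x| ≤ K) ∧ |c t x| ≤ K :=
    fun t ht x hxr => hK [] le_rfl t ht x (hx hxr)
  have hK0 : 0 ≤ K := (abs_nonneg _).trans (hb t₁ ht₁ x₀ (mem_closedBall_self hr.le)).2.2
  have hL0 : 0 ≤ L := by positivity
  have key := max_principle (α := 0) (β := S) (r := r) (x₀ := x₀)
    (V := fun t x => σ * u t x - (σ * a + ε + L * t) - D * distSq x₀ x)
    (V' := fun t x => σ * ell q b c t (u t) x - L) (q := q) ?_ ?_ ?_ ?_ ?_ ?_ ?_ ?_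
    t₁ ht₁ x₀ (mem_closedBall_self hr.le)
  · simp only [distSq_eq, sub_self, norm_zero] at key
    linarith
  · have h1 : ContinuousOn (fun p : ℝ × ES N => u p.1 p.2) (Icc 0 S ×ˢ closedBall x₀ r) :=
      (hu.cu []).mono (prod_mono_right (subset_univ _))
    have h2 : Continuous fun p : ℝ × ES N => σ * a + ε + L * p.1 := by fun_prop
    exact ((continuousOn_const.mul h1).sub h2.continuousOn).sub
      (continuous_const.mul ((contDiff_distSq x₀).continuous.comp continuous_snd)).continuousOn
  · intro t _
    exact ((contDiff_const.mul (Smooth.contDiff_two (f := u t) (hu.su t))).sub contDiff_const).sub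
      (contDiff_const.mul (Smooth.contDiff_two (f := distSq x₀) (contDiff_distSq x₀)))
  · intro t ht x _
    have h1 := ((hu.eqn t ⟨ht.1.le, ht.2⟩ x).const_mul σ).sub
      ((((hasDerivAt_id t).const_mul L).const_add (σ * a + ε)).hasDerivWithinAt (s := Icc 0 S))
    exact (h1.sub_const (D * distSq x₀ x)).congr_deriv (by ring)
  · exact fun t _ x i j => hu.symm t i j x
  · exact fun t _ x ξ => (mul_nonneg hν.le (Finset.sum_nonneg fun _ _ => sq_nonneg _)).trans
      (hu.ellip t x ξ)
  · intro t ht x hxb _ hgrad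
    have htI : t ∈ Icc 0 S := ⟨ht.1.le, ht.2⟩
    obtain ⟨b1, b2, b3⟩ := hb t htI x (ball_subset_closedBall hxb)
    have hu2 := Smooth.contDiff_two (f := u t) (hu.su t)
    have hd2 := Smooth.contDiff_two (f := distSq x₀) (contDiff_distSq x₀)
    have hg : ∀ i, σ * pd1 (u t) i x = D * (2 * (x i - x₀ i)) := fun i => by
      have := hgrad i
      rw [pd1_lin (hu2.differentiable (by simp)) (hd2.differentiable (by simp)), pd1_distSq] at this
      linarith
    have h1 : ∑ i, ∑ j, q t i j x * pdl [i, j]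
        (fun x => σ * u t x - (σ * a + ε + L * t) - D * distSq x₀ x) x
        = σ * (∑ i, ∑ j, q t i j x * pdl [i, j] (u t) x) - D * ∑ i, 2 * q t i i x := by
      simp only [pdl_lin hu2 hd2, mul_sub, Finset.sum_sub_distrib, pdl_distSq, Finset.mul_sum]
      congr 1
      · exact Finset.sum_congr rfl fun i _ => Finset.sum_congr rfl fun j _ => by ring
      · refine Finset.sum_congr rfl fun i _ => ?_
        simp
        ring
    have h2 : σ * ∑ j, b t j x * pdl [j] (u t) x = 2 * D * ∑ j, (x - x₀) j * b t j x := by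
      rw [Finset.mul_sum, Finset.mul_sum]
      refine Finset.sum_congr rfl fun j _ => ?_
      simp only [pdl_cons, pdl_nil, PiLp.sub_apply]
      linear_combination b t j x * hg j
    have h3 := (le_abs_self _).trans (abs_sum_mul_le (y := x - x₀) b2)
    have h4 : ‖x - x₀‖ ≤ 1 := (mem_ball_iff_norm.1 hxb).le.trans hr1
    have h5 : ∑ j, (x - x₀) j * b t j x ≤ N * K := by
      refine h3.trans ?_
      have := mul_le_mul_of_nonneg_left h4 (mul_nonneg (Nat.cast_nonneg (α := ℝ) N) hK0)
      linarith
    have h6 : ∑ i, 2 * q t i i x ≤ N * (2 * K) := by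
      calc ∑ i, 2 * q t i i x ≤ ∑ _i : Fin N, 2 * K :=
            Finset.sum_le_sum fun i _ => by linarith [(le_abs_self _).trans (b1 i i)]
        _ = N * (2 * K) := by simp
    have h7 : σ * (c t x * u t x) ≤ K * M := by
      refine (le_abs_self _).trans ?_
      rw [abs_mul, hσ, one_mul, abs_mul]
      exact mul_le_mul b3 (hM t htI x) (abs_nonneg _) hK0
    rw [h1]
    simp only [ell]
    have h8 := mul_le_mul_of_nonneg_left h5 (mul_nonneg zero_le_two hD0)
    have h9 := mul_le_mul_of_nonneg_left h6 hD0
    rw [hL]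
    linarith
  · intro x hxr
    have := h0 x hxr
    have h1 : 0 ≤ D * distSq x₀ x := mul_nonneg hD0 (by rw [distSq_eq]; positivity)
    simp only [mul_zero]
    linarith
  · intro t ht x hxs
    have h1 : D * distSq x₀ x = 2 * M := by
      rw [distSq_eq, mem_sphere_iff_norm.1 hxs, hD]
      field_simp
    have h2 : σ * (u t x - a) ≤ 2 * M := by
      refine (le_abs_self _).trans ?_
      rw [abs_mul, hσ, one_mul]
      exact (abs_sub _ _).trans (by linarith [hM t ht x])
    have h3 := mul_nonneg hL0 ht.1
    linarith

end InitialLayer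

/-! ### The solution obtained in the limit -/

section Limit

variable {N : ℕ} {q : ℕ → ℝ → Fin N → Fin N → ES N → ℝ} {b : ℕ → ℝ → Fin N → ES N → ℝ}
  {c : ℕ → ℝ → ES N → ℝ} {Q : ℝ → Fin N → Fin N → ES N → ℝ} {B : ℝ → Fin N → ES N → ℝ}
  {C : ℝ → ES N → ℝ} {ν c₀ S M : ℝ} {u : ℕ → ℝ → ES N → ℝ} {f : ES N → ℝ}

lemma ApproxCoeff.initial_layer (h : ApproxCoeff q b c Q B C ν c₀)
    (hu : ∀ n, SmoothSol (q n) (b n) (c n) ν (u n) 0 S)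
    (hM : ∀ n, ∀ t ∈ Icc 0 S, ∀ x, |u n t x| ≤ M) (hf : Continuous f) (hfM : ∀ x, |f x| ≤ M)
    (hl : ∀ R, ∀ ε > 0, ∀ᶠ n in atTop, ∀ x ∈ closedBall (0 : ES N) R, |u n 0 x - f x| ≤ ε)
    (R : ℝ) {ε : ℝ} (hε : 0 < ε) :
    ∃ L, ∀ᶠ n in atTop, ∀ t ∈ Icc 0 S, ∀ x ∈ closedBall (0 : ES N) R,
      |u n t x - f x| ≤ 2 * ε + L * t := by
  obtain ⟨K, hK⟩ := h.loc (R + 1)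
  have huc := (isCompact_closedBall (0 : ES N) (R + 1)).uniformContinuousOn_of_continuous
    hf.continuousOn
  obtain ⟨δ, hδ, hd⟩ := Metric.uniformContinuousOn_iff.1 huc ε hε
  set r := min (δ / 2) 1 with hr
  have hr0 : 0 < r := by positivity
  refine ⟨2 * M / r ^ 2 * (4 * N * K) + K * M + 1, ?_⟩
  filter_upwards [hK, hl (R + 1) ε hε] with n hn hn' t ht x hx
  have hxr : closedBall x r ⊆ closedBall 0 (R + 1) := closedBall_subset_closedBall' (by
    have := mem_closedBall.1 hx
    have := min_le_right (δ / 2) 1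
    linarith)
  have h0 : ∀ y ∈ closedBall x r, |u n 0 y - f x| ≤ 2 * ε := fun y hy => by
    have h1 := hn' y (hxr hy)
    have h2 := hd y (hxr hy) x (hxr (mem_closedBall_self hr0.le)) (by
      have := mem_closedBall.1 hy
      have := min_le_left (δ / 2) 1
      linarith)
    rw [Real.dist_eq] at h2
    linarith [abs_sub_le (u n 0 y) (f y) (f x)]
  have key : ∀ σ : ℝ, |σ| = 1 → _ := fun σ hσ => (hu n).initial_layer (σ := σ) (h.coeff n).pos
    (hn 0 S |>.mono (Nat.zero_le _) le_rfl le_rfl le_rfl) (hM n) hσ (hfM x) hr0 (min_le_right _ _) hxr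
    (by positivity : 0 ≤ 2 * ε) (fun y hy => (le_abs_self _).trans (by
      rw [abs_mul, hσ, one_mul]; exact h0 y hy)) t ht
  rw [abs_le]
  constructor
  · linarith [key (-1) (by simp)]
  · linarith [key 1 (by simp)]

theorem ApproxCoeff.exists_limit (hN : 1 ≤ N) (h : ApproxCoeff q b c Q B C ν c₀) (hS : 0 < S)
    (hf : Continuous f) (hfM : ∀ x, |f x| ≤ M) {F : ℕ → ES N → ℝ}
    (hF : ∀ n, UB fun _ : Unit => F n) (hFM : ∀ n x, |F n x| ≤ M)
    (hl : ∀ R, ∀ ε > 0, ∀ᶠ n in atTop, ∀ x ∈ closedBall (0 : ES N) R, |F n x - f x| ≤ ε) :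
    ∃ v : ℝ → ES N → ℝ, (∃ M', ∀ t ∈ Icc 0 S, ∀ x, |v t x| ≤ M') ∧
      ContinuousOn (fun p : ℝ × ES N => v p.1 p.2) (Icc 0 S ×ˢ univ) ∧ (∀ x, v 0 x = f x) ∧
      (∀ t ∈ Ioc 0 S, ContDiff ℝ 2 (v t)) ∧
      (∀ I : List (Fin N), I.length ≤ 2 →
        ContinuousOn (fun p : ℝ × ES N => pdl I (v p.1) p.2) (Ioc 0 S ×ˢ univ)) ∧
      ∀ t ∈ Ioo 0 S, ∀ x, HasDerivAt (fun t' => v t' x) (ell Q B C t (v t) x) t := by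
  choose u hu hu0 huM using fun n => (h.coeff n).exists_smoothSol hN hS.le (hF n) (hFM n)
  set M' := Real.exp (c₀ * S) * M with hM'
  have hMM : M ≤ M' := le_mul_of_one_le_left ((abs_nonneg _).trans (hfM 0))
    (Real.one_le_exp (mul_nonneg (h.coeff 0).c₀_nonneg hS.le))
  have hlb : LocBdd (Icc 0 S) u := fun R => ⟨M', Eventually.of_forall fun n t ht x _ => huM n t ht x⟩
  have hreg := fun α (hα : 0 < α) => ulim_regularity (m := 2) (J := Icc α S) (w := u)
    (fun n t _ => (hu n).su t) (fun I hI => h.locBdd_pdl hu huM hα I hI) (h.timeEqui_sol hu huM hα)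
  have hv0 : ∀ x, ulim u 0 x = f x := fun x => ulim_eq <| by
    refine (Metric.tendsto_atTop'.2 fun ε hε => ?_ : Tendsto (fun n => u n 0 x) atTop _).mono_left hyp_le
    obtain ⟨n₀, hn₀⟩ := eventually_atTop.1 (hl ‖x‖ (ε / 2) (by positivity))
    refine ⟨n₀, fun n hn => ?_⟩
    have := hn₀ n hn.le x (by simp)
    rw [Real.dist_eq, hu0]
    linarith
  have hcont : ∀ I : List (Fin N), I.length ≤ 2 →
      ContinuousOn (fun p : ℝ × ES N => pdl I (ulim u p.1) p.2) (Ioc 0 S ×ˢ univ) :=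
    fun I hI => continuousOn_Ioc_prod fun α hα => ((hreg α hα).2 I hI).2
  refine ⟨ulim u, ⟨M', fun t ht x => ?_⟩, ?_, hv0, fun t ht => ?_, hcont, fun t ht x => ?_⟩
  · exact le_of_tendsto (hlb.tendsto_ulim ht x).abs (Eventually.of_forall fun n => huM n t ht x)
  · rintro ⟨t, x⟩ ⟨ht, -⟩
    rcases ht.1.eq_or_lt with h0 | h0
    · simp only at h0
      subst h0
      rw [Metric.continuousWithinAt_iff]
      intro ε hε
      obtain ⟨L, hL⟩ := h.initial_layer hu huM hf (fun x => (hfM x).trans hMM)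
        (by simpa only [hu0] using hl) (‖x‖ + 1) (ε := ε / 8) (by positivity)
      have hL' : ∀ t ∈ Icc 0 S, ∀ y ∈ closedBall (0 : ES N) (‖x‖ + 1),
          |ulim u t y - f y| ≤ 2 * (ε / 8) + L * t := fun t ht y hy =>
        le_of_tendsto ((hlb.tendsto_ulim ht y).sub_const (f y)).abs
          ((hL.filter_mono hyp_le).mono fun n hn => hn t ht y hy)
      obtain ⟨δ, hδ, hd⟩ := Metric.continuousAt_iff.1 (hf.continuousAt (x := x)) (ε / 4)
        (by positivity)
      refine ⟨min (min δ 1) (ε / (4 * (|L| + 1))), by positivity, ?_⟩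
      rintro ⟨t, y⟩ ⟨ht', -⟩ hty
      simp only [Prod.dist_eq, max_lt_iff, lt_min_iff] at hty
      obtain ⟨⟨⟨-, h2⟩, -, h3⟩, h1, -⟩ := hty
      simp only [Real.dist_eq, sub_zero] at h1 h2 h3 ht' ⊢
      rw [hv0, abs_of_nonneg ht'.1, lt_div_iff₀ (by positivity)] at *
      have h4 := hL' t ht' y (mem_closedBall_zero_iff.2 (by
        have := norm_sub_norm_le y x
        rw [dist_eq_norm] at h3
        linarith))
      have h5 := hd h2
      rw [Real.dist_eq] at h5
      have h6 : L * t ≤ (|L| + 1) * t :=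
        mul_le_mul_of_nonneg_right (by linarith [le_abs_self L]) ht'.1
      linarith [abs_sub_le (ulim u t y) (f y) (f x)]
    · refine (hcont [] (by simp) (t, x) ⟨⟨h0, ht.2⟩, mem_univ _⟩).mono_of_mem_nhdsWithin ?_
      have h1 : Ioi 0 ×ˢ (univ : Set (ES N)) ∈ 𝓝 (t, x) := prod_mem_nhds (Ioi_mem_nhds h0) univ_mem
      filter_upwards [self_mem_nhdsWithin, mem_nhdsWithin_of_mem_nhds h1] with p hp hp'
      exact ⟨⟨hp'.1, hp.1.2⟩, mem_univ _⟩
  · exact (hreg t ht.1).1 t ⟨le_rfl, ht.2⟩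
  · exact (h.hasDerivWithinAt_ulim hu huM (half_pos ht.1) ⟨by linarith [ht.1], ht.2.le⟩ x).hasDerivAt
      (Icc_mem_nhds (by linarith [ht.1]) ht.2)

end Limit

/-! ### Mollification -/

section Mollification

variable {N : ℕ}

lemma eventuallyEq_pdl {f g : ES N → ℝ} {x : ES N} (h : f =ᶠ[𝓝 x] g) (I : List (Fin N)) :
    pdl I f =ᶠ[𝓝 x] pdl I g := by
  induction I with
  | nil => exact h
  | cons i I ih => exact (ih.fderiv (𝕜 := ℝ)).mono fun y hy => by simp only [pdl_cons, pd1, hy]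

lemma HasCompactSupport.pdl {f : ES N → ℝ} (hf : HasCompactSupport f) (I : List (Fin N)) :
    HasCompactSupport (pdl I f) := by
  induction I with
  | nil => exact hf
  | cons i I ih => exact ih.fderiv_apply (𝕜 := ℝ) _

lemma ContDiff.pdl {f : ES N → ℝ} {m : ℕ} (hf : ContDiff ℝ m f) (I : List (Fin N)) {k : ℕ}
    (hk : I.length + k ≤ m) : ContDiff ℝ k (pdl I f) := by
  induction I generalizing k with
  | nil => exact hf.of_le (by exact_mod_cast (by simpa using hk))
  | cons i I ih =>
    refine ContDiff.pd1 (ih (k := k + 1) ?_) (by norm_cast) i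
    rw [List.length_cons] at hk
    omega

lemma pdl_convolution (L : ℝ →L[ℝ] ℝ →L[ℝ] ℝ) {f g : ES N → ℝ} (hf : LocallyIntegrable f volume)
    (hg : HasCompactSupport g) {m : ℕ} (hgs : ContDiff ℝ m g) (I : List (Fin N))
    (hI : I.length ≤ m) :
    _root_.pdl I (convolution f g L volume) = convolution f (_root_.pdl I g) L volume := by
  induction I with
  | nil => rfl
  | cons i I ih =>
    rw [List.length_cons] at hI
    have h1 : ContDiff ℝ 1 (_root_.pdl I g) := by
      exact_mod_cast ContDiff.pdl hgs I (k := 1) hI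
    ext x
    rw [pdl_cons, ih (by omega), _root_.pd1,
      ((HasCompactSupport.pdl hg I).hasFDerivAt_convolution_right L hf h1 x).fderiv,
      convolution_precompR_apply L hf ((HasCompactSupport.pdl hg I).fderiv ℝ)
        (h1.continuous_fderiv (by simp))]
    rfl

variable {φ : ContDiffBump (0 : ES N)} {f g h : ES N → ℝ} {x : ES N} {k : ℝ}

/-- Averaging against a normalized bump function. -/
def avg (φ : ContDiffBump (0 : ES N)) (h : ES N → ℝ) : ES N → ℝ :=
  convolution (φ.normed volume) h (ContinuousLinearMap.mul ℝ ℝ) volume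

lemma avg_apply : avg φ h x = ∫ y, φ.normed volume y * h (x - y) := rfl

lemma integrable_avg (hh : Continuous h) :
    Integrable fun y => φ.normed volume y * h (x - y) := by
  have h1 : Continuous (φ.normed (volume : Measure (ES N))) := φ.continuous_normed
  exact (h1.mul (hh.comp (continuous_const.sub continuous_id))).integrable_of_hasCompactSupport
    φ.hasCompactSupport_normed.mul_right

lemma avg_le (hh : Continuous h) (hk : ∀ y ∈ closedBall x φ.rOut, h y ≤ k) : avg φ h x ≤ k := by
  have h1 : ∫ y, φ.normed volume y * k = k := by
    rw [integral_mul_const, φ.integral_normed, one_mul]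
  rw [avg_apply, ← h1]
  refine integral_mono (integrable_avg hh) (φ.integrable_normed.mul_const k) fun y => ?_
  by_cases hy : y ∈ closedBall 0 φ.rOut
  · refine mul_le_mul_of_nonneg_left (hk _ ?_) (φ.nonneg_normed y)
    rw [mem_closedBall_iff_norm] at hy ⊢
    simpa using hy
  · have : φ.normed volume y = 0 := by
      rw [← Function.notMem_support, φ.support_normed_eq]
      exact fun h => hy (ball_subset_closedBall h)
    simp [this]

lemma avg_sum {ι : Type*} (s : Finset ι) {h : ι → ES N → ℝ} (hh : ∀ a ∈ s, Continuous (h a))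
    (w : ι → ℝ) : avg φ (fun y => ∑ a ∈ s, w a * h a y) x = ∑ a ∈ s, w a * avg φ (h a) x := by
  simp only [avg_apply, ← integral_const_mul]
  rw [← integral_finsetSum s fun a ha => (integrable_avg (hh a ha)).const_mul (w a)]
  congr 1
  ext y
  rw [Finset.mul_sum]
  exact Finset.sum_congr rfl fun a _ => by ring

lemma avg_neg : avg φ (fun y => -h y) x = -avg φ h x := by
  simp only [avg_apply, mul_neg, integral_neg]

lemma avg_sub (hf : Continuous f) (hg : Continuous g) :
    avg φ (fun y => f y - g y) x = avg φ f x - avg φ g x := by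
  simp only [avg_apply, mul_sub]
  exact integral_sub (integrable_avg hf) (integrable_avg hg)

lemma abs_avg_le (hh : Continuous h) (hk : ∀ y ∈ closedBall x φ.rOut, |h y| ≤ k) :
    |avg φ h x| ≤ k := by
  refine abs_le'.2 ⟨avg_le hh fun y hy => (le_abs_self _).trans (hk y hy), ?_⟩
  rw [← avg_neg]
  exact avg_le hh.neg fun y hy => (neg_le_abs _).trans (hk y hy)

lemma abs_avg_sub_le (hh : Continuous h) (hk : ∀ y ∈ closedBall x φ.rOut, |h y - h x| ≤ k) :
    |avg φ h x - h x| ≤ k := by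
  have h1 : avg φ (fun _ => h x) x = h x := by
    rw [avg_apply, integral_mul_const, φ.integral_normed, one_mul]
  have h2 := avg_sub (φ := φ) (x := x) hh (continuous_const (y := h x))
  rw [h1] at h2
  rw [← h2]
  exact abs_avg_le (hh.sub continuous_const) hk

lemma pdl_avg {m : ℕ} (hc : HasCompactSupport h) (hh : ContDiff ℝ m h) (I : List (Fin N))
    (hI : I.length ≤ m) : pdl I (avg φ h) = avg φ (pdl I h) :=
  pdl_convolution _ (φ.continuous_normed).locallyIntegrable hc hh I hI

lemma ub_avg {P : Type*} {h : P → ES N → ℝ} (hh : ∀ p, Continuous (h p))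
    (hk : ∀ p x, |h p x| ≤ k) : UB fun p => avg φ (h p) := by
  have hs : ∀ m : ℕ, ContDiff ℝ m (φ.normed (volume : Measure (ES N))) := fun m =>
    φ.contDiff_normed (n := m)
  have hcs := φ.hasCompactSupport_normed (μ := (volume : Measure (ES N)))
  refine ⟨fun p => ?_, fun I => ⟨(∫ y, |pdl I (φ.normed volume) y|) * k, fun p x => ?_⟩⟩
  · exact hcs.contDiff_convolution_left _ φ.contDiff_normed (hh p).locallyIntegrable
  · have h1 : pdl I (avg φ (h p)) = convolution (pdl I (φ.normed volume)) (h p)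
        (ContinuousLinearMap.mul ℝ ℝ) volume := by
      rw [avg, ← convolution_flip, pdl_convolution _ (hh p).locallyIntegrable hcs (hs _) I le_rfl,
        convolution_flip]
    rw [h1, convolution_def, ← Real.norm_eq_abs, ← integral_mul_const]
    have h2 : Continuous (pdl I (φ.normed (volume : Measure (ES N)))) :=
      (ContDiff.pdl (hs I.length) I (k := 0) le_rfl).continuous
    refine norm_integral_le_of_norm_le
      ((h2.abs.integrable_of_hasCompactSupport (hcs.pdl I).abs).mul_const k) ?_
    refine Eventually.of_forall fun y => ?_
    rw [ContinuousLinearMap.mul_apply', norm_mul]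
    exact mul_le_mul_of_nonneg_left (hk p _) (norm_nonneg _)

variable {a : ℝ → ES N → ℝ} {n : ℕ}

/-- A mollifier supported in the ball of radius `1/(n+1)`. -/
def mollBump (N n : ℕ) : ContDiffBump (0 : ES N) where
  rIn := 1 / (2 * (n + 1))
  rOut := 1 / (n + 1)
  rIn_pos := by positivity
  rIn_lt_rOut := one_div_lt_one_div_of_lt (by positivity) (by linarith [n.cast_nonneg (α := ℝ)])

/-- A cutoff function which is `1` on the ball of radius `n + 1`. -/
def cutBump (N n : ℕ) : ContDiffBump (0 : ES N) where
  rIn := n + 1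
  rOut := n + 2
  rIn_pos := by positivity
  rIn_lt_rOut := by linarith

/-- The function `g` cut off outside a large ball. -/
def cut (n : ℕ) (g : ES N → ℝ) (x : ES N) : ℝ := cutBump N n x * g x

/-- The `n`-th mollification of `g`. -/
def moll (n : ℕ) (g : ES N → ℝ) : ES N → ℝ := avg (mollBump N n) (cut n g)

lemma mollBump_rOut_le : (mollBump N n).rOut ≤ 1 :=
  div_le_one_of_le₀ (by linarith [n.cast_nonneg (α := ℝ)]) (by positivity)

lemma continuous_cut (hg : Continuous g) : Continuous (cut n g) := (cutBump N n).continuous.mul hg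

lemma abs_cut_le : |cut n g x| ≤ |g x| := by
  rw [cut, abs_mul, abs_of_nonneg (cutBump N n).nonneg]
  exact mul_le_of_le_one_left (abs_nonneg _) (cutBump N n).le_one

lemma cut_eventuallyEq (hx : ‖x‖ < n + 1) : cut n g =ᶠ[𝓝 x] g :=
  ((cutBump N n).eventuallyEq_one_of_mem_ball (mem_ball_zero_iff.2 hx)).mono fun y hy => by
    rw [cut, hy, Pi.one_apply, one_mul]

lemma norm_lt_of_mem {R : ℝ} (hx : x ∈ closedBall (0 : ES N) R) {y : ES N}
    (hy : y ∈ closedBall x (mollBump N n).rOut) : y ∈ closedBall (0 : ES N) (R + 1) := by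
  rw [mem_closedBall_zero_iff] at hx ⊢
  have h1 := (mem_closedBall_iff_norm.1 hy).trans mollBump_rOut_le
  linarith [norm_sub_norm_le y x]

lemma moll_le (hg : Continuous g) (hk : 0 ≤ k) (h : ∀ x, g x ≤ k) : moll n g x ≤ k :=
  avg_le (continuous_cut hg) fun y _ => (mul_le_mul_of_nonneg_left (h y) (cutBump N n).nonneg).trans
    (mul_le_of_le_one_left hk (cutBump N n).le_one)

lemma abs_moll_le (hg : Continuous g) (h : ∀ x, |g x| ≤ k) : |moll n g x| ≤ k :=
  abs_avg_le (continuous_cut hg) fun y _ => abs_cut_le.trans (h y)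

lemma moll_sum {ι : Type*} (s : Finset ι) {h : ι → ES N → ℝ} (hh : ∀ a ∈ s, Continuous (h a))
    (w : ι → ℝ) : moll n (fun y => ∑ a ∈ s, w a * h a y) x = ∑ a ∈ s, w a * moll n (h a) x := by
  rw [moll, funext fun y => show cut n (fun y => ∑ a ∈ s, w a * h a y) y
    = ∑ a ∈ s, w a * cut n (h a) y from ?_]
  · exact avg_sum s (fun a ha => continuous_cut (hh a ha)) w
  · rw [cut, Finset.mul_sum]
    exact Finset.sum_congr rfl fun a _ => by rw [cut]; ring

lemma moll_tendsto (hg : Continuous g) (R : ℝ) {ε : ℝ} (hε : 0 < ε) :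
    ∀ᶠ n in atTop, ∀ x ∈ closedBall (0 : ES N) R, |moll n g x - g x| ≤ ε := by
  have huc := (isCompact_closedBall (0 : ES N) (R + 1)).uniformContinuousOn_of_continuous
    hg.continuousOn
  obtain ⟨δ, hδ, hd⟩ := Metric.uniformContinuousOn_iff.1 huc ε hε
  filter_upwards [(tendsto_one_div_add_atTop_nhds_zero_nat (𝕜 := ℝ)).eventually (gt_mem_nhds hδ),
    eventually_gt_atTop ⌈R⌉₊] with n hn hR x hx
  have hRn : R < n := (Nat.le_ceil R).trans_lt (by exact_mod_cast hR)
  have hc : ∀ y ∈ closedBall (0 : ES N) (R + 1), cut n g y = g y := fun y hy =>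
    (cut_eventuallyEq (by linarith [mem_closedBall_zero_iff.1 hy])).eq_of_nhds
  have hx' := closedBall_subset_closedBall (by linarith : R ≤ R + 1) hx
  rw [← hc x hx']
  refine abs_avg_sub_le (continuous_cut hg) fun y hy => ?_
  have hy' := norm_lt_of_mem hx hy
  rw [hc x hx', hc y hy']
  exact (hd y hy' x hx' ((mem_closedBall.1 hy).trans_lt hn)).le

/-- Families of coefficients with locally bounded space derivatives up to the order three, and
locally uniformly continuous in time. -/
structure LocCoeff (a : ℝ → ES N → ℝ) : Prop where
  smooth : ∀ t, ContDiff ℝ 3 (a t)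
  bdd : ∀ R, ∃ K, ∀ I : List (Fin N), I.length ≤ 3 → ∀ t, ∀ x ∈ closedBall (0 : ES N) R,
    |pdl I (a t) x| ≤ K
  time : TimeCont a

lemma LocCoeff.ub (ha : LocCoeff a) (n : ℕ) : UB fun t => moll n (a t) := by
  obtain ⟨K, hK⟩ := ha.bdd (n + 2)
  refine ub_avg (k := max K 0) (fun t => continuous_cut (ha.smooth t).continuous) fun t x => ?_
  by_cases hx : x ∈ closedBall (0 : ES N) (n + 2)
  · exact abs_cut_le.trans ((hK [] (by simp) t x hx).trans (le_max_left _ _))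
  · have : cutBump N n x = 0 := (cutBump N n).zero_of_le_dist (le_of_lt (by
      rw [mem_closedBall, not_le] at hx; exact hx))
    simp [cut, this]

lemma LocCoeff.moll_bdd (ha : LocCoeff a) (R : ℝ) : ∃ K, ∀ᶠ n in atTop, ∀ I : List (Fin N),
    I.length ≤ 3 → ∀ t, ∀ x ∈ closedBall (0 : ES N) R, |pdl I (moll n (a t)) x| ≤ K := by
  obtain ⟨K, hK⟩ := ha.bdd (R + 1)
  refine ⟨K, (eventually_gt_atTop ⌈R⌉₊).mono fun n hR I hI t x hx => ?_⟩
  have hRn : R < n := (Nat.le_ceil R).trans_lt (by exact_mod_cast hR)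
  have hs : ContDiff ℝ 3 (cut n (a t)) := (cutBump N n).contDiff.mul (ha.smooth t)
  have hcs : HasCompactSupport (cut n (a t)) := (cutBump N n).hasCompactSupport.mul_right
  rw [moll, pdl_avg (m := 3) hcs hs I hI]
  refine abs_avg_le (ContDiff.pdl (m := 3) hs I (k := 0) hI).continuous fun y hy => ?_
  have hy' := norm_lt_of_mem hx hy
  rw [(eventuallyEq_pdl (cut_eventuallyEq (by linarith [mem_closedBall_zero_iff.1 hy'])) I).eq_of_nhds]
  exact hK I hI t y hy'

lemma LocCoeff.moll_time (ha : LocCoeff a) (R : ℝ) {ε : ℝ} (hε : 0 < ε) :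
    ∃ δ > 0, ∀ n t t', |t - t'| < δ → ∀ x ∈ closedBall (0 : ES N) R,
      |moll n (a t) x - moll n (a t') x| ≤ ε := by
  obtain ⟨δ, hδ, h⟩ := ha.time (R + 1) ε hε
  refine ⟨δ, hδ, fun n t t' htt x hx => ?_⟩
  have hc := fun t => continuous_cut (n := n) (ha.smooth t).continuous
  rw [moll, moll, ← avg_sub (hc t) (hc t')]
  refine abs_avg_le ((hc t).sub (hc t')) fun y hy => ?_
  have h1 : cut n (a t) y - cut n (a t') y = cut n (fun y => a t y - a t' y) y := by
    simp only [cut]; ring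
  rw [h1]
  exact abs_cut_le.trans (h t t' htt y (norm_lt_of_mem hx hy))

end Mollification

/-! ### Approximation of unbounded coefficients -/

section ApproximatingCoefficients

variable {N : ℕ}

lemma abs_pdl_add_const_le (f : ES N → ℝ) (k : ℝ) (I : List (Fin N)) (x : ES N) :
    |pdl I (fun y => f y + k) x| ≤ |pdl I f x| + |k| := by
  cases I with
  | nil => exact abs_add_le _ _
  | cons i I =>
    have h : pdl (i :: I) (fun y => f y + k) = pdl (i :: I) f := by
      rw [← List.dropLast_append_getLast (List.cons_ne_nil i I), pdl_append, pdl_append]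
      congr 1
      ext y
      simp [pd1, fderiv_add_const]
    rw [h]
    linarith [abs_nonneg k]

lemma LocCoeff.add_const {a : ℝ → ES N → ℝ} (ha : LocCoeff a) (k : ℝ) :
    LocCoeff fun t x => a t x + k where
  smooth t := (ha.smooth t).add contDiff_const
  bdd R := (ha.bdd R).imp' (· + |k|) fun K hK I hI t x hx =>
    (abs_pdl_add_const_le _ _ _ _).trans (by linarith [hK I hI t x hx])
  time R ε hε := (ha.time R ε hε).imp fun δ hδ => ⟨hδ.1, fun t t' htt x hx => by
    rw [add_sub_add_right_eq_sub]; exact hδ.2 t t' htt x hx⟩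

lemma LocCoeff.timeCont_moll {a : ℝ → ES N → ℝ} (ha : LocCoeff a) (n : ℕ) :
    TimeCont fun t => moll n (a t) := fun R _ hε =>
  (ha.moll_time R hε).imp fun _ hδ => ⟨hδ.1, fun t t' htt => hδ.2 n t t' htt⟩

lemma LocCoeff.timeEqui_moll {a : ℝ → ES N → ℝ} (ha : LocCoeff a) :
    TimeEqui univ fun n t => moll n (a t) := fun R _ hε =>
  (ha.moll_time R hε).imp fun _ hδ => ⟨hδ.1, Eventually.of_forall fun n t _ t' _ htt => hδ.2 n t t' htt⟩

lemma tendsto_moll {g : ES N → ℝ} (hg : Continuous g) (x : ES N) :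
    Tendsto (fun n => moll n g x) atTop (𝓝 (g x)) := by
  refine Metric.tendsto_atTop'.2 fun ε hε => ?_
  obtain ⟨n₀, hn₀⟩ := eventually_atTop.1 (moll_tendsto hg ‖x‖ (half_pos hε))
  refine ⟨n₀, fun n hn => ?_⟩
  have := hn₀ n hn.le x (by simp)
  rw [Real.dist_eq]
  linarith

variable {Q : ℝ → Fin N → Fin N → ES N → ℝ} {B : ℝ → Fin N → ES N → ℝ} {C : ℝ → ES N → ℝ} {ν₀ c₀ : ℝ}

/-- Mollification of a diffusion matrix, interpolating with the identity matrix at infinity. -/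
def mollMatrix (Q : ℝ → Fin N → Fin N → ES N → ℝ) (n : ℕ) (t : ℝ) (i j : Fin N) (x : ES N) : ℝ :=
  moll n (fun y => Q t i j y + -(if i = j then 1 else 0)) x + if i = j then 1 else 0

theorem approxCoeff_moll (hQ : ∀ i j, LocCoeff fun t => Q t i j) (hB : ∀ j, LocCoeff fun t => B t j)
    (hC : LocCoeff C) (hs : ∀ t i j x, Q t i j x = Q t j i x) (hν : 0 < ν₀)
    (he : ∀ t x (ξ : Fin N → ℝ), ν₀ * ∑ i, ξ i ^ 2 ≤ ∑ i, ∑ j, Q t i j x * ξ i * ξ j)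
    (hc : ∀ t x, C t x ≤ c₀) :
    ApproxCoeff (mollMatrix Q) (fun n t j => moll n (B t j)) (fun n t => moll n (C t)) Q B C
      (min ν₀ 1) (max c₀ 0) := by
  have hQ' := fun i j => (hQ i j).add_const (-(if i = j then 1 else 0))
  have hB' := fun j t => ((hB j).smooth t).continuous
  have hcont := fun i j t => ((hQ' i j).smooth t).continuous
  refine ⟨fun n => ⟨fun i j => ?_, fun j => (hB j).ub n, hC.ub n, fun i j => ?_,
    fun j => (hB j).timeCont_moll n, hC.timeCont_moll n, fun t i j x => ?_, lt_min hν one_pos,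
    fun t x ξ => ?_, fun t x => ?_, le_max_right _ _⟩, fun R => ?_, fun i j => ?_,
    fun j => (hB j).timeEqui_moll, hC.timeEqui_moll, fun i j t x => ?_,
    fun j t x => tendsto_moll (hB' j t) x, fun t x => tendsto_moll (hC.smooth t).continuous x⟩
  · exact ((hQ' i j).ub n).add (UB.const (C := |if i = j then 1 else 0|) fun _ => le_rfl)
  · intro R ε hε
    refine ((hQ' i j).timeCont_moll n R ε hε).imp fun δ hδ => ⟨hδ.1, fun t t' htt x hx => ?_⟩
    simp only [mollMatrix, add_sub_add_right_eq_sub]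
    exact hδ.2 t t' htt x hx
  · simp only [mollMatrix, hs t i j, eq_comm (a := i)]
  · have h1 := moll_sum (n := n) (x := x) (Finset.univ : Finset (Fin N × Fin N))
      (h := fun p y => Q t p.1 p.2 y + -(if p.1 = p.2 then 1 else 0)) (fun p _ => hcont p.1 p.2 t)
      fun p => -(ξ p.1 * ξ p.2)
    have hid : ∑ i, ∑ j, (if i = j then 1 else 0) * ξ i * ξ j = ∑ i, ξ i ^ 2 := by
      simp [sq]
    have h2 : ∀ y, ∑ p : Fin N × Fin N, -(ξ p.1 * ξ p.2) *
        (Q t p.1 p.2 y + -(if p.1 = p.2 then 1 else 0))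
        = ∑ i, ξ i ^ 2 - ∑ i, ∑ j, Q t i j y * ξ i * ξ j := fun y => by
      rw [← hid, Fintype.sum_prod_type, ← Finset.sum_sub_distrib]
      refine Finset.sum_congr rfl fun i _ => ?_
      rw [← Finset.sum_sub_distrib]
      exact Finset.sum_congr rfl fun j _ => by ring
    have hξ : 0 ≤ ∑ i, ξ i ^ 2 := Finset.sum_nonneg fun _ _ => sq_nonneg _
    have h3 : moll n (fun y => ∑ p : Fin N × Fin N, -(ξ p.1 * ξ p.2) *
        (Q t p.1 p.2 y + -(if p.1 = p.2 then 1 else 0))) x ≤ (1 - min ν₀ 1) * ∑ i, ξ i ^ 2 := by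
      refine moll_le (continuous_finsetSum _ fun p _ => continuous_const.mul (hcont p.1 p.2 t))
        (mul_nonneg (sub_nonneg.2 (min_le_right _ _)) hξ) fun y => ?_
      rw [h2]
      have := mul_le_mul_of_nonneg_right (min_le_left ν₀ 1) hξ
      linarith [he t y ξ]
    rw [h1, Fintype.sum_prod_type] at h3
    have h4 : ∑ i, ∑ j, mollMatrix Q n t i j x * ξ i * ξ j = ∑ i, ξ i ^ 2 - ∑ i, ∑ j,
        -(ξ i * ξ j) * moll n (fun y => Q t i j y + -(if i = j then 1 else 0)) x := by
      rw [← hid, ← Finset.sum_sub_distrib]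
      refine Finset.sum_congr rfl fun i _ => ?_
      rw [← Finset.sum_sub_distrib]
      exact Finset.sum_congr rfl fun j _ => by rw [mollMatrix]; ring
    rw [h4]
    linarith
  · exact moll_le (hC.smooth t).continuous (le_max_right _ _) fun y => (hc t y).trans (le_max_left _ _)
  · choose Kq hKq using fun i j => (hQ' i j).moll_bdd R
    choose Kb hKb using fun j => (hB j).moll_bdd R
    obtain ⟨Kc, hKc⟩ := hC.moll_bdd R
    refine ⟨(∑ i, ∑ j, (|Kq i j| + 1)) + (∑ j, |Kb j|) + |Kc|, ?_⟩
    filter_upwards [eventually_all.2 fun i => eventually_all.2 fun j => hKq i j,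
      eventually_all.2 hKb, hKc] with n h1 h2 h3 α β I hI t _ x hx
    have p1 : 0 ≤ ∑ i, ∑ j, (|Kq i j| + 1) := by positivity
    have p2 : 0 ≤ ∑ j, |Kb j| := by positivity
    refine ⟨fun i j => ?_, fun j => ?_, ?_⟩
    · have e1 : |Kq i j| + 1 ≤ ∑ j, (|Kq i j| + 1) :=
        Finset.single_le_sum (f := fun j => |Kq i j| + 1) (fun _ _ => by positivity)
          (Finset.mem_univ j)
      have e2 : ∑ j, (|Kq i j| + 1) ≤ ∑ i, ∑ j, (|Kq i j| + 1) :=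
        Finset.single_le_sum (f := fun i => ∑ j, (|Kq i j| + 1)) (fun _ _ => by positivity)
          (Finset.mem_univ i)
      have e3 := abs_pdl_add_const_le
        (moll n (fun y => Q t i j y + -(if i = j then 1 else 0))) (if i = j then 1 else 0) I x
      have e4 : |(if i = j then 1 else 0 : ℝ)| ≤ 1 := by split_ifs <;> simp
      have e5 := h1 i j I hI t x hx
      have e6 : |pdl I (mollMatrix Q n t i j) x| ≤ _ := e3
      linarith [le_abs_self (Kq i j), abs_nonneg Kc]
    · have e1 : |Kb j| ≤ ∑ j, |Kb j| :=
        Finset.single_le_sum (f := fun j => |Kb j|) (fun _ _ => abs_nonneg _) (Finset.mem_univ j)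
      linarith [h2 j I hI t x hx, le_abs_self (Kb j), abs_nonneg Kc]
    · linarith [h3 I hI t x hx, le_abs_self Kc]
  · intro R ε hε
    refine ((hQ' i j).timeEqui_moll R ε hε).imp fun δ hδ => ⟨hδ.1, hδ.2.mono fun n hn t ht t' ht' htt
      x hx => ?_⟩
    simp only [mollMatrix, add_sub_add_right_eq_sub]
    exact hn t ht t' ht' htt x hx
  · have := (tendsto_moll (hcont i j t) x).add_const (if i = j then 1 else 0)
    rwa [neg_add_cancel_right] at this

end ApproximatingCoefficients

/-! ### Locally Hölder continuous coefficients -/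

section HolderCoefficients

variable {N : ℕ} {a : ℝ → ES N → ℝ} {T δ : ℝ}

lemma LocCoeff.continuous (ha : LocCoeff a) : Continuous fun p : ℝ × ES N => a p.1 p.2 := by
  refine continuous_iff_continuousAt.2 fun p => Metric.continuousAt_iff'.2 fun ε hε => ?_
  obtain ⟨δ, hδ, h⟩ := ha.time (‖p.2‖ + 1) (ε / 2) (half_pos hε)
  have h1 : ∀ᶠ z : ℝ × ES N in 𝓝 p, |z.1 - p.1| < δ := by
    have := (continuous_fst (X := ℝ) (Y := ES N)).continuousAt (x := p)
    exact this.eventually (Metric.ball_mem_nhds _ hδ)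
  have h2 : ∀ᶠ z : ℝ × ES N in 𝓝 p, dist (a p.1 z.2) (a p.1 p.2) < ε / 2 :=
    Metric.tendsto_nhds.1
      (((ha.smooth p.1).continuous.comp continuous_snd).continuousAt (x := p)) _ (half_pos hε)
  have h3 : ∀ᶠ z : ℝ × ES N in 𝓝 p, ‖z.2‖ < ‖p.2‖ + 1 :=
    (continuous_snd.norm.continuousAt (x := p)).eventually_lt continuousAt_const (by simp)
  filter_upwards [h1, h2, h3] with z hz1 hz2 hz3
  have := h z.1 p.1 hz1 z.2 (mem_closedBall_zero_iff.2 hz3.le)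
  rw [← Real.dist_eq] at this
  linarith [dist_triangle (a z.1 z.2) (a p.1 z.2) (a p.1 p.2)]

lemma ParabolicHolderOn.exists_bound {R : ℝ} (h : ParabolicHolderOn T δ R a) (hT : 0 ≤ T)
    (hδ : 0 < δ) (hR : 0 ≤ R) : ∃ K, ∀ t ∈ Icc 0 T, ∀ x ∈ closedBall (0 : ES N) R, |a t x| ≤ K := by
  obtain ⟨C, hC⟩ := h
  refine ⟨|a 0 0| + |C| * (T + R ^ 2) ^ (δ / 2), fun t ht x hx => ?_⟩
  have h1 := hC t ht 0 (left_mem_Icc.2 hT) x hx 0 (by simpa using hR)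
  have hx' := mem_closedBall_zero_iff.1 hx
  have h2 : (|t - 0| + ‖x - 0‖ ^ 2) ^ (δ / 2) ≤ (T + R ^ 2) ^ (δ / 2) := by
    rw [sub_zero, sub_zero, abs_of_nonneg ht.1]
    refine Real.rpow_le_rpow (by linarith [ht.1, sq_nonneg ‖x‖]) ?_ (by positivity)
    gcongr
    exact ht.2
  have h3 := mul_le_mul (le_abs_self C) h2 (by positivity) (abs_nonneg C)
  linarith [abs_sub_abs_le_abs_sub (a t x) (a 0 0)]

lemma ParabolicHolderOn.time_continuity {R : ℝ} (h : ParabolicHolderOn T δ R a) (hδ : 0 < δ)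
    {ε : ℝ} (hε : 0 < ε) : ∃ η > 0, ∀ t ∈ Icc 0 T, ∀ t' ∈ Icc 0 T, |t - t'| < η →
      ∀ x ∈ closedBall (0 : ES N) R, |a t x - a t' x| ≤ ε := by
  obtain ⟨C, hC⟩ := h
  have hlim : Tendsto (fun r : ℝ => C * |r| ^ (δ / 2)) (𝓝 0) (𝓝 0) := by
    have : Continuous fun r : ℝ => C * |r| ^ (δ / 2) :=
      continuous_const.mul (continuous_abs.rpow_const fun _ => Or.inr (by positivity))
    simpa [Real.zero_rpow (half_pos hδ).ne'] using this.tendsto 0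
  obtain ⟨η, hη, h⟩ := Metric.eventually_nhds_iff.1 (hlim.eventually (gt_mem_nhds hε))
  refine ⟨η, hη, fun t ht t' ht' htt x hx => (hC t ht t' ht' x hx x hx).trans ?_⟩
  simpa using (h (y := t - t') (by simpa [Real.dist_eq] using htt)).le

lemma abs_projIcc_sub_le (hT : 0 ≤ T) (t r : ℝ) :
    |(projIcc 0 T hT t : ℝ) - projIcc 0 T hT r| ≤ |t - r| := by
  simpa [Real.dist_eq, Subtype.dist_eq] using (LipschitzWith.projIcc hT).dist_le_mul t r

/-- Coefficients on `[0, T]`, shifted in time by `s` and frozen outside of `[0, T]`. -/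
lemma LocCoeff.of_holder (hT : 0 ≤ T) (hδ : 0 < δ) (s : ℝ) (h : ∀ t ∈ Icc 0 T, ContDiff ℝ 3 (a t))
    (h0 : ∀ R > 0, ParabolicHolderOn T δ R a)
    (h1 : ∀ R > 0, ∀ i, ParabolicHolderOn T δ R fun t => pd1 (a t) i)
    (h2 : ∀ R > 0, ∀ i j, ParabolicHolderOn T δ R fun t => pd2 (a t) i j)
    (h3 : ∀ R > 0, ∀ i j k, ParabolicHolderOn T δ R fun t => pd3 (a t) i j k) :
    LocCoeff fun t => a (projIcc 0 T hT (s + t)) where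
  smooth t := h _ (projIcc 0 T hT (s + t)).2
  bdd R := by
    have hp : ∀ I : List (Fin N), I.length ≤ 3 →
        ParabolicHolderOn T δ (|R| + 1) fun t => pdl I (a t) := fun I hI =>
      match I, hI with
      | [], _ => h0 _ (by positivity)
      | [i], _ => h1 _ (by positivity) i
      | [i, j], _ => h2 _ (by positivity) i j
      | [i, j, k], _ => h3 _ (by positivity) i j k
    choose! K hK using fun I hI => (hp I hI).exists_bound hT hδ (by positivity)
    obtain ⟨L, hL⟩ := ((List.finite_length_le (Fin N) 3).image K).bddAbove
    refine ⟨L, fun I hI t x hx => ?_⟩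
    exact (hK I hI _ (projIcc 0 T hT (s + t)).2 x
      (closedBall_subset_closedBall (by linarith [le_abs_self R]) hx)).trans
      (hL (mem_image_of_mem K hI))
  time R ε hε := by
    obtain ⟨η, hη, h⟩ := (h0 (|R| + 1) (by positivity)).time_continuity hδ hε
    refine ⟨η, hη, fun t t' htt x hx => h _ (projIcc 0 T hT _).2 _ (projIcc 0 T hT _).2 ?_ x
      (closedBall_subset_closedBall (by linarith [le_abs_self R]) hx)⟩
    refine (abs_projIcc_sub_le hT _ _).trans_lt ?_
    rwa [add_sub_add_left_eq_sub]

end HolderCoefficients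

section Existence

variable {N : ℕ} {T : ℝ} {q : ℝ → ES N → Fin N → Fin N → ℝ} {b : ℝ → ES N → Fin N → ℝ}
  {c : ℝ → ES N → ℝ}

lemma Hyp.exists_isBCSol (H : Hyp N T q b c) {s : ℝ} (hs : s ∈ Ico 0 T) {f : ES N → ℝ}
    (hf : Continuous f) {M : ℝ} (hM : ∀ x, |f x| ≤ M) : ∃ u, IsBCSol q b c s T f u := by
  have hT := H.T_pos.le
  have hδ := H.δ_mem.1
  set τ : ℝ → ℝ := fun t => projIcc 0 T hT (s + t) with hτ
  have hτm : ∀ t, τ t ∈ Icc 0 T := fun t => (projIcc 0 T hT (s + t)).2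
  have hτs : ∀ t ∈ Ioc s T, τ (t - s) = t := fun t ht => by
    simp [hτ, projIcc_of_mem hT (⟨hs.1.trans ht.1.le, ht.2⟩ : t ∈ Icc 0 T)]
  have hQ : ∀ i j, LocCoeff fun t x => q (τ t) x i j := fun i j =>
    LocCoeff.of_holder (a := fun t x => q t x i j) hT hδ s (fun t ht => H.smooth_q t ht i j)
      (fun R hR => H.holder_q R hR i j) (fun R hR => H.holder_q1 R hR i j)
      (fun R hR => H.holder_q2 R hR i j) (fun R hR => H.holder_q3 R hR i j)
  have hB : ∀ j, LocCoeff fun t x => b (τ t) x j := fun j =>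
    LocCoeff.of_holder (a := fun t x => b t x j) hT hδ s (fun t ht => H.smooth_b t ht j)
      (fun R hR => H.holder_b R hR j) (fun R hR => H.holder_b1 R hR j)
      (fun R hR => H.holder_b2 R hR j) (fun R hR => H.holder_b3 R hR j)
  have hC : LocCoeff fun t x => c (τ t) x :=
    LocCoeff.of_holder hT hδ s H.smooth_c H.holder_c H.holder_c1 H.holder_c2 H.holder_c3
  have happ := approxCoeff_moll (Q := fun t i j x => q (τ t) x i j) (B := fun t j x => b (τ t) x j)
    (c₀ := H.c₀) hQ hB hC (fun t i j x => H.q_symm _ (hτm t) x i j) H.ν₀_pos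
    (fun t x ξ => by
      have h1 := H.ellip _ (hτm t) x (WithLp.toLp 2 ξ)
      have h2 := H.ν_lb _ (hτm t) x
      rw [EuclideanSpace.real_norm_sq_eq] at h1
      exact (mul_le_mul_of_nonneg_right h2 (Finset.sum_nonneg fun i _ => sq_nonneg _)).trans h1)
    fun t x => H.c_ub _ (hτm t) x
  obtain ⟨v, ⟨M', hvM⟩, hvc, hv0, hvd, hvp, hve⟩ := happ.exists_limit (S := T - s + 1) H.N_pos
    (by linarith [hs.2]) hf hM (F := fun n => moll n f)
    (fun n => ub_avg (fun _ => continuous_cut hf) fun _ x => abs_cut_le.trans (hM x))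
    (fun n x => abs_moll_le hf hM) fun R ε hε => moll_tendsto hf R hε
  have hcc : ∀ t ∈ Icc s T, t - s ∈ Icc 0 (T - s + 1) := fun t ht =>
    ⟨by linarith [ht.1], by linarith [ht.2]⟩
  have hoo : ∀ t ∈ Ioc s T, t - s ∈ Ioo 0 (T - s + 1) := fun t ht =>
    ⟨by linarith [ht.1], by linarith [ht.2]⟩
  have hoc : ∀ t ∈ Ioc s T, t - s ∈ Ioc 0 (T - s + 1) := fun t ht => Ioo_subset_Ioc_self (hoo t ht)
  have hshift : Continuous fun p : ℝ × ES N => (p.1 - s, p.2) := by fun_prop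
  have hpd : ∀ I : List (Fin N), I.length ≤ 2 →
      ContinuousOn (fun p : ℝ × ES N => pdl I (v (p.1 - s)) p.2) (Ioc s T ×ˢ univ) := fun I hI =>
    (hvp I hI).comp hshift.continuousOn fun p hp => ⟨hoc _ hp.1, mem_univ _⟩
  have hder : ∀ t ∈ Ioc s T, ∀ x,
      HasDerivAt (fun t' => v (t' - s) x) (Aop q b c (v (t - s)) t x) t := fun t ht x => by
    have h := (hve _ (hoo t ht) x).comp_sub_const t s
    simp only [ell, hτs t ht] at h
    exact h
  have hcoef : ∀ {a : ℝ → ES N → ℝ}, LocCoeff (fun t => a (τ t)) →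
      ContinuousOn (fun p : ℝ × ES N => a p.1 p.2) (Ioc s T ×ˢ univ) := fun {a} ha =>
    (ha.continuous.comp hshift).continuousOn.congr fun p hp => by
      simp [hτs p.1 hp.1]
  refine ⟨fun t => v (t - s), ⟨M', fun t ht => hvM _ (hcc t ht)⟩,
    hvc.comp hshift.continuousOn fun p hp => ⟨hcc _ hp.1, mem_univ _⟩, fun t ht => hvd _ (hoc t ht),
    fun x t ht => (hder t ht x).differentiableAt, ?_, fun i => hpd [i] (by simp),
    fun i j => hpd [i, j] (by simp), fun t ht x => (hder t ht x).deriv, fun x => by simp [hv0]⟩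
  refine ContinuousOn.congr (f := fun p : ℝ × ES N => Aop q b c (v (p.1 - s)) p.1 p.2) ?_
    fun p hp => (hder p.1 hp.1 p.2).deriv
  simp only [Aop]
  refine ((continuousOn_finsetSum _ fun i _ => continuousOn_finsetSum _ fun j _ => ?_).add
    (continuousOn_finsetSum _ fun j _ => ?_)).add ?_
  · exact (hcoef (a := fun t x => q t x i j) (hQ i j)).mul (hpd [i, j] (by simp))
  · exact (hcoef (a := fun t x => b t x j) (hB j)).mul (hpd [j] (by simp))
  · exact (hcoef (a := c) hC).mul (hpd [] (by simp))

end Existence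

/-- Theorem 3.2 of the paper. Under Hypotheses (H), for every `s ∈ [0,T)` and
every `f ∈ C_b(ℝ^N)`, the homogeneous Cauchy problem `D_t u = 𝒜 u` on `(s,T] × ℝ^N`,
`u(s,·) = f`, admits a unique bounded classical solution `u`; moreover
`‖u(t,·)‖_∞ ≤ e^{c₀ (t-s)} ‖f‖_∞` for every `t ∈ [s,T]` (formulated as: every sup bound `M`
for `f` yields the bound `e^{c₀(t-s)} M` for `u(t,·)`). -/
theorem existence_uniqueness_homogeneous {N : ℕ} {T : ℝ} {q : ℝ → ES N → Fin N → Fin N → ℝ}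
    {b : ℝ → ES N → Fin N → ℝ} {c : ℝ → ES N → ℝ} (H : Hyp N T q b c)
    (s : ℝ) (hs : s ∈ Ico (0:ℝ) T) (f : ES N → ℝ)
    (hf_cont : Continuous f) (hf_bdd : ∃ M, ∀ x, |f x| ≤ M) :
    ∃ u : ℝ → ES N → ℝ, IsBCSol q b c s T f u ∧
      (∀ v : ℝ → ES N → ℝ, IsBCSol q b c s T f v → ∀ t ∈ Icc s T, ∀ x, v t x = u t x) ∧
      (∀ M : ℝ, (∀ x, |f x| ≤ M) →
        ∀ t ∈ Icc s T, ∀ x, |u t x| ≤ Real.exp (H.c₀ * (t - s)) * M) := by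
  obtain ⟨M, hM⟩ := hf_bdd
  obtain ⟨u, hu⟩ := H.exists_isBCSol hs hf_cont hM
  refine ⟨u, hu, fun v hv t ht x => ?_, fun M hM => hu.abs_le_exp_mul H hs hM⟩
  have h := (hv.sub hu).abs_le_exp_mul H hs (M := 0) (fun x => by simp) t ht x
  rw [mul_zero] at h
  exact sub_eq_zero.1 (abs_nonpos_iff.1 h)
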